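/- Let F, G be Borel subsets of ℝ with finite Lebesgue measure, and let f be a bounded measurable function on ℝ with |f| ≤ 1_F. Then |∫_G T f(x) dx| ≤ C |F|^{1/2} |G|^{1/2}, where C = 2^{474·4³} (the constant C_{a,q} = 2^{474a³}/(q−1)⁶ with a = 4, q = 2). -/

import Mathlib

open MeasureTheory
open scoped Real ENNReal NNReal

/-- The Hilbert-type kernel `κ`: `κ(x) = (1 - |x|)/(1 - e^{ix})` for `0 < |x| < 1`,
and `κ(x) = 0` otherwise. -/
noncomputable def hilbertKernel (x : ℝ) : ℂ :=
  if 0 < |x| ∧ |x| < 1 then (1 - |x|) / (1 - Complex.exp (Complex.I * x)) else 0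

/-- The real Carleson operator
`T f(x) = sup_{n ∈ ℤ} sup_{r > 0} |∫_{r < |x - y| < 1} f(y) κ(x - y) e^{iny} dy|`. -/
noncomputable def carlesonOperatorReal (f : ℝ → ℂ) (x : ℝ) : ℝ≥0∞ :=
  ⨆ (n : ℤ) (r : ℝ) (_ : 0 < r),
    (‖∫ y in {y : ℝ | r < |x - y| ∧ |x - y| < 1},
        f y * hilbertKernel (x - y) * Complex.exp (Complex.I * (n : ℂ) * (y : ℂ))‖₊ : ℝ≥0∞)

namespace Carl
open Complex (I)

/-- band-limited functions -/
def BL (g : ℝ → ℂ) (a b : ℝ) : Prop :=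
  ∃ h : ℝ → ℂ, Integrable h ∧ (∀ ξ, ξ ∉ Set.Icc a b → h ξ = 0) ∧
    ∀ t : ℝ, g t = ∫ ξ, h ξ * Complex.exp (I * ξ * t)

lemma norm_expI (x y : ℝ) : ‖Complex.exp (I * x * y)‖ = 1 := by
  have : I * (x:ℂ) * y = ((x * y : ℝ) : ℂ) * I := by push_cast; ring
  rw [this, Complex.norm_exp_ofReal_mul_I]

lemma integrable_mul_exp {h : ℝ → ℂ} (hh : Integrable h) (t : ℝ) :
    Integrable (fun ξ : ℝ => h ξ * Complex.exp (I * ξ * t)) := by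
  refine hh.mul_bdd (c := 1) ?_ ?_
  · exact (by fun_prop : Continuous fun ξ : ℝ => Complex.exp (I * ξ * t)).aestronglyMeasurable
  · exact Filter.Eventually.of_forall fun ξ => (norm_expI ξ t).le

lemma BL.mono {g : ℝ → ℂ} {a b a' b' : ℝ} (h : BL g a b) (h1 : a' ≤ a) (h2 : b ≤ b') :
    BL g a' b' := by
  obtain ⟨k, k1, k2, k3⟩ := h
  exact ⟨k, k1, fun ξ hξ => k2 ξ fun h => hξ ⟨h1.trans h.1, h.2.trans h2⟩, k3⟩

lemma BL.continuous {g : ℝ → ℂ} {a b : ℝ} (h : BL g a b) : Continuous g := by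
  obtain ⟨k, k1, k2, k3⟩ := h
  have : g = fun t : ℝ => ∫ ξ, k ξ * Complex.exp (I * ξ * t) := funext k3
  rw [this]
  refine continuous_of_dominated (bound := fun ξ => ‖k ξ‖) ?_ ?_ k1.norm ?_
  · intro t; exact (integrable_mul_exp k1 t).aestronglyMeasurable
  · intro t; refine Filter.Eventually.of_forall fun ξ => ?_
    simp [norm_expI]
  · refine Filter.Eventually.of_forall fun ξ => ?_
    fun_prop

lemma BL.zero (a b : ℝ) : BL (fun _ => 0) a b :=
  ⟨fun _ => 0, integrable_zero _ _ _, fun _ _ => rfl, fun t => by simp⟩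

lemma BL.add {g g' : ℝ → ℂ} {a b : ℝ} (h : BL g a b) (h' : BL g' a b) :
    BL (fun t => g t + g' t) a b := by
  obtain ⟨k, k1, k2, k3⟩ := h
  obtain ⟨l, l1, l2, l3⟩ := h'
  refine ⟨fun ξ => k ξ + l ξ, k1.add l1, fun ξ hξ => by simp [k2 ξ hξ, l2 ξ hξ], fun t => ?_⟩
  beta_reduce
  rw [k3, l3, ← integral_add (integrable_mul_exp k1 t) (integrable_mul_exp l1 t)]
  simp [add_mul]

lemma BL.const_mul {g : ℝ → ℂ} {a b : ℝ} (h : BL g a b) (c : ℂ) :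
    BL (fun t => c * g t) a b := by
  obtain ⟨k, k1, k2, k3⟩ := h
  refine ⟨fun ξ => c * k ξ, k1.const_mul c, fun ξ hξ => by simp [k2 ξ hξ], fun t => ?_⟩
  beta_reduce
  rw [k3, ← integral_const_mul]
  simp [mul_assoc]

lemma BL.sub {g g' : ℝ → ℂ} {a b : ℝ} (h : BL g a b) (h' : BL g' a b) :
    BL (fun t => g t - g' t) a b := by
  simpa [sub_eq_add_neg] using h.add (h'.const_mul (-1))

lemma BL.sum {ι : Type*} (s : Finset ι) {g : ι → ℝ → ℂ} {a b : ℝ} (h : ∀ i ∈ s, BL (g i) a b) :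
    BL (fun t => ∑ i ∈ s, g i t) a b := by
  classical
  induction s using Finset.induction_on with
  | empty => simpa using BL.zero a b
  | insert i s hi ih =>
    simp only [Finset.sum_insert hi]
    exact (h i (by simp)).add (ih fun j hj => h j (by simp [hj]))

lemma BL.mul {g g' : ℝ → ℂ} {a b a' b' : ℝ} (h : BL g a b) (h' : BL g' a' b') :
    BL (fun t => g t * g' t) (a + a') (b + b') := by
  obtain ⟨k, k1, k2, k3⟩ := h
  obtain ⟨l, l1, l2, l3⟩ := h'
  refine ⟨fun ζ => ∫ ξ, k ξ * l (ζ - ξ), ?_, ?_, ?_⟩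
  · exact k1.integrable_convolution (ContinuousLinearMap.mul ℂ ℂ) l1
  · intro ζ hζ; try beta_reduce
    rw [integral_eq_zero_of_ae]
    refine Filter.Eventually.of_forall fun ξ => ?_
    by_cases h1 : ξ ∈ Set.Icc a b
    · have : ζ - ξ ∉ Set.Icc a' b' := fun h2 => hζ ⟨by linarith [h1.1, h2.1], by linarith [h1.2, h2.2]⟩
      simp [l2 _ this]
    · simp [k2 _ h1]
  · intro t; try beta_reduce
    have := integral_convolution (μ := volume) (ν := volume) (ContinuousLinearMap.mul ℂ ℂ)
      (integrable_mul_exp k1 t) (integrable_mul_exp l1 t)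
    rw [k3, l3]
    simp only [ContinuousLinearMap.mul_apply'] at this
    rw [← this]
    congr 1; ext ζ
    simp only [convolution, ContinuousLinearMap.mul_apply']
    rw [← integral_mul_const]
    congr 1; ext ξ
    have : Complex.exp (I * ζ * t) = Complex.exp (I * ξ * t) * Complex.exp (I * ((ζ - ξ : ℝ):ℂ) * t) := by
      rw [← Complex.exp_add]; congr 1; push_cast; ring
    rw [this]; ring

lemma BL.conj {g : ℝ → ℂ} {a b : ℝ} (h : BL g a b) :
    BL (fun t => (starRingEnd ℂ) (g t)) (-b) (-a) := by
  obtain ⟨k, k1, k2, k3⟩ := h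
  refine ⟨fun ξ => (starRingEnd ℂ) (k (-ξ)), ?_, ?_, ?_⟩
  · have := k1.comp_neg
    exact (Complex.conjCLE.toContinuousLinearMap.integrable_comp this)
  · intro ξ hξ; try beta_reduce
    rw [k2, map_zero]
    intro h; exact hξ ⟨by linarith [h.2], by linarith [h.1]⟩
  · intro t; try beta_reduce
    rw [k3, ← integral_conj, ← integral_neg_eq_self]
    congr 1; ext ξ
    rw [map_mul, ← Complex.exp_conj]
    congr 2
    simp

/-- composition with an increasing affine map -/
lemma BL.affine {g : ℝ → ℂ} {a b : ℝ} (h : BL g a b) {c : ℝ} (hc : 0 < c) (d : ℝ) :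
    BL (fun t => g (c * t + d)) (c * a) (c * b) := by
  obtain ⟨k, k1, k2, k3⟩ := h
  refine ⟨fun ξ => (c:ℂ)⁻¹ * (k (ξ / c) * Complex.exp (I * ((ξ / c : ℝ):ℂ) * d)), ?_, ?_, ?_⟩
  · exact ((integrable_mul_exp k1 d).comp_div hc.ne').const_mul _
  · intro ξ hξ; try beta_reduce
    rw [k2]; · simp
    intro h; exact hξ ⟨by have := h.1; rw [le_div_iff₀ hc] at this; linarith,
      by have := h.2; rw [div_le_iff₀ hc] at this; linarith⟩
  · intro t; try beta_reduce
    rw [k3]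
    have := Measure.integral_comp_div (fun ξ : ℝ => k ξ * Complex.exp (I * ξ * ((c * t + d : ℝ):ℂ))) c
    rw [abs_of_pos hc] at this
    have h2 : (∫ ξ, k ξ * Complex.exp (I * ξ * ((c * t + d : ℝ):ℂ))) =
       (c:ℂ)⁻¹ * ∫ ξ : ℝ, k (ξ / c) * Complex.exp (I * ((ξ / c : ℝ):ℂ) * ((c * t + d : ℝ):ℂ)) := by
      rw [this, Complex.real_smul, inv_mul_cancel_left₀]
      exact_mod_cast hc.ne'
    rw [h2, ← integral_const_mul]
    congr 1; ext ξ
    have hc' : (c:ℂ) ≠ 0 := by exact_mod_cast hc.ne'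
    have : Complex.exp (I * ((ξ / c : ℝ):ℂ) * ((c * t + d : ℝ):ℂ)) =
       Complex.exp (I * ((ξ / c : ℝ):ℂ) * d) * Complex.exp (I * ξ * t) := by
      rw [← Complex.exp_add]; congr 1; push_cast; field_simp
      ring
    rw [this]; ring

lemma BL.neg {g : ℝ → ℂ} {a b : ℝ} (h : BL g a b) :
    BL (fun t => g (- t)) (-b) (-a) := by
  obtain ⟨k, k1, k2, k3⟩ := h
  refine ⟨fun ξ => k (-ξ), k1.comp_neg, ?_, ?_⟩
  · intro ξ hξ; try beta_reduce
    rw [k2]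
    intro h; exact hξ ⟨by linarith [h.2], by linarith [h.1]⟩
  · intro t; try beta_reduce
    rw [k3, ← integral_neg_eq_self]
    congr 1; ext ξ
    congr 2
    push_cast; ring

lemma BL.modulate {g : ℝ → ℂ} {a b : ℝ} (h : BL g a b) (n : ℝ) :
    BL (fun t => Complex.exp (I * n * t) * g t) (n + a) (n + b) := by
  obtain ⟨k, k1, k2, k3⟩ := h
  refine ⟨fun ξ => k (ξ - n), k1.comp_sub_right n, ?_, ?_⟩
  · intro ξ hξ; try beta_reduce
    rw [k2]
    intro h; exact hξ ⟨by linarith [h.1], by linarith [h.2]⟩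
  · intro t; try beta_reduce
    rw [k3, ← integral_sub_right_eq_self _ n, ← integral_const_mul]
    congr 1; ext ξ
    have : Complex.exp (I * ξ * t) = Complex.exp (I * n * t) * Complex.exp (I * ((ξ - n : ℝ):ℂ) * t) := by
      rw [← Complex.exp_add]; congr 1; push_cast; ring
    rw [this]; ring

lemma BL.conv {g : ℝ → ℂ} {a b : ℝ} (h : BL g a b) {f : ℝ → ℂ} (hf : Integrable f) :
    BL (fun x => ∫ y, f y * g (x - y)) a b := by
  obtain ⟨k, k1, k2, k3⟩ := h
  have hF : Continuous (fun ξ : ℝ => ∫ y, f y * Complex.exp (I * ξ * ((-y : ℝ):ℂ))) := by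
    refine continuous_of_dominated (bound := fun ξ => ‖f ξ‖) ?_ ?_ hf.norm ?_
    · intro t; try beta_reduce
      refine hf.aestronglyMeasurable.mul ?_
      exact (by fun_prop : Continuous fun y : ℝ => Complex.exp (I * t * ((-y : ℝ):ℂ))).aestronglyMeasurable
    · intro t; refine Filter.Eventually.of_forall fun ξ => ?_
      rw [norm_mul, norm_expI, mul_one]
    · refine Filter.Eventually.of_forall fun ξ => ?_
      fun_prop
  refine ⟨fun ξ => k ξ * ∫ y, f y * Complex.exp (I * ξ * ((-y : ℝ):ℂ)), ?_, ?_, ?_⟩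
  · refine k1.mul_bdd (c := ∫ y, ‖f y‖) hF.aestronglyMeasurable ?_
    refine Filter.Eventually.of_forall fun ξ => ?_
    refine (norm_integral_le_integral_norm _).trans (le_of_eq ?_)
    congr 1; ext y
    rw [norm_mul, norm_expI, mul_one]
  · intro ξ hξ; simp [k2 ξ hξ]
  · intro t; try beta_reduce
    simp_rw [k3]
    have h1 : ∀ y : ℝ, f y * ∫ ξ : ℝ, k ξ * Complex.exp (I * ξ * ((t - y : ℝ):ℂ)) =
        ∫ ξ : ℝ, f y * k ξ * Complex.exp (I * ξ * ((t - y : ℝ):ℂ)) := by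
      intro y; rw [← integral_const_mul]; simp [mul_assoc]
    simp_rw [h1]
    rw [integral_integral_swap]
    · congr 1; ext ξ
      rw [mul_assoc, ← integral_mul_const, ← integral_const_mul]
      congr 1; ext y
      have : Complex.exp (I * ξ * ((t - y : ℝ):ℂ)) = Complex.exp (I * ξ * ((-y : ℝ):ℂ)) * Complex.exp (I * ξ * t) := by
        rw [← Complex.exp_add]; congr 1; push_cast; ring
      rw [this]; ring
    · have := hf.mul_prod k1
      refine this.mul_bdd (c := 1) ?_ ?_
      · exact (by fun_prop : Continuous fun p : ℝ × ℝ => Complex.exp (I * p.2 * ((t - p.1 : ℝ):ℂ))).aestronglyMeasurable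
      · exact Filter.Eventually.of_forall fun p => (norm_expI p.2 (t - p.1)).le

open FourierTransform in
lemma BL.integral_zero {g : ℝ → ℂ} {a b : ℝ} (h : BL g a b) (hab : 0 < a ∨ b < 0)
    (hg : Integrable g) : ∫ t, g t = 0 := by
  obtain ⟨k, k1, k2, k3⟩ := h
  have e1 : 𝓕 k = fun w => g (w * (-(2 * π))) := by
    ext w
    rw [Real.fourier_real_eq_integral_exp_smul, k3]
    congr 1; ext v
    rw [smul_eq_mul, mul_comm]
    congr 2; push_cast; ring
  have hpi : -(2 * π) ≠ 0 := by have := Real.pi_pos; intro h; linarith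
  have e2 : Integrable (𝓕 k) := by
    rw [e1]; exact hg.comp_mul_right' hpi
  have hz : ∀ᶠ ξ in nhds (0:ℝ), k ξ = 0 := by
    rcases hab with h | h
    · filter_upwards [eventually_lt_nhds h] with ξ hξ
      exact k2 ξ fun h' => by linarith [h'.1]
    · filter_upwards [eventually_gt_nhds h] with ξ hξ
      exact k2 ξ fun h' => by linarith [h'.2]
  have hc : ContinuousAt k 0 := by
    refine (continuousAt_const (y := (0:ℂ))).congr ?_
    filter_upwards [hz] with ξ h using h.symm
  have := k1.fourierInv_fourier_eq e2 hc
  rw [hz.self_of_nhds, e1, Real.fourierInv_eq'] at this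
  simp only [inner_zero_right, mul_zero, Complex.ofReal_zero, zero_mul, Complex.exp_zero, one_smul] at this
  rw [Measure.integral_comp_mul_right] at this
  have h3 := smul_eq_zero.1 this
  rcases h3 with h3 | h3
  · exfalso; rw [abs_eq_zero, inv_eq_zero] at h3; exact hpi h3
  · exact h3

end Carl

namespace Carl
open Complex (I)

noncomputable def hk (n : ℕ) (ξ : ℝ) : ℂ := (Set.Icc (-1:ℝ) 1).indicator (fun ξ : ℝ => (1/2 : ℂ) * (I * ξ) ^ n) ξ

noncomputable def sck (n : ℕ) (t : ℝ) : ℂ := ∫ ξ, hk n ξ * Complex.exp (I * ξ * t)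

lemma hk_norm_le (n : ℕ) (ξ : ℝ) : ‖hk n ξ‖ ≤ (Set.Icc (-1:ℝ) 1).indicator (fun _ => (1/2:ℝ)) ξ := by
  unfold hk
  by_cases h : ξ ∈ Set.Icc (-1:ℝ) 1
  · rw [Set.indicator_of_mem h, Set.indicator_of_mem h]
    have h1 : |ξ| ≤ 1 := abs_le.2 h
    have : |ξ| ^ n ≤ 1 := pow_le_one₀ (abs_nonneg _) h1
    simp only [norm_mul, norm_pow, Complex.norm_I, Complex.norm_real, one_mul, Real.norm_eq_abs]
    norm_num
    linarith
  · rw [Set.indicator_of_notMem h, Set.indicator_of_notMem h]; simp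

lemma integrable_half : Integrable ((Set.Icc (-1:ℝ) 1).indicator (fun _ => (1/2:ℝ))) := by
  rw [integrable_indicator_iff measurableSet_Icc]
  exact continuousOn_const.integrableOn_Icc

lemma hk_integrable (n : ℕ) : Integrable (hk n) := by
  refine integrable_half.mono' ?_ (Filter.Eventually.of_forall (hk_norm_le n))
  refine AEStronglyMeasurable.indicator ?_ measurableSet_Icc
  exact (by fun_prop : Continuous fun ξ : ℝ => (1/2 : ℂ) * (I * ξ) ^ n).aestronglyMeasurable

lemma sck_BL (n : ℕ) : BL (sck n) (-1) 1 :=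
  ⟨hk n, hk_integrable n, fun ξ hξ => by simp [hk, hξ], fun t => rfl⟩

lemma sck_norm (n : ℕ) (t : ℝ) : ‖sck n t‖ ≤ 1 := by
  unfold sck
  refine (norm_integral_le_integral_norm _).trans ?_
  calc ∫ ξ, ‖hk n ξ * Complex.exp (I * ξ * t)‖
      ≤ ∫ ξ, (Set.Icc (-1:ℝ) 1).indicator (fun _ => (1/2:ℝ)) ξ := by
        refine integral_mono (integrable_mul_exp (hk_integrable n) t).norm integrable_half ?_
        intro ξ; beta_reduce
        rw [norm_mul, norm_expI, mul_one]; exact hk_norm_le n ξ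
    _ ≤ 1 := by
        rw [integral_indicator measurableSet_Icc]; simp; norm_num

lemma sck_deriv (n : ℕ) (t : ℝ) : HasDerivAt (sck n) (sck (n+1) t) t := by
  have := hasDerivAt_integral_of_dominated_loc_of_deriv_le (μ := volume) (𝕜 := ℝ)
    (F := fun (t ξ : ℝ) => hk n ξ * Complex.exp (I * ξ * t))
    (F' := fun (t ξ : ℝ) => hk (n+1) ξ * Complex.exp (I * ξ * t)) (x₀ := t) (s := Set.univ)
    (bound := (Set.Icc (-1:ℝ) 1).indicator (fun _ => (1/2:ℝ)))
    Filter.univ_mem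
    (Filter.Eventually.of_forall fun t => (integrable_mul_exp (hk_integrable n) t).aestronglyMeasurable)
    (integrable_mul_exp (hk_integrable n) t)
    (integrable_mul_exp (hk_integrable (n+1)) t).aestronglyMeasurable
    (Filter.Eventually.of_forall fun ξ t _ => by
      rw [norm_mul, norm_expI, mul_one]; exact hk_norm_le _ ξ) integrable_half
    (Filter.Eventually.of_forall fun ξ t _ => by
      have h1 : HasDerivAt (fun t : ℝ => I * ξ * (t:ℂ)) (I * ξ) t := by
        simpa using (Complex.ofRealCLM.hasDerivAt (x := t)).const_mul (I * ξ)
      have h2 := (h1.cexp).const_mul (hk n ξ)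
      have : hk (n+1) ξ = hk n ξ * (I * ξ) := by
        unfold hk
        by_cases h : ξ ∈ Set.Icc (-1:ℝ) 1
        · simp only [Set.indicator_of_mem h]; ring
        · simp only [Set.indicator_of_notMem h]; ring
      have h3 : hk (n+1) ξ * Complex.exp (I * ξ * t) = hk n ξ * (Complex.exp (I * ξ * t) * (I * ξ)) := by
        rw [this]; ring
      rw [h3]; exact h2)
  exact this.2

lemma sck_zero (t : ℝ) : sck 0 t = (Real.sinc t : ℂ) := by
  unfold sck hk
  have : ∀ ξ : ℝ, (Set.Icc (-1:ℝ) 1).indicator (fun ξ : ℝ => (1/2 : ℂ) * (I * ξ) ^ 0) ξ * Complex.exp (I * ξ * t)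
     = (Set.Icc (-1:ℝ) 1).indicator (fun ξ : ℝ => (1/2 : ℂ) * Complex.exp (I * t * ξ)) ξ := by
    intro ξ
    by_cases h : ξ ∈ Set.Icc (-1:ℝ) 1
    · simp only [Set.indicator_of_mem h]
      simp only [pow_zero, mul_one]
      congr 2; ring
    · simp only [Set.indicator_of_notMem h]; ring
  simp_rw [this]
  rw [integral_indicator measurableSet_Icc, integral_Icc_eq_integral_Ioc,
    ← intervalIntegral.integral_of_le (by norm_num), intervalIntegral.integral_const_mul]
  by_cases ht : t = 0
  · subst ht; simp; norm_num
  · rw [integral_exp_mul_complex (by simp [ht]), Real.sinc_of_ne_zero ht]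
    push_cast
    rw [Complex.sin]
    have : (t:ℂ) ≠ 0 := by exact_mod_cast ht
    field_simp
    rw [show I ^ 2 = -1 by simp]
    ring

lemma sck_zero_decay {t : ℝ} (ht : t ≠ 0) : ‖sck 0 t‖ ≤ |t|⁻¹ := by
  rw [sck_zero, Complex.norm_real, Real.norm_eq_abs]
  rw [Real.sinc_of_ne_zero ht, abs_div, div_eq_mul_inv]
  exact mul_le_of_le_one_left (by positivity) (Real.abs_sin_le_one t)

lemma sck_zero_decay' (t : ℝ) : ‖sck 0 (t / 2)‖ ≤ 3 * (1 + |t|)⁻¹ := by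
  rw [← div_eq_mul_inv, le_div_iff₀ (by positivity)]
  by_cases h : |t| ≤ 2
  · have := sck_norm 0 (t/2)
    nlinarith [norm_nonneg (sck 0 (t/2)), abs_nonneg t]
  · have ht : t ≠ 0 := by rintro rfl; simp at h
    have := sck_zero_decay (t := t/2) (by simpa using ht)
    rw [abs_div, abs_two, inv_div] at this
    calc ‖sck 0 (t / 2)‖ * (1 + |t|) ≤ 2 / |t| * (1 + |t|) := by gcongr
      _ = 2 / |t| + 2 := by field_simp
      _ ≤ 3 := by
        have : 2 / |t| ≤ 1 := by rw [div_le_one (by positivity)]; linarith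
        linarith

noncomputable def gg (v : ℝ) : ℂ := Complex.exp (I * (12:ℝ) * v) * sck 0 (v/2) ^ 8

noncomputable def gg1 (v : ℝ) : ℂ :=
  Complex.exp (I * (12:ℝ) * v) * (12 * I * sck 0 (v/2) ^ 8 + 4 * sck 0 (v/2) ^ 7 * sck 1 (v/2))

noncomputable def gg2 (v : ℝ) : ℂ :=
  Complex.exp (I * (12:ℝ) * v) * (12 * I * (12 * I * sck 0 (v/2) ^ 8 + 4 * sck 0 (v/2) ^ 7 * sck 1 (v/2)) +
    (48 * I * sck 0 (v/2) ^ 7 * sck 1 (v/2) + 14 * sck 0 (v/2) ^ 6 * sck 1 (v/2) ^ 2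
      + 2 * sck 0 (v/2) ^ 7 * sck 2 (v/2)))

lemma sckh_deriv (n : ℕ) (v : ℝ) : HasDerivAt (fun v : ℝ => sck n (v/2)) (sck (n+1) (v/2) / 2) v := by
  have h1 : HasDerivAt (fun v : ℝ => v / 2) (1/2) v := (hasDerivAt_id v).div_const 2
  have := (sck_deriv n (v/2)).scomp v h1
  have e : sck (n+1) (v/2) / 2 = (1/2:ℝ) • sck (n+1) (v/2) := by
    rw [Complex.real_smul]; push_cast; ring
  rw [e]; exact this

lemma exp12_deriv (v : ℝ) : HasDerivAt (fun v : ℝ => Complex.exp (I * (12:ℝ) * v))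
    (Complex.exp (I * (12:ℝ) * v) * (I * (12:ℝ))) v := by
  have h1 : HasDerivAt (fun t : ℝ => I * (12:ℝ) * (t:ℂ)) (I * (12:ℝ)) v := by
    simpa using (Complex.ofRealCLM.hasDerivAt (x := v)).const_mul (I * (12:ℝ))
  exact h1.cexp

lemma gg_deriv (v : ℝ) : HasDerivAt gg (gg1 v) v := by
  have := (exp12_deriv v).mul ((sckh_deriv 0 v).pow 8)
  exact this.congr_deriv (by unfold gg1; simp; ring)

lemma gg1_deriv (v : ℝ) : HasDerivAt gg1 (gg2 v) v := by
  have := (exp12_deriv v).mul ((((sckh_deriv 0 v).pow 8).const_mul (12 * I)).add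
    ((((sckh_deriv 0 v).pow 7).const_mul 4).mul (sckh_deriv 1 v)))
  exact this.congr_deriv (by unfold gg2; simp; ring)

lemma inv_le_of_dec (v : ℝ) : (1 + |v|)⁻¹ ≤ 1 := inv_le_one_of_one_le₀ (by linarith [abs_nonneg v])

lemma gg_bound (v : ℝ) : ‖gg v‖ ≤ 3 ^ 8 * (1 + |v|)⁻¹ ^ 8 := by
  unfold gg
  rw [norm_mul, norm_expI, one_mul, norm_pow, ← mul_pow]
  gcongr; exact sck_zero_decay' v

lemma gg_bound' (v : ℝ) : ‖gg v‖ ≤ 1 := by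
  unfold gg
  rw [norm_mul, norm_expI, one_mul, norm_pow]
  exact pow_le_one₀ (norm_nonneg _) (sck_norm _ _)

lemma gg1_bound (v : ℝ) : ‖gg1 v‖ ≤ 3 ^ 12 * (1 + |v|)⁻¹ ^ 6 := by
  unfold gg1
  rw [norm_mul, norm_expI, one_mul]
  set d := (1 + |v|)⁻¹
  have hd : d ≤ 1 := inv_le_of_dec v
  have hd0 : 0 ≤ d := by positivity
  have h0 : ‖sck 0 (v/2)‖ ≤ 3 * d := sck_zero_decay' v
  have h1 := sck_norm 1 (v/2)
  calc _ ≤ ‖12 * I * sck 0 (v/2) ^ 8‖ + ‖4 * sck 0 (v/2) ^ 7 * sck 1 (v/2)‖ := norm_add_le _ _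
    _ = 12 * ‖sck 0 (v/2)‖ ^ 8 + 4 * ‖sck 0 (v/2)‖ ^ 7 * ‖sck 1 (v/2)‖ := by simp
    _ ≤ 12 * (3 * d) ^ 8 + 4 * (3 * d) ^ 7 * 1 := by gcongr
    _ = (12 * 3 ^ 8 * d ^ 2 + 4 * 3 ^ 7 * d) * d ^ 6 := by ring
    _ ≤ (12 * 3 ^ 8 * 1 ^ 2 + 4 * 3 ^ 7 * 1) * d ^ 6 := by gcongr
    _ ≤ 3 ^ 12 * d ^ 6 := by gcongr; norm_num

lemma gg2_bound (v : ℝ) : ‖gg2 v‖ ≤ 3 ^ 15 * (1 + |v|)⁻¹ ^ 6 := by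
  unfold gg2
  rw [norm_mul, norm_expI, one_mul]
  set d := (1 + |v|)⁻¹
  have hd : d ≤ 1 := inv_le_of_dec v
  have hd0 : 0 ≤ d := by positivity
  have h0 : ‖sck 0 (v/2)‖ ≤ 3 * d := sck_zero_decay' v
  have h1 := sck_norm 1 (v/2)
  have h2 := sck_norm 2 (v/2)
  calc _ ≤ ‖12 * I * (12 * I * sck 0 (v/2) ^ 8 + 4 * sck 0 (v/2) ^ 7 * sck 1 (v/2))‖
      + ‖48 * I * sck 0 (v/2) ^ 7 * sck 1 (v/2) + 14 * sck 0 (v/2) ^ 6 * sck 1 (v/2) ^ 2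
      + 2 * sck 0 (v/2) ^ 7 * sck 2 (v/2)‖ := norm_add_le _ _
    _ ≤ ‖12 * I‖ * (‖12 * I * sck 0 (v/2) ^ 8‖ + ‖4 * sck 0 (v/2) ^ 7 * sck 1 (v/2)‖)
      + (‖48 * I * sck 0 (v/2) ^ 7 * sck 1 (v/2)‖ + ‖14 * sck 0 (v/2) ^ 6 * sck 1 (v/2) ^ 2‖
      + ‖2 * sck 0 (v/2) ^ 7 * sck 2 (v/2)‖) := by
        gcongr
        · rw [norm_mul]; gcongr; exact norm_add_le _ _
        · exact norm_add₃_le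
    _ = 12 * (12 * ‖sck 0 (v/2)‖ ^ 8 + 4 * ‖sck 0 (v/2)‖ ^ 7 * ‖sck 1 (v/2)‖)
      + (48 * ‖sck 0 (v/2)‖ ^ 7 * ‖sck 1 (v/2)‖ + 14 * ‖sck 0 (v/2)‖ ^ 6 * ‖sck 1 (v/2)‖ ^ 2
      + 2 * ‖sck 0 (v/2)‖ ^ 7 * ‖sck 2 (v/2)‖) := by simp
    _ ≤ 12 * (12 * (3 * d) ^ 8 + 4 * (3 * d) ^ 7 * 1)
      + (48 * (3 * d) ^ 7 * 1 + 14 * (3 * d) ^ 6 * 1 ^ 2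
      + 2 * (3 * d) ^ 7 * 1) := by gcongr
    _ = (12 * (12 * 3 ^ 8 * d ^ 2 + 4 * 3 ^ 7 * d) + (48 * 3 ^ 7 * d + 14 * 3 ^ 6 + 2 * 3 ^ 7 * d)) * d ^ 6 := by ring
    _ ≤ (12 * (12 * 3 ^ 8 * 1 ^ 2 + 4 * 3 ^ 7 * 1) + (48 * 3 ^ 7 * 1 + 14 * 3 ^ 6 + 2 * 3 ^ 7 * 1)) * d ^ 6 := by gcongr
    _ ≤ 3 ^ 15 * d ^ 6 := by gcongr; norm_num

lemma BL.pow_succ {g : ℝ → ℂ} {a b : ℝ} (h : BL g a b) (n : ℕ) :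
    BL (fun t => g t ^ (n+1)) ((n+1) * a) ((n+1) * b) := by
  induction n with
  | zero => simpa using h
  | succ n ih =>
    have := ih.mul h
    simp only [_root_.pow_succ (g _) (n+1)]
    convert this using 1 <;> push_cast <;> ring

lemma sckh_BL (n : ℕ) : BL (fun v => sck n (v/2)) (-(1/2)) (1/2) := by
  have := (sck_BL n).affine (c := 1/2) (by norm_num) 0
  convert this using 1
  · ext v; congr 1; ring
  · ring
  · ring

lemma gg_BL : BL gg 8 16 := by
  have := ((sckh_BL 0).pow_succ 7).modulate 12
  unfold gg
  refine this.mono ?_ ?_ <;> norm_num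

lemma gg_zero : gg 0 = 1 := by
  unfold gg
  simp [sck_zero]

lemma dec_shift (a b : ℝ) : (1 + |a|)⁻¹ ≤ (1 + |b|)⁻¹ * (1 + |b - a|) := by
  rw [inv_mul_eq_div, le_div_iff₀ (by positivity), inv_mul_le_iff₀ (by positivity)]
  have h : |b| ≤ |a| + |b - a| := by
    have := abs_add_le a (b - a); simpa using this
  nlinarith [abs_nonneg a, abs_nonneg (b - a), mul_nonneg (abs_nonneg a) (abs_nonneg (b-a))]

lemma gg_sub_one (v : ℝ) : ‖gg v - 1‖ ≤ 3 ^ 12 * |v| := by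
  rw [← gg_zero]
  have := Convex.norm_image_sub_le_of_norm_hasDerivWithin_le (f := gg) (f' := gg1) (C := 3 ^ 12)
    (s := Set.univ) (x := 0) (y := v) (fun x _ => (gg_deriv x).hasDerivWithinAt) ?_ convex_univ trivial trivial
  · simpa using this
  · intro x _
    refine (gg1_bound x).trans ?_
    exact mul_le_of_le_one_right (by positivity) (pow_le_one₀ (by positivity) (inv_le_of_dec x))

lemma gg1_lip (v w : ℝ) : ‖gg1 v - gg1 w‖ ≤ 3 ^ 15 * |v - w| * ((1 + |v|)⁻¹ ^ 6 * (1 + |v - w|) ^ 6) := by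
  have := Convex.norm_image_sub_le_of_norm_hasDerivWithin_le (f := gg1) (f' := gg2)
    (C := 3 ^ 15 * ((1 + |v|)⁻¹ ^ 6 * (1 + |v - w|) ^ 6))
    (s := Set.uIcc w v) (x := w) (y := v) (fun x _ => (gg1_deriv x).hasDerivWithinAt) ?_ (convex_uIcc _ _)
    Set.left_mem_uIcc Set.right_mem_uIcc
  · rw [Real.norm_eq_abs] at this
    linarith
  · intro x hx
    refine (gg2_bound x).trans ?_
    rw [← mul_pow]
    gcongr
    refine (dec_shift x v).trans ?_
    have := Set.abs_sub_right_of_mem_uIcc hx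
    gcongr

end Carl

namespace Carl
open Complex (I)

/-- the mother wavelet -/
noncomputable def psi (t : ℝ) : ℂ := - ∫ l in (1/2:ℝ)..1, gg1 (l * t)

lemma gg1_continuous : Continuous gg1 :=
  continuous_iff_continuousAt.2 fun v => (gg1_deriv v).continuousAt

lemma psi_of_ne {t : ℝ} (ht : t ≠ 0) : psi t = (gg (t / 2) - gg t) / t := by
  have h1 : ∀ x ∈ Set.uIcc (1/2:ℝ) 1, HasDerivAt (fun l : ℝ => gg (l * t)) (t • gg1 (x * t)) x := by
    intro x _
    have : HasDerivAt (fun l : ℝ => l * t) t x := by simpa using (hasDerivAt_id x).mul_const t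
    exact (gg_deriv (x * t)).scomp x this
  have h2 := intervalIntegral.integral_eq_sub_of_hasDerivAt h1
    ((by have := gg1_continuous; fun_prop : Continuous fun x : ℝ => t • gg1 (x * t)).intervalIntegrable _ _)
  rw [intervalIntegral.integral_smul] at h2
  have ht' : (t:ℂ) ≠ 0 := by exact_mod_cast ht
  unfold psi
  rw [eq_div_iff ht']
  rw [Complex.real_smul] at h2
  rw [show (1/2 * t) = t / 2 by ring, one_mul] at h2
  linear_combination -h2

lemma psi_continuous : Continuous psi := by
  unfold psi
  have := gg1_continuous
  refine Continuous.neg ?_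
  exact intervalIntegral.continuous_parametric_intervalIntegral_of_continuous' (by fun_prop) _ _

lemma psi_BL : BL psi 4 16 := by
  obtain ⟨k, k1, k2, k3⟩ := gg_BL
  have hS : MeasurableSet {p : ℝ × ℝ | p.1 / 2 ≤ p.2 ∧ p.2 ≤ p.1} :=
    (measurableSet_le (f := fun p : ℝ × ℝ => p.1 / 2) (g := fun p => p.2) (by fun_prop) (by fun_prop)).inter
      (measurableSet_le (f := fun p : ℝ × ℝ => p.2) (g := fun p => p.1) (by fun_prop) (by fun_prop))
  set S := {p : ℝ × ℝ | p.1 / 2 ≤ p.2 ∧ p.2 ≤ p.1} with hSdef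
  set K : ℝ × ℝ → ℂ := S.indicator (fun p => -I * k p.1) with hK
  -- support
  have hsupp : ∀ p : ℝ × ℝ, p.2 ∉ Set.Icc (4:ℝ) 16 → K p = 0 := by
    intro p hp
    simp only [hK]
    by_cases h : p ∈ S
    · rw [Set.indicator_of_mem h, k2, mul_zero]
      intro h'
      exact hp ⟨by linarith [h.1, h'.1], by linarith [h.2, h'.2]⟩
    · rw [Set.indicator_of_notMem h]
  have hKint : Integrable K (volume.prod volume) := by
    have i1 : Integrable (fun p : ℝ × ℝ => (-I * k p.1) * (Set.Icc (4:ℝ) 16).indicator (fun _ => (1:ℂ)) p.2)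
        (volume.prod volume) := by
      refine (k1.const_mul (-I)).mul_prod (g := (Set.Icc (4:ℝ) 16).indicator (fun _ => (1:ℂ))) ?_
      rw [integrable_indicator_iff measurableSet_Icc]
      exact continuousOn_const.integrableOn_Icc
    refine (i1.indicator hS).congr (Filter.Eventually.of_forall fun p => ?_)
    by_cases hp : p.2 ∈ Set.Icc (4:ℝ) 16
    · simp [hK, Set.indicator, hp]
    · rw [hsupp p hp]; simp [Set.indicator, hp]
  have hfun : BL (fun t : ℝ => ∫ η : ℝ, (∫ ξ, K (ξ, η)) * Complex.exp (I * η * t)) 4 16 := by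
    refine ⟨fun η => ∫ ξ, K (ξ, η), hKint.integral_prod_right, fun η hη => ?_, fun t => rfl⟩
    simp [hsupp (_, η) hη]
  have heq : Set.EqOn psi (fun t : ℝ => ∫ η : ℝ, (∫ ξ, K (ξ, η)) * Complex.exp (I * η * t)) {0}ᶜ := by
    intro t ht
    have ht : t ≠ 0 := by simpa using ht
    have ht' : (t:ℂ) ≠ 0 := by exact_mod_cast ht
    rw [psi_of_ne ht]
    simp_rw [← integral_mul_const]
    rw [integral_integral_swap (f := fun η ξ : ℝ => K (ξ, η) * Complex.exp (I * η * t))]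
    · rw [k3, k3, ← integral_sub (integrable_mul_exp k1 _) (integrable_mul_exp k1 _), ← integral_div]
      congr 1; ext ξ
      by_cases hξ : ξ ∈ Set.Icc (8:ℝ) 16
      · have e1 : ∀ η : ℝ, K (ξ, η) * Complex.exp (I * η * t) = (Set.Icc (ξ/2) ξ).indicator
          (fun η : ℝ => -I * k ξ * Complex.exp (I * t * η)) η := by
          intro η
          by_cases h : η ∈ Set.Icc (ξ/2) ξ
          · have : (ξ, η) ∈ S := ⟨h.1, h.2⟩
            rw [hK, Set.indicator_of_mem this, Set.indicator_of_mem h]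
            congr 2; ring
          · have : (ξ, η) ∉ S := fun h' => h ⟨h'.1, h'.2⟩
            rw [hK, Set.indicator_of_notMem this, Set.indicator_of_notMem h, zero_mul]
        simp_rw [e1]
        rw [integral_indicator measurableSet_Icc, integral_Icc_eq_integral_Ioc,
          ← intervalIntegral.integral_of_le (by linarith [hξ.1]), intervalIntegral.integral_const_mul,
          integral_exp_mul_complex (by simp [ht])]
        have a1 : I * ξ * ((t/2 : ℝ):ℂ) = I * t * ((ξ/2 : ℝ):ℂ) := by push_cast; ring
        have a2 : I * ξ * (t:ℂ) = I * t * ξ := by ring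
        rw [a1, a2]
        field_simp
        ring
      · rw [k2 ξ hξ]
        have : ∀ η, K (ξ, η) = 0 := by
          intro η; simp [hK, Set.indicator, k2 ξ hξ]
        simp [this]
    · have i2 : Integrable (fun p : ℝ × ℝ => K p * Complex.exp (I * p.2 * t)) (volume.prod volume) := by
        refine hKint.mul_bdd (c := 1) ?_ ?_
        · exact (by fun_prop : Continuous fun p : ℝ × ℝ => Complex.exp (I * p.2 * t)).aestronglyMeasurable
        · exact Filter.Eventually.of_forall fun p => (norm_expI p.2 t).le
      exact i2.swap
  have : psi = _ := psi_continuous.ext_on (dense_compl_singleton 0) hfun.continuous heq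
  rw [this]; exact hfun

lemma half_dec {l t : ℝ} (hl : l ∈ Set.Icc (1/2:ℝ) 1) : (1 + |l * t|)⁻¹ ≤ 2 * (1 + |t|)⁻¹ := by
  rw [← div_eq_mul_inv, le_div_iff₀ (by positivity), inv_mul_le_iff₀ (by positivity), abs_mul,
    abs_of_nonneg (by linarith [hl.1] : (0:ℝ) ≤ l)]
  nlinarith [hl.1, abs_nonneg t, mul_nonneg (sub_nonneg.2 hl.1) (abs_nonneg t)]

lemma psi_bound (t : ℝ) : ‖psi t‖ ≤ 3 ^ 22 * (1 + |t|)⁻¹ ^ 6 := by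
  unfold psi
  rw [norm_neg]
  have := intervalIntegral.norm_integral_le_of_norm_le_const (a := 1/2) (b := 1) (f := fun l => gg1 (l * t))
    (C := 3 ^ 22 * (1 + |t|)⁻¹ ^ 6) ?_
  · refine this.trans ?_
    refine mul_le_of_le_one_right (by positivity) ?_
    norm_num [abs_of_nonneg]
  · intro l hl
    rw [Set.uIoc_of_le (by norm_num)] at hl
    have h2 := half_dec (t := t) ⟨hl.1.le, hl.2⟩
    calc ‖gg1 (l * t)‖ ≤ 3 ^ 12 * (1 + |l * t|)⁻¹ ^ 6 := gg1_bound _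
      _ ≤ 3 ^ 12 * (2 * (1 + |t|)⁻¹) ^ 6 := by gcongr
      _ = 3 ^ 12 * 2 ^ 6 * (1 + |t|)⁻¹ ^ 6 := by ring
      _ ≤ 3 ^ 22 * (1 + |t|)⁻¹ ^ 6 := by gcongr; norm_num

lemma psi_lip (t u : ℝ) : ‖psi t - psi u‖ ≤ 3 ^ 22 * |t - u| * ((1 + |t|)⁻¹ ^ 6 * (1 + |t - u|) ^ 6) := by
  unfold psi
  have hc := gg1_continuous
  rw [neg_sub_neg, norm_sub_rev, ← intervalIntegral.integral_sub
    ((by fun_prop : Continuous _).intervalIntegrable _ _) ((by fun_prop : Continuous _).intervalIntegrable _ _)]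
  have := intervalIntegral.norm_integral_le_of_norm_le_const (a := 1/2) (b := 1)
    (f := fun l => gg1 (l * t) - gg1 (l * u))
    (C := 3 ^ 22 * |t - u| * ((1 + |t|)⁻¹ ^ 6 * (1 + |t - u|) ^ 6)) ?_
  · refine this.trans ?_
    refine mul_le_of_le_one_right (by positivity) ?_
    norm_num [abs_of_nonneg]
  · intro l hl
    rw [Set.uIoc_of_le (by norm_num)] at hl
    have h2 := half_dec (t := t) ⟨hl.1.le, hl.2⟩
    have h3 : |l * t - l * u| ≤ |t - u| := by
      rw [← mul_sub, abs_mul]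
      exact mul_le_of_le_one_left (abs_nonneg _) (abs_le.2 ⟨by linarith [hl.1], hl.2⟩)
    calc _ ≤ 3 ^ 15 * |l * t - l * u| * ((1 + |l * t|)⁻¹ ^ 6 * (1 + |l * t - l * u|) ^ 6) := gg1_lip _ _
      _ ≤ 3 ^ 15 * |t - u| * ((2 * (1 + |t|)⁻¹) ^ 6 * (1 + |t - u|) ^ 6) := by gcongr
      _ = 3 ^ 15 * 2 ^ 6 * |t - u| * ((1 + |t|)⁻¹ ^ 6 * (1 + |t - u|) ^ 6) := by ring
      _ ≤ _ := by gcongr; norm_num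

/-! ### the averaging bump -/

lemma dec_sq_le (t : ℝ) : (1 + |t|)⁻¹ ^ 2 ≤ (1 + t ^ 2)⁻¹ := by
  rw [inv_pow]
  refine inv_anti₀ (by positivity) ?_
  nlinarith [abs_nonneg t, sq_abs t]

lemma dec_continuous (n : ℕ) : Continuous (fun t : ℝ => (1 + |t|)⁻¹ ^ n) :=
  Continuous.pow (Continuous.inv₀ (by fun_prop) fun t => by positivity) _

lemma integrable_dec : Integrable (fun t : ℝ => (1 + |t|)⁻¹ ^ 2) := by
  refine integrable_inv_one_add_sq.mono' (dec_continuous 2).aestronglyMeasurable ?_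
  refine Filter.Eventually.of_forall fun t => ?_
  rw [Real.norm_eq_abs, abs_of_nonneg (by positivity)]
  exact dec_sq_le t

lemma integral_dec_le : ∫ t : ℝ, (1 + |t|)⁻¹ ^ 2 ≤ 4 := by
  calc ∫ t : ℝ, (1 + |t|)⁻¹ ^ 2 ≤ ∫ t : ℝ, (1 + t ^ 2)⁻¹ :=
        integral_mono integrable_dec integrable_inv_one_add_sq dec_sq_le
    _ = π := integral_univ_inv_one_add_sq
    _ ≤ 4 := Real.pi_le_four

noncomputable def rho0 (t : ℝ) : ℝ := Real.sinc (t / 8) ^ 16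

lemma rho0_nonneg (t : ℝ) : 0 ≤ rho0 t := by unfold rho0; exact Even.pow_nonneg (by decide) _

lemma rho0_bound (t : ℝ) : rho0 t ≤ 12 ^ 16 * (1 + |t|)⁻¹ ^ 16 := by
  have h := sck_zero_decay' (t / 4)
  rw [sck_zero, Complex.norm_real, Real.norm_eq_abs, show t / 4 / 2 = t / 8 by ring] at h
  have h2 : (1 + |t / 4|)⁻¹ ≤ 4 * (1 + |t|)⁻¹ := by
    rw [← div_eq_mul_inv, le_div_iff₀ (by positivity), inv_mul_le_iff₀ (by positivity), abs_div]
    norm_num; linarith [abs_nonneg t]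
  unfold rho0
  rw [← Even.pow_abs (by decide), ← mul_pow]
  gcongr
  linarith

lemma rho0_continuous : Continuous rho0 := by
  unfold rho0; have := Real.continuous_sinc; fun_prop

lemma dec_pow_le (t : ℝ) {m n : ℕ} (h : m ≤ n) : (1 + |t|)⁻¹ ^ n ≤ (1 + |t|)⁻¹ ^ m :=
  pow_le_pow_of_le_one (by positivity) (inv_le_of_dec t) h

lemma rho0_integrable : Integrable rho0 := by
  refine (integrable_dec.const_mul (12 ^ 16)).mono' rho0_continuous.aestronglyMeasurable ?_
  refine Filter.Eventually.of_forall fun t => ?_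
  rw [Real.norm_eq_abs, abs_of_nonneg (rho0_nonneg t)]
  refine (rho0_bound t).trans ?_
  gcongr ?_ * ?_
  exact dec_pow_le t (by norm_num)

lemma rho0_integral : 1 / 16 ≤ ∫ t, rho0 t := by
  have h1 : ∀ t ∈ Set.Ioc (0:ℝ) 8, (1/64 : ℝ) / 2 ≤ rho0 t := by
    intro t ht
    have hx : 0 < t / 8 := by linarith [ht.1]
    have := Real.sin_gt_sub_cube hx
    unfold rho0
    rw [Real.sinc_of_ne_zero hx.ne']
    have h3 : (3/4:ℝ) ≤ Real.sin (t/8) / (t/8) := by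
      rw [le_div_iff₀ hx]
      have : (t/8)^3 ≤ t/8 := by
        have h1 : t / 8 ≤ 1 := by linarith [ht.2]
        calc (t/8)^3 ≤ (t/8)^1 := pow_le_pow_of_le_one hx.le h1 (by norm_num)
          _ = t/8 := pow_one _
      linarith
    calc (1/64:ℝ)/2 ≤ (3/4)^16 := by norm_num
      _ ≤ _ := by gcongr
  calc (1:ℝ)/16 ≤ ∫ t in Set.Ioc (0:ℝ) 8, (1/64:ℝ)/2 := by simp; norm_num
    _ ≤ ∫ t in Set.Ioc (0:ℝ) 8, rho0 t := by
      refine setIntegral_mono_on (by simp) rho0_integrable.integrableOn measurableSet_Ioc h1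
    _ ≤ ∫ t, rho0 t := setIntegral_le_integral rho0_integrable (Filter.Eventually.of_forall rho0_nonneg)

noncomputable def rho (t : ℝ) : ℝ := (∫ t, rho0 t)⁻¹ * rho0 t

lemma rho0_int_pos : 0 < ∫ t, rho0 t := lt_of_lt_of_le (by norm_num) rho0_integral

lemma rho_nonneg (t : ℝ) : 0 ≤ rho t := mul_nonneg (inv_nonneg.2 rho0_int_pos.le) (rho0_nonneg t)

lemma rho_continuous : Continuous rho := rho0_continuous.const_mul _

lemma rho_integrable : Integrable rho := rho0_integrable.const_mul _

lemma rho_integral : ∫ t, rho t = 1 := by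
  unfold rho; rw [integral_const_mul]; exact inv_mul_cancel₀ rho0_int_pos.ne'

lemma rho_bound (t : ℝ) : rho t ≤ 2 ^ 62 * (1 + |t|)⁻¹ ^ 16 := by
  unfold rho
  have : (∫ t, rho0 t)⁻¹ ≤ 16 := by
    have := inv_anti₀ (by norm_num) rho0_integral; simpa using this
  calc _ ≤ 16 * (12 ^ 16 * (1 + |t|)⁻¹ ^ 16) := by
        have := rho0_bound t; have := rho0_nonneg t; gcongr
    _ = 16 * 12 ^ 16 * (1 + |t|)⁻¹ ^ 16 := by ring
    _ ≤ _ := by gcongr; norm_num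

lemma rho_BL : BL (fun t => (rho t : ℂ)) (-2) 2 := by
  have h1 := ((sck_BL 0).affine (c := 1/8) (by norm_num) 0).pow_succ 15
  have h2 := (h1.const_mul (((∫ t, rho0 t)⁻¹ : ℝ) : ℂ)).mono (a' := -2) (b' := 2) (by norm_num) (by norm_num)
  convert h2 using 2 with t
  unfold rho rho0
  push_cast
  rw [sck_zero]
  congr 4
  ring

end Carl

namespace Carl

/-- dyadic averages -/
noncomputable def avg (F : ℝ → ℝ≥0∞) (j : ℤ) (x : ℝ) : ℝ≥0∞ :=
  (2 ^ j)⁻¹ * ∫⁻ y in Metric.ball x (2 ^ j), F y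

/-- maximal function -/
noncomputable def MM (F : ℝ → ℝ≥0∞) (x : ℝ) : ℝ≥0∞ := ⨆ j : ℤ, avg F j x

lemma ofReal_two_zpow (j : ℤ) : ENNReal.ofReal ((2:ℝ) ^ j) = 2 ^ j := by
  cases j with
  | ofNat n => simp [ENNReal.ofReal_pow]
  | negSucc n =>
    rw [zpow_negSucc, zpow_negSucc, ENNReal.ofReal_inv_of_pos (by positivity), ENNReal.ofReal_pow (by norm_num)]
    simp

lemma two_zpow_ne_zero (j : ℤ) : (2:ℝ≥0∞) ^ j ≠ 0 := (ENNReal.zpow_pos (by norm_num) (by norm_num) j).ne'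
lemma two_zpow_ne_top (j : ℤ) : (2:ℝ≥0∞) ^ j ≠ ⊤ := (ENNReal.zpow_lt_top (by norm_num) (by norm_num) j).ne

lemma measurable_avg {F : ℝ → ℝ≥0∞} (hF : Measurable F) (j : ℤ) : Measurable (avg F j) := by
  unfold avg
  refine Measurable.const_mul ?_ _
  have : (fun x : ℝ => ∫⁻ y in Metric.ball x (2 ^ j), F y) =
      fun x => ∫⁻ y, {p : ℝ × ℝ | |p.2 - p.1| < 2 ^ j}.indicator (fun p => F p.2) (x, y) := by
    ext x
    rw [← lintegral_indicator measurableSet_ball]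
    rfl
  rw [this]
  refine Measurable.lintegral_prod_right' (f := {p : ℝ × ℝ | |p.2 - p.1| < 2 ^ j}.indicator (fun p => F p.2)) ?_
  refine (hF.comp measurable_snd).indicator ?_
  exact measurableSet_lt (f := fun p : ℝ × ℝ => |p.2 - p.1|) (by fun_prop) measurable_const

lemma measurable_MM {F : ℝ → ℝ≥0∞} (hF : Measurable F) : Measurable (MM F) :=
  Measurable.iSup fun j => measurable_avg hF j

lemma MM_weak {F : ℝ → ℝ≥0∞} (k : ℤ) :
    2 ^ k * volume {x | 2 ^ k < MM F x} ≤ 8 * ∫⁻ y, F y := by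
  by_cases hI : ∫⁻ y, F y = ⊤
  · rw [hI]; simp
  set A := {x | 2 ^ k < MM F x} with hA
  have h1 : ∀ x : ℝ, ∃ j : ℤ, x ∈ A → (2:ℝ≥0∞) ^ k * 2 ^ j ≤ ∫⁻ y in Metric.ball x (2 ^ j), F y := by
    intro x
    by_cases hx : x ∈ A
    · obtain ⟨j, hj⟩ := lt_iSup_iff.1 (show 2 ^ k < ⨆ j : ℤ, avg F j x from hx)
      refine ⟨j, fun _ => ?_⟩
      have := hj.le
      unfold avg at this
      rw [mul_comm, ← div_eq_mul_inv, ENNReal.le_div_iff_mul_le (Or.inl (two_zpow_ne_zero j)) (Or.inl (two_zpow_ne_top j))] at this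
      exact this
    · exact ⟨0, fun h => absurd h hx⟩
  choose j hj using h1
  have hR : ∀ a ∈ A, (2:ℝ) ^ (j a) ≤ (∫⁻ y, F y).toReal / 2 ^ k := by
    intro a ha
    rw [le_div_iff₀ (by positivity)]
    have h2 : (2:ℝ≥0∞) ^ k * 2 ^ (j a) ≤ ∫⁻ y, F y := (hj a ha).trans (setLIntegral_le_lintegral _ _)
    rw [← ofReal_two_zpow, ← ofReal_two_zpow, ← ENNReal.ofReal_mul (by positivity)] at h2
    have := (ENNReal.ofReal_le_iff_le_toReal hI).1 h2
    linarith
  obtain ⟨u, huA, hu, hcov⟩ := Vitali.exists_disjoint_subfamily_covering_enlargement_ball A (fun a => a)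
    (fun a => (2:ℝ) ^ (j a)) _ hR 4 (by norm_num)
  have hucount : u.Countable := hu.countable_of_isOpen (fun a _ => Metric.isOpen_ball)
    (fun a _ => Metric.nonempty_ball.2 (by positivity))
  have hsub : A ⊆ ⋃ b ∈ u, Metric.ball b (4 * 2 ^ (j b)) := by
    intro a ha
    obtain ⟨b, hb, hab⟩ := hcov a ha
    simp only [Set.mem_iUnion]
    exact ⟨b, hb, hab (Metric.mem_ball_self (by positivity))⟩
  haveI := hucount.to_subtype
  calc 2 ^ k * volume A ≤ 2 ^ k * ∑' b : u, volume (Metric.ball (b:ℝ) (4 * 2 ^ (j b))) := by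
        gcongr
        exact (measure_mono hsub).trans (measure_biUnion_le _ hucount _)
    _ = ∑' b : u, 8 * (2 ^ k * 2 ^ (j b)) := by
        rw [← ENNReal.tsum_mul_left]
        congr 1; ext b
        rw [Real.volume_ball, show (2:ℝ) * (4 * 2 ^ (j b)) = 8 * 2 ^ (j b) by ring,
          ENNReal.ofReal_mul (by norm_num), ofReal_two_zpow]
        simp; ring
    _ ≤ ∑' b : u, 8 * ∫⁻ y in Metric.ball (b:ℝ) (2 ^ (j b)), F y := by
        refine ENNReal.tsum_le_tsum fun b => ?_
        gcongr; exact hj b (huA b.2)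
    _ = 8 * ∫⁻ y in ⋃ b ∈ u, Metric.ball (b:ℝ) (2 ^ (j b)), F y := by
        rw [ENNReal.tsum_mul_left, lintegral_biUnion hucount (fun b _ => measurableSet_ball) hu]
    _ ≤ 8 * ∫⁻ y, F y := mul_le_mul' le_rfl (setLIntegral_le_lintegral _ _)

lemma MM_split (F : ℝ → ℝ≥0∞) (hF : Measurable F) (k : ℤ) (x : ℝ) :
    MM F x ≤ MM ({y | 2 ^ (k - 2) < F y}.indicator F) x + 2 ^ (k - 1) := by
  unfold MM
  refine iSup_le fun j => ?_
  have hS : MeasurableSet {y | 2 ^ (k - 2) < F y} := measurableSet_lt measurable_const hF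
  have h1 : avg F j x ≤ avg ({y | 2 ^ (k - 2) < F y}.indicator F) j x + 2 ^ (k - 1) := by
    unfold avg
    calc (2 ^ j)⁻¹ * ∫⁻ y in Metric.ball x (2 ^ j), F y
        ≤ (2 ^ j)⁻¹ * ∫⁻ y in Metric.ball x (2 ^ j), ({y | 2 ^ (k - 2) < F y}.indicator F y + 2 ^ (k - 2)) := by
          gcongr with y
          by_cases hy : y ∈ {y | 2 ^ (k - 2) < F y}
          · rw [Set.indicator_of_mem hy]; exact le_self_add
          · rw [Set.indicator_of_notMem hy, zero_add]; exact not_lt.1 hy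
      _ = (2 ^ j)⁻¹ * (∫⁻ y in Metric.ball x (2 ^ j), ({y | 2 ^ (k - 2) < F y}.indicator F y)) + 2 ^ (k - 1) := by
          rw [lintegral_add_right _ measurable_const, mul_add]
          congr 1
          rw [setLIntegral_const, Real.volume_ball, ENNReal.ofReal_mul (by norm_num), ofReal_two_zpow]
          rw [show k - 1 = (k - 2) + 1 by ring, ENNReal.zpow_add (by norm_num) (by norm_num), zpow_one]
          have := ENNReal.inv_mul_cancel (two_zpow_ne_zero j) (two_zpow_ne_top j)
          calc (2 ^ j)⁻¹ * (2 ^ (k - 2) * (ENNReal.ofReal 2 * 2 ^ j)) = ((2 ^ j)⁻¹ * 2 ^ j) * (2 ^ (k - 2) * ENNReal.ofReal 2) := by ring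
            _ = _ := by rw [this]; simp
  exact h1.trans (by gcongr; exact le_iSup (fun j => avg ({y | 2 ^ (k - 2) < F y}.indicator F) j x) j)

lemma MM_dist (F : ℝ → ℝ≥0∞) (hF : Measurable F) (k : ℤ) :
    2 ^ (k - 1) * volume {x | 2 ^ k < MM F x} ≤ 8 * ∫⁻ y, {y | 2 ^ (k - 2) < F y}.indicator F y := by
  refine le_trans ?_ (MM_weak (k - 1))
  gcongr 2 ^ (k-1) * volume ?_
  intro x hx
  have h1 : 2 ^ k < MM F x := hx
  have h2 := h1.trans_le (MM_split F hF k x)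
  rw [show k = (k - 1) + 1 by ring, ENNReal.zpow_add (by norm_num) (by norm_num), zpow_one, mul_two,
    show k - 1 + 1 = k by ring] at h2
  exact (ENNReal.add_lt_add_iff_right (two_zpow_ne_top _)).1 h2

lemma tsum_zpow_le {a : ℝ≥0∞} (ha : a ≠ ⊤) :
    ∑' k : ℤ, (if 2 ^ k < a then (2:ℝ≥0∞) ^ k else 0) ≤ 2 * a := by
  by_cases h0 : a = 0
  · subst h0; simp
  obtain ⟨n, hn1, hn2⟩ := ENNReal.exists_mem_Ioc_zpow h0 ha (by norm_num : (1:ℝ≥0∞) < 2) (by norm_num)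
  have hinj : Function.Injective (fun m : ℕ => n - (m:ℤ)) := by
    intro m m' h; simpa using h
  have hsupp : Function.support (fun k : ℤ => if 2 ^ k < a then (2:ℝ≥0∞) ^ k else 0) ⊆ Set.range (fun m : ℕ => n - (m:ℤ)) := by
    intro k hk
    have hk : 2 ^ k < a := by
      by_contra h; simp [h] at hk
    have : (2:ℝ≥0∞) ^ k < 2 ^ (n + 1) := hk.trans_le hn2
    have hkn : k < n + 1 := by
      by_contra h
      push Not at h
      exact absurd this (not_lt.2 (ENNReal.zpow_le_of_le (by norm_num) h))
    exact ⟨(n - k).toNat, by simp only; omega⟩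
  rw [← hinj.tsum_eq hsupp]
  calc ∑' m : ℕ, (if 2 ^ (n - (m:ℤ)) < a then (2:ℝ≥0∞) ^ (n - (m:ℤ)) else 0)
      ≤ ∑' m : ℕ, 2 ^ n * (2⁻¹ : ℝ≥0∞) ^ m := by
        refine ENNReal.tsum_le_tsum fun m => ?_
        split_ifs
        · rw [sub_eq_add_neg, ENNReal.zpow_add (by norm_num) (by norm_num), ENNReal.zpow_neg, zpow_natCast, ENNReal.inv_pow]
        · positivity
    _ = 2 * 2 ^ n := by
        rw [ENNReal.tsum_mul_left, ENNReal.tsum_geometric, ENNReal.one_sub_inv_two, inv_inv, mul_comm]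
    _ ≤ 2 * a := by gcongr

lemma sq_le_tsum (a : ℝ≥0∞) :
    a ^ 2 ≤ ∑' k : ℤ, (if 2 ^ k < a then 4 * ((2:ℝ≥0∞) ^ k * 2 ^ k) else 0) := by
  by_cases h0 : a = 0
  · subst h0; simp
  by_cases ht : a = ⊤
  · subst ht
    have : ∑' k : ℤ, (if (2:ℝ≥0∞) ^ k < ⊤ then 4 * ((2:ℝ≥0∞) ^ k * 2 ^ k) else 0) = ⊤ := by
      rw [eq_top_iff]
      calc ⊤ = ∑' n : ℕ, (1:ℝ≥0∞) := by rw [ENNReal.tsum_const]; simp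
        _ ≤ ∑' n : ℕ, (fun k : ℤ => (if (2:ℝ≥0∞) ^ k < ⊤ then 4 * ((2:ℝ≥0∞) ^ k * 2 ^ k) else 0)) (n:ℤ) := by
          refine ENNReal.tsum_le_tsum fun n => ?_
          simp only [zpow_natCast]
          rw [if_pos (by simp [lt_top_iff_ne_top])]
          have : (1:ℝ≥0∞) ≤ 2 ^ n := one_le_pow₀ (by norm_num)
          calc (1:ℝ≥0∞) ≤ 4 * (1 * 1) := by norm_num
            _ ≤ _ := by gcongr
        _ ≤ _ := ENNReal.tsum_comp_le_tsum_of_injective Nat.cast_injective _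
    rw [this]; simp
  obtain ⟨n, hn1, hn2⟩ := ENNReal.exists_mem_Ioc_zpow h0 ht (by norm_num : (1:ℝ≥0∞) < 2) (by norm_num)
  refine le_trans ?_ (ENNReal.le_tsum n)
  rw [if_pos hn1]
  calc a ^ 2 ≤ (2 ^ (n + 1)) ^ 2 := by gcongr
    _ = 4 * (2 ^ n * 2 ^ n) := by
      rw [ENNReal.zpow_add (by norm_num) (by norm_num), zpow_one]; ring

/-- Hardy-Littlewood in L² -/
lemma MM_L2 {F : ℝ → ℝ≥0∞} (hF : Measurable F) (hfin : ∀ x, F x ≠ ⊤) :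
    ∫⁻ x, MM F x ^ 2 ≤ 512 * ∫⁻ x, F x ^ 2 := by
  have hM := measurable_MM hF
  calc ∫⁻ x, MM F x ^ 2 ≤ ∫⁻ x, ∑' k : ℤ, (if 2 ^ k < MM F x then 4 * ((2:ℝ≥0∞) ^ k * 2 ^ k) else 0) :=
        lintegral_mono fun x => sq_le_tsum _
    _ = ∑' k : ℤ, ∫⁻ x, (if 2 ^ k < MM F x then 4 * ((2:ℝ≥0∞) ^ k * 2 ^ k) else 0) := by
        rw [lintegral_tsum]
        intro k
        exact (Measurable.ite (measurableSet_lt measurable_const hM) measurable_const measurable_const).aemeasurable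
    _ = ∑' k : ℤ, 4 * ((2:ℝ≥0∞) ^ k * 2 ^ k) * volume {x | 2 ^ k < MM F x} := by
        congr 1; ext k
        rw [← lintegral_indicator_const (measurableSet_lt measurable_const hM)]
        congr 1; ext x; simp [Set.indicator]
    _ ≤ ∑' k : ℤ, 64 * (2 ^ k * ∫⁻ y, {y | 2 ^ (k - 2) < F y}.indicator F y) := by
        refine ENNReal.tsum_le_tsum fun k => ?_
        have h2 : (2:ℝ≥0∞) ^ k = 2 * 2 ^ (k - 1) := by
          conv_lhs => rw [show k = (k - 1) + 1 by ring]
          rw [ENNReal.zpow_add (by norm_num) (by norm_num), zpow_one, mul_comm]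
        calc 4 * ((2:ℝ≥0∞) ^ k * 2 ^ k) * volume {x | 2 ^ k < MM F x}
            = 8 * 2 ^ k * (2 ^ (k - 1) * volume {x | 2 ^ k < MM F x}) := by
              nth_rewrite 2 [h2]; ring
          _ ≤ 8 * 2 ^ k * (8 * ∫⁻ y, {y | 2 ^ (k - 2) < F y}.indicator F y) := by
              exact mul_le_mul' le_rfl (MM_dist F hF k)
          _ = _ := by ring
    _ = 64 * ∫⁻ y, ∑' k : ℤ, (2 ^ k * {y | 2 ^ (k - 2) < F y}.indicator F y) := by
        rw [lintegral_tsum]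
        · rw [ENNReal.tsum_mul_left]
          congr 2; ext k
          rw [lintegral_const_mul]
          exact hF.indicator (measurableSet_lt measurable_const hF)
        · intro k
          exact ((hF.indicator (measurableSet_lt measurable_const hF)).const_mul _).aemeasurable
    _ ≤ 64 * ∫⁻ y, 8 * F y ^ 2 := by
        gcongr with y
        have : ∀ k : ℤ, 2 ^ k * {y | 2 ^ (k - 2) < F y}.indicator F y = F y * (if 2 ^ k < 4 * F y then 2 ^ k else 0) := by
          intro k
          have e : (2:ℝ≥0∞) ^ k = 4 * 2 ^ (k - 2) := by
            conv_lhs => rw [show k = (k - 2) + 2 by ring]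
            rw [ENNReal.zpow_add (by norm_num) (by norm_num), mul_comm]; congr 1; norm_cast
          have e2 : (2 ^ k < 4 * F y) ↔ 2 ^ (k - 2) < F y := by
            rw [e]; exact ENNReal.mul_lt_mul_iff_right (by norm_num) (by norm_num)
          by_cases h : 2 ^ (k - 2) < F y
          · rw [if_pos (e2.2 h), Set.indicator_of_mem (show y ∈ {y | 2 ^ (k - 2) < F y} from h), mul_comm]
          · rw [if_neg (fun h' => h (e2.1 h')), Set.indicator_of_notMem (show y ∉ {y | 2 ^ (k - 2) < F y} from h)]; simp
        simp_rw [this]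
        rw [ENNReal.tsum_mul_left]
        calc F y * _ ≤ F y * (2 * (4 * F y)) := by
              gcongr
              exact tsum_zpow_le (ENNReal.mul_ne_top (by norm_num) (hfin y))
          _ = _ := by ring
    _ = 512 * ∫⁻ x, F x ^ 2 := by
        rw [lintegral_const_mul _ (hF.pow_const 2), ← mul_assoc]; norm_num

end Carl

namespace Carl
open Complex (I)

/-- weight at scale `2^s` -/
noncomputable def wt (s : ℕ) (t : ℝ) : ℝ := 1 + |t| / 2 ^ s

lemma one_le_wt (s : ℕ) (t : ℝ) : 1 ≤ wt s t := by unfold wt; have : 0 ≤ |t| / 2 ^ s := by positivity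
                                                   linarith
lemma wt_pos (s : ℕ) (t : ℝ) : 0 < wt s t := lt_of_lt_of_le one_pos (one_le_wt s t)
lemma wt_ne (s : ℕ) (t : ℝ) : wt s t ≠ 0 := (wt_pos s t).ne'
lemma wt_inv_le_one (s : ℕ) (t : ℝ) : (wt s t)⁻¹ ≤ 1 := inv_le_one_of_one_le₀ (one_le_wt s t)
lemma wt_inv_nonneg (s : ℕ) (t : ℝ) : 0 ≤ (wt s t)⁻¹ := (inv_pos.2 (wt_pos s t)).le
lemma wt_continuous (s : ℕ) : Continuous (wt s) := by unfold wt; fun_prop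
lemma wt_inv_continuous (s : ℕ) : Continuous (fun t => (wt s t)⁻¹) := (wt_continuous s).inv₀ (wt_ne s)
lemma wt_neg (s : ℕ) (t : ℝ) : wt s (-t) = wt s t := by unfold wt; rw [abs_neg]
lemma wt_sub_comm (s : ℕ) (a b : ℝ) : wt s (a - b) = wt s (b - a) := by rw [← wt_neg, neg_sub]
lemma wt_eq (s : ℕ) (t : ℝ) : wt s t = 1 + |t / 2 ^ s| := by
  unfold wt; rw [abs_div, abs_of_pos (by positivity : (0:ℝ) < 2 ^ s)]
lemma wt_add_le (s : ℕ) (a b : ℝ) : wt s (a + b) ≤ wt s a * wt s b := by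
  unfold wt
  have h1 : |a + b| / 2 ^ s ≤ |a| / 2 ^ s + |b| / 2 ^ s := by
    rw [← add_div]; gcongr; exact abs_add_le a b
  have h2 : 0 ≤ |a| / 2 ^ s * (|b| / 2 ^ s) := by positivity
  nlinarith
lemma wt_inv_shift (s : ℕ) (a b : ℝ) : (wt s a)⁻¹ ≤ (wt s b)⁻¹ * wt s (b - a) := by
  have h := wt_add_le s (b - a) a
  rw [sub_add_cancel] at h
  rw [← div_eq_inv_mul, inv_eq_one_div, div_le_div_iff₀ (wt_pos s a) (wt_pos s b)]
  linarith
lemma wt_anti {s s' : ℕ} (h : s ≤ s') (t : ℝ) : wt s' t ≤ wt s t := by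
  unfold wt; gcongr; norm_num
lemma wt_pow_le (s : ℕ) (t : ℝ) {m n : ℕ} (h : m ≤ n) : (wt s t)⁻¹ ^ n ≤ (wt s t)⁻¹ ^ m :=
  pow_le_pow_of_le_one (wt_inv_nonneg s t) (wt_inv_le_one s t) h
lemma wt_pow_cancel (s : ℕ) (t : ℝ) (m n : ℕ) : (wt s t)⁻¹ ^ (m + n) * wt s t ^ m = (wt s t)⁻¹ ^ n := by
  have := wt_ne s t
  rw [pow_add, inv_pow, inv_pow]; field_simp

/-- decaying kernel at scale `2^s` -/
noncomputable def kd (s n : ℕ) (t : ℝ) : ℝ := (2 ^ s)⁻¹ * (wt s t)⁻¹ ^ n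

lemma kd_nonneg (s n : ℕ) (t : ℝ) : 0 ≤ kd s n t := by
  unfold kd; have := wt_inv_nonneg s t; positivity
lemma kd_continuous (s n : ℕ) : Continuous (kd s n) := ((wt_inv_continuous s).pow n).const_mul _
lemma kd_le (s : ℕ) {m n : ℕ} (h : m ≤ n) (t : ℝ) : kd s n t ≤ kd s m t := by
  unfold kd; have := wt_pow_le s t h; gcongr
lemma kd_le_inv (s n : ℕ) (t : ℝ) : kd s n t ≤ (2 ^ s)⁻¹ := by
  unfold kd
  have h := pow_le_one₀ (n := n) (wt_inv_nonneg s t) (wt_inv_le_one s t)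
  exact mul_le_of_le_one_right (by positivity) h
lemma kd_le_one (s n : ℕ) (t : ℝ) : kd s n t ≤ 1 :=
  (kd_le_inv s n t).trans (inv_le_one_of_one_le₀ (one_le_pow₀ (by norm_num)))
lemma kd_two_integrable (s : ℕ) : Integrable (kd s 2) := by
  have := (integrable_dec.comp_div (R := (2:ℝ) ^ s) (by positivity)).const_mul ((2:ℝ) ^ s)⁻¹
  refine this.congr (Filter.Eventually.of_forall fun t => ?_)
  simp [kd, wt_eq]
lemma kd_integrable (s : ℕ) {n : ℕ} (h : 2 ≤ n) : Integrable (kd s n) := by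
  refine (kd_two_integrable s).mono' (kd_continuous s n).aestronglyMeasurable (Filter.Eventually.of_forall fun t => ?_)
  rw [Real.norm_of_nonneg (kd_nonneg _ _ _)]
  exact kd_le s h t
lemma kd_two_integral (s : ℕ) : ∫ t, kd s 2 t ≤ 4 := by
  have h1 : ∫ t, kd s 2 t = ∫ t : ℝ, (1 + |t|)⁻¹ ^ 2 := by
    have : (fun t => kd s 2 t) = fun t => ((2:ℝ) ^ s)⁻¹ * ((fun t : ℝ => (1 + |t|)⁻¹ ^ 2) (t / 2 ^ s)) := by
      ext t; simp [kd, wt_eq]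
    rw [this, integral_const_mul, Measure.integral_comp_div (fun t : ℝ => (1 + |t|)⁻¹ ^ 2), abs_of_pos (by positivity), smul_eq_mul, ← mul_assoc,
      inv_mul_cancel₀ (by positivity), one_mul]
  rw [h1]; exact integral_dec_le
lemma kd_two_lintegral (s : ℕ) : ∫⁻ t, ENNReal.ofReal (kd s 2 t) ≤ 4 := by
  rw [← ofReal_integral_eq_lintegral_ofReal (kd_two_integrable s) (Filter.Eventually.of_forall (kd_nonneg s 2))]
  exact (ENNReal.ofReal_le_ofReal (kd_two_integral s)).trans (by simp)
lemma kd_two_lintegral_sub (s : ℕ) (x : ℝ) : ∫⁻ y, ENNReal.ofReal (kd s 2 (x - y)) ≤ 4 := by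
  rw [lintegral_sub_left_eq_self (fun t => ENNReal.ofReal (kd s 2 t))]; exact kd_two_lintegral s
lemma kd_lintegral_sub (s : ℕ) {n : ℕ} (h : 2 ≤ n) (x : ℝ) : ∫⁻ y, ENNReal.ofReal (kd s n (x - y)) ≤ 4 :=
  (lintegral_mono fun _ => ENNReal.ofReal_le_ofReal (kd_le s h _)).trans (kd_two_lintegral_sub s x)

lemma exists_shell {v : ℝ} (hv : 0 ≤ v) : ∃ k : ℕ, v < 2 ^ k ∧ (1 + v)⁻¹ ^ 2 ≤ 4 * (4⁻¹) ^ k := by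
  classical
  obtain ⟨k0, hk0⟩ := pow_unbounded_of_one_lt v (by norm_num : (1:ℝ) < 2)
  have hex : ∃ k : ℕ, v < 2 ^ k := ⟨k0, hk0⟩
  refine ⟨Nat.find hex, Nat.find_spec hex, ?_⟩
  rcases h : Nat.find hex with _ | k
  · simp
    calc ((1 + v) ^ 2)⁻¹ ≤ 1 := inv_le_one_of_one_le₀ (one_le_pow₀ (by linarith))
      _ ≤ 4 := by norm_num
  · have h1 := Nat.find_min hex (show k < Nat.find hex by omega)
    have h2 : (2:ℝ) ^ k ≤ 1 + v := by linarith [not_lt.1 h1]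
    calc (1 + v)⁻¹ ^ 2 ≤ ((2:ℝ) ^ k)⁻¹ ^ 2 := by gcongr
      _ = 4 * (4⁻¹) ^ (k + 1) := by
        rw [inv_pow, ← pow_mul, mul_comm k 2, pow_mul, pow_succ (4⁻¹:ℝ), inv_pow]; norm_num; ring

lemma kd_MM (F : ℝ → ℝ≥0∞) (hF : Measurable F) (s : ℕ) (x : ℝ) :
    ∫⁻ y, ENNReal.ofReal (kd s 2 (x - y)) * F y ≤ 8 * MM F x := by
  have h1 : ∀ y, ENNReal.ofReal (kd s 2 (x - y)) * F y ≤
      ∑' k : ℕ, 4 * 2⁻¹ ^ k * ((2 ^ ((k + s : ℕ) : ℤ))⁻¹ * (Metric.ball x (2 ^ ((k + s : ℕ) : ℤ))).indicator F y) := by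
    intro y
    obtain ⟨k, hk1, hk2⟩ := exists_shell (v := |x - y| / 2 ^ s) (by positivity)
    refine le_trans ?_ (ENNReal.le_tsum k)
    have hy : y ∈ Metric.ball x (2 ^ ((k + s : ℕ) : ℤ)) := by
      rw [Metric.mem_ball', Real.dist_eq, zpow_natCast, pow_add]
      rwa [div_lt_iff₀ (by positivity)] at hk1
    rw [Set.indicator_of_mem hy, ← mul_assoc]
    refine mul_le_mul' ?_ le_rfl
    have e1 : (4 * 2⁻¹ ^ k * (2 ^ ((k + s : ℕ) : ℤ))⁻¹ : ℝ≥0∞) = ENNReal.ofReal (4 * 2⁻¹ ^ k * ((2:ℝ) ^ (k + s))⁻¹) := by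
      rw [ENNReal.ofReal_mul (by positivity), ENNReal.ofReal_mul (by positivity), ENNReal.ofReal_inv_of_pos (by positivity),
        ENNReal.ofReal_pow (by norm_num), ENNReal.ofReal_pow (by norm_num), ENNReal.ofReal_inv_of_pos (by norm_num), zpow_natCast]
      simp
    rw [e1]
    refine ENNReal.ofReal_le_ofReal ?_
    unfold kd wt
    calc _ ≤ ((2:ℝ) ^ s)⁻¹ * (4 * 4⁻¹ ^ k) := by gcongr
      _ = _ := by
        rw [show (4:ℝ) = 2 * 2 by norm_num]
        rw [pow_add, mul_inv, mul_inv, mul_pow, inv_pow]; ring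
  calc _ ≤ ∫⁻ y, ∑' k : ℕ, 4 * 2⁻¹ ^ k * ((2 ^ ((k + s : ℕ) : ℤ))⁻¹ * (Metric.ball x (2 ^ ((k + s : ℕ) : ℤ))).indicator F y) :=
        lintegral_mono h1
    _ = ∑' k : ℕ, 4 * 2⁻¹ ^ k * avg F ((k + s : ℕ) : ℤ) x := by
        rw [lintegral_tsum]
        · congr 1; ext k
          rw [lintegral_const_mul _ ((hF.indicator measurableSet_ball).const_mul _),
            lintegral_const_mul _ (hF.indicator measurableSet_ball), lintegral_indicator measurableSet_ball]
          rfl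
        · intro k
          exact (((hF.indicator measurableSet_ball).const_mul _).const_mul _).aemeasurable
    _ ≤ ∑' k : ℕ, 4 * 2⁻¹ ^ k * MM F x := by
        refine ENNReal.tsum_le_tsum fun k => mul_le_mul' le_rfl (le_iSup (fun j => avg F j x) _)
    _ = 8 * MM F x := by
        rw [ENNReal.tsum_mul_right, ENNReal.tsum_mul_left, ENNReal.tsum_geometric]
        congr 1
        rw [show (1 - 2⁻¹ : ℝ≥0∞) = 2⁻¹ by rw [ENNReal.one_sub_inv_two], inv_inv]; norm_num

/-- cross integral across a point `b` -/
lemma cross (s : ℕ) (b : ℝ) (A B : Set ℝ) (hAB : (A ⊆ Set.Iic b ∧ B ⊆ Set.Ici b) ∨ (A ⊆ Set.Ici b ∧ B ⊆ Set.Iic b))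
    (hA : MeasurableSet A) (hB : MeasurableSet B) :
    ∫⁻ x in A, ∫⁻ y in B, ENNReal.ofReal (kd s 4 (x - y)) ≤ 16 * 2 ^ s := by
  have key : ∀ x ∈ A, ∀ y ∈ B, ENNReal.ofReal (kd s 4 (x - y)) ≤
      2 ^ s * (ENNReal.ofReal (kd s 2 (b - x)) * ENNReal.ofReal (kd s 2 (b - y))) := by
    intro x hx y hy
    have e : (2:ℝ≥0∞) ^ s = ENNReal.ofReal (2 ^ s) := by rw [ENNReal.ofReal_pow (by norm_num)]; simp
    rw [e, ← ENNReal.ofReal_mul (kd_nonneg _ _ _), ← ENNReal.ofReal_mul (by positivity)]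
    refine ENNReal.ofReal_le_ofReal ?_
    have hadd : |x - y| = |b - x| + |b - y| := by
      rcases hAB with ⟨h1, h2⟩ | ⟨h1, h2⟩
      · have := h1 hx; have := h2 hy; simp only [Set.mem_Iic, Set.mem_Ici] at *
        rw [abs_of_nonpos (by linarith : x - y ≤ 0), abs_of_nonneg (by linarith : 0 ≤ b - x),
          abs_of_nonpos (by linarith : b - y ≤ 0)]; ring
      · have := h1 hx; have := h2 hy; simp only [Set.mem_Iic, Set.mem_Ici] at *
        rw [abs_of_nonneg (by linarith : 0 ≤ x - y), abs_of_nonpos (by linarith : b - x ≤ 0),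
          abs_of_nonneg (by linarith : 0 ≤ b - y)]; ring
    have e1 : wt s (b - x) ≤ wt s (x - y) := by unfold wt; rw [hadd]; gcongr; linarith [abs_nonneg (b - y)]
    have e2 : wt s (b - y) ≤ wt s (x - y) := by unfold wt; rw [hadd]; gcongr; linarith [abs_nonneg (b - x)]
    have := wt_pos s (b - x)
    have := wt_pos s (b - y)
    have := wt_inv_nonneg s (x - y)
    unfold kd
    calc ((2:ℝ) ^ s)⁻¹ * (wt s (x - y))⁻¹ ^ 4 = ((2:ℝ) ^ s)⁻¹ * ((wt s (x - y))⁻¹ ^ 2 * (wt s (x - y))⁻¹ ^ 2) := by ring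
      _ ≤ ((2:ℝ) ^ s)⁻¹ * ((wt s (b - x))⁻¹ ^ 2 * (wt s (b - y))⁻¹ ^ 2) := by gcongr
      _ = _ := by field_simp
  have hm : ∀ z : ℝ, Measurable fun y => ENNReal.ofReal (kd s 2 (z - y)) := fun z =>
    ((kd_continuous s 2).comp (continuous_const.sub continuous_id)).measurable.ennreal_ofReal
  calc _ ≤ ∫⁻ x in A, ∫⁻ y in B, 2 ^ s * (ENNReal.ofReal (kd s 2 (b - x)) * ENNReal.ofReal (kd s 2 (b - y))) :=
        setLIntegral_mono' hA fun x hx => setLIntegral_mono' hB fun y hy => key x hx y hy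
    _ ≤ ∫⁻ x, ∫⁻ y, 2 ^ s * (ENNReal.ofReal (kd s 2 (b - x)) * ENNReal.ofReal (kd s 2 (b - y))) :=
        (setLIntegral_le_lintegral _ _).trans (lintegral_mono fun x => setLIntegral_le_lintegral _ _)
    _ = 2 ^ s * ((∫⁻ x, ENNReal.ofReal (kd s 2 (b - x))) * ∫⁻ y, ENNReal.ofReal (kd s 2 (b - y))) := by
        rw [← lintegral_mul_const _ (hm b), ← lintegral_const_mul _ ((hm b).mul_const _)]
        congr 1; ext x
        rw [lintegral_const_mul _ ((hm b).const_mul _), lintegral_const_mul _ (hm b)]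
    _ ≤ 2 ^ s * (4 * 4) := by
        gcongr <;> exact kd_two_lintegral_sub s b
    _ = _ := by ring

end Carl

namespace Carl
open Complex (I)

/-- dyadic index of `x` at scale `2^s` -/
noncomputable def Dy (x : ℝ) (s : ℕ) : ℤ := ⌊x / 2 ^ s⌋

/-- dyadic interval -/
def In (s : ℕ) (j : ℤ) : Set ℝ := {x | Dy x s = j}

lemma In_eq (s : ℕ) (j : ℤ) : In s j = Set.Ico (j * 2 ^ s : ℝ) ((j + 1) * 2 ^ s) := by
  ext x
  simp only [In, Dy, Set.mem_ofPred_eq, Int.floor_eq_iff, Set.mem_Ico]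
  rw [le_div_iff₀ (by positivity), div_lt_iff₀ (by positivity)]

lemma mem_In_Dy (x : ℝ) (s : ℕ) : x ∈ In s (Dy x s) := rfl

lemma In_meas (s : ℕ) (j : ℤ) : MeasurableSet (In s j) := by rw [In_eq]; exact measurableSet_Ico

lemma In_vol (s : ℕ) (j : ℤ) : volume (In s j) = 2 ^ s := by
  rw [In_eq, Real.volume_Ico, show ((j:ℝ) + 1) * 2 ^ s - j * 2 ^ s = 2 ^ s by ring, ENNReal.ofReal_pow (by norm_num)]
  simp

lemma Dy_measurable (s : ℕ) : Measurable (fun x => Dy x s) := by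
  unfold Dy; exact Int.measurable_floor.comp (measurable_id.div_const _)

/-- left end point -/
noncomputable def lp (s : ℕ) (j : ℤ) : ℝ := j * 2 ^ s

lemma Dy_lp (s : ℕ) (j : ℤ) : Dy (lp s j) s = j := by
  unfold Dy lp; rw [mul_div_cancel_right₀ _ (by positivity)]; simp

lemma lp_mem (s : ℕ) (j : ℤ) : lp s j ∈ In s j := Dy_lp s j

lemma In_dist {s : ℕ} {j : ℤ} {x y : ℝ} (hx : x ∈ In s j) (hy : y ∈ In s j) : |x - y| ≤ 2 ^ s := by
  rw [In_eq] at hx hy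
  rw [abs_le]; constructor <;> nlinarith [hx.1, hx.2, hy.1, hy.2]

lemma wt_In {s : ℕ} {j : ℤ} {x y : ℝ} (hx : x ∈ In s j) (hy : y ∈ In s j) : wt s (x - y) ≤ 2 := by
  unfold wt
  have := In_dist hx hy
  have : |x - y| / 2 ^ s ≤ 1 := by rw [div_le_one (by positivity)]; exact this
  linarith

lemma Dy_succ (x : ℝ) (s : ℕ) : Dy x (s + 1) = Dy x s / 2 := by
  unfold Dy
  rw [pow_succ, ← div_div]
  exact_mod_cast Int.floor_div_natCast (x / 2 ^ s) 2

lemma Dy_mono {x y : ℝ} {s t : ℕ} (h : Dy x s = Dy y s) (hst : s ≤ t) : Dy x t = Dy y t := by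
  induction t, hst using Nat.le_induction with
  | base => exact h
  | succ n _ ih => rw [Dy_succ, Dy_succ, ih]

lemma In_subset {s t : ℕ} (hst : s ≤ t) {j k : ℤ} {x : ℝ} (hx : x ∈ In s j) (hx' : x ∈ In t k) : In s j ⊆ In t k := by
  intro y hy
  have h1 : Dy y s = Dy x s := (show Dy y s = j from hy).trans (show Dy x s = j from hx).symm
  exact (Dy_mono h1 hst).trans hx'

lemma In_disj {s : ℕ} {j k : ℤ} (h : j ≠ k) : Disjoint (In s j) (In s k) :=
  Set.disjoint_left.2 fun _ h1 h2 => h ((show _ = j from h1).symm.trans h2)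

/-- families closed upwards inside a top interval -/
structure UpIn (Q : Finset (ℕ × ℤ)) (t : ℕ) (k : ℤ) : Prop where
  sub : ∀ p ∈ Q, 1 ≤ p.1 ∧ p.1 ≤ t ∧ In p.1 p.2 ⊆ In t k
  up : ∀ (x : ℝ) (s s' : ℕ), (s, Dy x s) ∈ Q → s ≤ s' → s' ≤ t → (s', Dy x s') ∈ Q

/-- maximal intervals not in the family -/
noncomputable def stp (Q : Finset (ℕ × ℤ)) : Finset (ℕ × ℤ) :=
  (Q.image (fun p => (p.1 - 1, 2 * p.2)) ∪ Q.image (fun p => (p.1 - 1, 2 * p.2 + 1))).filter (fun p => p ∉ Q)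

lemma mem_stp {Q : Finset (ℕ × ℤ)} {t : ℕ} {k : ℤ} (hQ : UpIn Q t k) (p : ℕ × ℤ) :
    p ∈ stp Q ↔ p ∉ Q ∧ (p.1 + 1, p.2 / 2) ∈ Q := by
  obtain ⟨r, j⟩ := p
  simp only [stp, Finset.mem_filter, Finset.mem_union, Finset.mem_image, Prod.exists, Prod.mk.injEq]
  rw [and_comm]
  refine and_congr_right fun _ => ⟨?_, ?_⟩
  · rintro (⟨a, b, hab, rfl, rfl⟩ | ⟨a, b, hab, rfl, rfl⟩)
    · have := (hQ.sub _ hab).1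
      rw [show a - 1 + 1 = a from Nat.sub_add_cancel this, show 2 * b / 2 = b by omega]; exact hab
    · have := (hQ.sub _ hab).1
      rw [show a - 1 + 1 = a from Nat.sub_add_cancel this, show (2 * b + 1) / 2 = b by omega]; exact hab
  · intro h
    rcases Int.emod_two_eq_zero_or_one j with h2 | h2
    · left; exact ⟨r + 1, j / 2, h, by omega, by omega⟩
    · right; exact ⟨r + 1, j / 2, h, by omega, by omega⟩

lemma exists_stp {Q : Finset (ℕ × ℤ)} {t : ℕ} {k : ℤ} (hQ : UpIn Q t k) (ht : (t, k) ∈ Q) {x : ℝ} (hx : x ∈ In t k)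
    {r : ℕ} (hrt : r ≤ t) (hr : (r, Dy x r) ∉ Q) : ∃ r', r ≤ r' ∧ r' < t ∧ (r', Dy x r') ∈ stp Q := by
  have hx' : Dy x t = k := hx
  induction hn : t - r generalizing r with
  | zero =>
    have : r = t := by omega
    subst this; rw [hx'] at hr; exact absurd ht hr
  | succ n ih =>
    by_cases h : (r + 1, Dy x (r + 1)) ∈ Q
    · refine ⟨r, le_rfl, by omega, (mem_stp hQ _).2 ⟨hr, ?_⟩⟩
      simp only; rw [← Dy_succ]; exact h
    · obtain ⟨r', h1, h2⟩ := ih (by omega) h (by omega)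
      exact ⟨r', by omega, h2⟩

lemma stp_unique {Q : Finset (ℕ × ℤ)} {t : ℕ} {k : ℤ} (hQ : UpIn Q t k) {x : ℝ} {r r' : ℕ}
    (h : (r, Dy x r) ∈ stp Q) (h' : (r', Dy x r') ∈ stp Q) : r = r' := by
  have key : ∀ a b : ℕ, (a, Dy x a) ∈ stp Q → (b, Dy x b) ∈ stp Q → ¬ a < b := by
    intro a b ha hb hab
    rw [mem_stp hQ] at ha hb
    have h1 : (a + 1, Dy x (a + 1)) ∈ Q := by rw [Dy_succ]; exact ha.2
    have h2 := (hQ.sub _ hb.2).2.1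
    exact hb.1 (hQ.up x (a + 1) b h1 (by omega) (by simp at h2; omega))
  have := key r r' h h'
  have := key r' r h' h
  omega

lemma stp_sub {Q : Finset (ℕ × ℤ)} {t : ℕ} {k : ℤ} (hQ : UpIn Q t k) {p : ℕ × ℤ} (hp : p ∈ stp Q) :
    p.1 < t ∧ In p.1 p.2 ⊆ In t k := by
  rw [mem_stp hQ] at hp
  obtain ⟨h1, h2, h3⟩ := hQ.sub _ hp.2
  refine ⟨by simp at h2; omega, fun x hx => h3 ?_⟩
  show Dy x (p.1 + 1) = p.2 / 2
  rw [Dy_succ, show Dy x p.1 = p.2 from hx]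

lemma stp_disj {Q : Finset (ℕ × ℤ)} {t : ℕ} {k : ℤ} (hQ : UpIn Q t k) :
    (stp Q : Set (ℕ × ℤ)).PairwiseDisjoint (fun p => In p.1 p.2) := by
  rintro ⟨r, j⟩ hp ⟨r', j'⟩ hq hne
  refine Set.disjoint_left.2 fun x h1 h2 => hne ?_
  have e1 : Dy x r = j := h1
  have e2 : Dy x r' = j' := h2
  subst e1; subst e2
  have := stp_unique hQ hp hq
  subst this; rfl

lemma sum_lintegral_le {ι : Type*} (S : Finset ι) (A : ι → Set ℝ) (hA : ∀ i ∈ S, MeasurableSet (A i))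
    (hd : (S : Set ι).PairwiseDisjoint A) (B : Set ℝ) (hB : ∀ i ∈ S, A i ⊆ B) (g : ℝ → ℝ≥0∞) :
    ∑ i ∈ S, ∫⁻ x in A i, g x ≤ ∫⁻ x in B, g x := by
  rw [← lintegral_biUnion_finset hd hA]
  exact lintegral_mono_set (Set.iUnion₂_subset hB)

lemma sum_stp_le {Q : Finset (ℕ × ℤ)} {t : ℕ} {k : ℤ} (hQ : UpIn Q t k) (g : ℝ → ℝ≥0∞) :
    ∑ p ∈ stp Q, ∫⁻ x in In p.1 p.2, g x ≤ ∫⁻ x in In t k, g x :=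
  sum_lintegral_le _ _ (fun p _ => In_meas p.1 p.2) (stp_disj hQ) _ (fun _ hp => (stp_sub hQ hp).2) g

lemma sum_stp_len {Q : Finset (ℕ × ℤ)} {t : ℕ} {k : ℤ} (hQ : UpIn Q t k) :
    ∑ p ∈ stp Q, (2:ℝ≥0∞) ^ p.1 ≤ 2 ^ t := by
  have := sum_stp_le hQ 1
  simpa [In_vol] using this

lemma crossI (s r : ℕ) (j : ℤ) :
    ∫⁻ x in In r j, ∫⁻ y in (In r j)ᶜ, ENNReal.ofReal (kd s 4 (x - y)) ≤ 32 * 2 ^ s := by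
  set a : ℝ := j * 2 ^ r
  set b : ℝ := (j + 1) * 2 ^ r
  have e : (In r j)ᶜ ⊆ Set.Iio a ∪ Set.Ici b := by
    intro x hx
    rw [In_eq] at hx
    by_contra h
    simp only [Set.mem_union, Set.mem_Iio, Set.mem_Ici, not_or, not_lt, not_le] at h
    exact hx h
  have hm : Measurable (fun x => ∫⁻ y in Set.Iio a, ENNReal.ofReal (kd s 4 (x - y))) := by
    refine Measurable.lintegral_prod_right' (f := fun p : ℝ × ℝ => ENNReal.ofReal (kd s 4 (p.1 - p.2))) ?_
    exact ((kd_continuous s 4).comp (continuous_fst.sub continuous_snd)).measurable.ennreal_ofReal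
  calc _ ≤ ∫⁻ x in In r j, ((∫⁻ y in Set.Iio a, ENNReal.ofReal (kd s 4 (x - y))) + ∫⁻ y in Set.Ici b, ENNReal.ofReal (kd s 4 (x - y))) :=
        lintegral_mono fun x => (lintegral_mono_set e).trans (lintegral_union_le _ _ _)
    _ = (∫⁻ x in In r j, ∫⁻ y in Set.Iio a, ENNReal.ofReal (kd s 4 (x - y))) + ∫⁻ x in In r j, ∫⁻ y in Set.Ici b, ENNReal.ofReal (kd s 4 (x - y)) :=
        lintegral_add_left hm _
    _ ≤ 16 * 2 ^ s + 16 * 2 ^ s := by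
        refine add_le_add ?_ ?_
        · refine cross s a _ _ (Or.inr ⟨?_, Set.Iio_subset_Iic_self⟩) (In_meas _ _) measurableSet_Iio
          rw [In_eq]; exact fun x hx => hx.1
        · refine cross s b _ _ (Or.inl ⟨?_, subset_rfl⟩) (In_meas _ _) measurableSet_Ici
          rw [In_eq]; exact fun x hx => hx.2.le
    _ = _ := by ring

lemma crossI' (s r : ℕ) (j : ℤ) :
    ∫⁻ x in (In r j)ᶜ, ∫⁻ y in In r j, ENNReal.ofReal (kd s 4 (x - y)) ≤ 32 * 2 ^ s := by
  rw [lintegral_lintegral_swap]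
  · have := crossI s r j
    convert this using 6 with x y
    unfold kd; rw [wt_sub_comm]
  · exact ((kd_continuous s 4).comp (continuous_fst.sub continuous_snd)).measurable.ennreal_ofReal.aemeasurable

/-- union of the scale `s` members -/
def AA (Q : Finset (ℕ × ℤ)) (s : ℕ) : Set ℝ := {x | (s, Dy x s) ∈ Q}

lemma AA_meas (Q : Finset (ℕ × ℤ)) (s : ℕ) : MeasurableSet (AA Q s) := by
  have : AA Q s = (fun x => Dy x s) ⁻¹' {j | (s, j) ∈ Q} := rfl
  rw [this]; exact Dy_measurable s (by trivial)

lemma geom_sum_le (r : ℕ) : ∑ s ∈ Finset.range (r + 1), (2:ℝ≥0∞) ^ s ≤ 2 * 2 ^ r := by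
  induction r with
  | zero => simp
  | succ n ih =>
    rw [Finset.sum_range_succ]
    calc ∑ s ∈ Finset.range (n + 1), (2:ℝ≥0∞) ^ s + 2 ^ (n + 1) ≤ 2 * 2 ^ n + 2 ^ (n + 1) := by gcongr
      _ = 2 * 2 ^ (n + 1) := by ring

lemma boundary {Q : Finset (ℕ × ℤ)} {t : ℕ} {k : ℤ} (hQ : UpIn Q t k) :
    ∑ s ∈ Finset.Icc 1 t, ∫⁻ x in AA Q s, ∫⁻ y in (AA Q s)ᶜ, ENNReal.ofReal (kd s 4 (x - y)) ≤ 128 * 2 ^ t := by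
  classical
  have hm : ∀ (s : ℕ) (B : Set ℝ), Measurable (fun x => ∫⁻ y in B, ENNReal.ofReal (kd s 4 (x - y))) := by
    intro s B
    refine Measurable.lintegral_prod_right' (f := fun p : ℝ × ℝ => ENNReal.ofReal (kd s 4 (p.1 - p.2))) ?_
    exact ((kd_continuous s 4).comp (continuous_fst.sub continuous_snd)).measurable.ennreal_ofReal
  have hs : ∀ s ∈ Finset.Icc 1 t, ∫⁻ x in AA Q s, ∫⁻ y in (AA Q s)ᶜ, ENNReal.ofReal (kd s 4 (x - y)) ≤
      32 * 2 ^ s + ∑ q ∈ stp Q, if s ≤ q.1 then 32 * 2 ^ s else 0 := by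
    intro s hs
    rw [Finset.mem_Icc] at hs
    have hA : AA Q s ⊆ In t k := fun x hx => (hQ.sub _ hx).2.2 (mem_In_Dy x s)
    rcases (AA Q s).eq_empty_or_nonempty with h0 | ⟨x0, hx0⟩
    · rw [h0]; simp
    have htk : (t, k) ∈ Q := by
      have h1 := hQ.up x0 s t hx0 hs.2 le_rfl
      rwa [show Dy x0 t = k from hA hx0] at h1
    have hcov : (AA Q s)ᶜ ⊆ (In t k)ᶜ ∪ ⋃ q ∈ (stp Q).filter (fun q => s ≤ q.1), In q.1 q.2 := by
      intro y hy
      by_cases hyt : y ∈ In t k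
      · right
        obtain ⟨r', h1, h2, h3⟩ := exists_stp hQ htk hyt hs.2 hy
        simp only [Set.mem_iUnion]
        exact ⟨(r', Dy y r'), Finset.mem_filter.2 ⟨h3, h1⟩, mem_In_Dy y r'⟩
      · left; exact hyt
    have hsub : ∀ q ∈ (stp Q).filter (fun q => s ≤ q.1), AA Q s ⊆ (In q.1 q.2)ᶜ := by
      intro q hq x hx hxq
      rw [Finset.mem_filter] at hq
      have h1 := (stp_sub hQ hq.1).1
      have h2 := hQ.up x s q.1 hx hq.2 h1.le
      rw [show Dy x q.1 = q.2 from hxq] at h2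
      exact ((mem_stp hQ q).1 hq.1).1 h2
    calc ∫⁻ x in AA Q s, ∫⁻ y in (AA Q s)ᶜ, ENNReal.ofReal (kd s 4 (x - y))
        ≤ ∫⁻ x in AA Q s, ((∫⁻ y in (In t k)ᶜ, ENNReal.ofReal (kd s 4 (x - y))) +
            ∑ q ∈ (stp Q).filter (fun q => s ≤ q.1), ∫⁻ y in In q.1 q.2, ENNReal.ofReal (kd s 4 (x - y))) := by
          refine lintegral_mono fun x => (lintegral_mono_set hcov).trans ((lintegral_union_le _ _ _).trans ?_)
          refine add_le_add le_rfl ?_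
          rw [lintegral_biUnion_finset ((stp_disj hQ).subset (Finset.coe_subset.2 (Finset.filter_subset _ _))) (fun q _ => In_meas q.1 q.2)]
      _ = (∫⁻ x in AA Q s, ∫⁻ y in (In t k)ᶜ, ENNReal.ofReal (kd s 4 (x - y))) +
            ∑ q ∈ (stp Q).filter (fun q => s ≤ q.1), ∫⁻ x in AA Q s, ∫⁻ y in In q.1 q.2, ENNReal.ofReal (kd s 4 (x - y)) := by
          rw [lintegral_add_left (hm _ _), lintegral_finsetSum _ (fun q _ => hm _ _)]
      _ ≤ 32 * 2 ^ s + ∑ q ∈ (stp Q).filter (fun q => s ≤ q.1), 32 * 2 ^ s := by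
          refine add_le_add ((lintegral_mono_set hA).trans (crossI s t k)) (Finset.sum_le_sum fun q hq => ?_)
          exact (lintegral_mono_set (hsub q hq)).trans (crossI' s q.1 q.2)
      _ = _ := by rw [Finset.sum_filter]
  calc _ ≤ ∑ s ∈ Finset.Icc 1 t, ((32:ℝ≥0∞) * 2 ^ s + ∑ q ∈ stp Q, if s ≤ q.1 then 32 * 2 ^ s else 0) := Finset.sum_le_sum hs
    _ = ∑ s ∈ Finset.Icc 1 t, (32:ℝ≥0∞) * 2 ^ s + ∑ q ∈ stp Q, ∑ s ∈ Finset.Icc 1 t, if s ≤ q.1 then 32 * 2 ^ s else 0 := by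
        rw [Finset.sum_add_distrib, Finset.sum_comm]
    _ ≤ 64 * 2 ^ t + ∑ q ∈ stp Q, 64 * 2 ^ q.1 := by
        have h1 : ∀ r, ∑ s ∈ Finset.range (r + 1), (32:ℝ≥0∞) * 2 ^ s ≤ 64 * 2 ^ r := by
          intro r
          rw [← Finset.mul_sum]
          calc _ ≤ 32 * (2 * 2 ^ r : ℝ≥0∞) := by gcongr; exact geom_sum_le r
            _ = _ := by ring
        refine add_le_add (le_trans (Finset.sum_le_sum_of_subset ?_) (h1 t)) (Finset.sum_le_sum fun q _ => ?_)
        · intro s; simp only [Finset.mem_Icc, Finset.mem_range]; omega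
        · rw [← Finset.sum_filter]
          refine le_trans (Finset.sum_le_sum_of_subset ?_) (h1 q.1)
          intro s; simp only [Finset.mem_filter, Finset.mem_Icc, Finset.mem_range]; omega
    _ ≤ 64 * 2 ^ t + 64 * 2 ^ t := by
        rw [← Finset.mul_sum]; gcongr; exact sum_stp_len hQ
    _ = _ := by ring

end Carl

namespace Carl
open Complex (I)

lemma psi_bound8 (t : ℝ) : ‖psi t‖ ≤ 2 ^ 38 * (1 + |t|)⁻¹ ^ 8 := by
  have hp : 0 < 1 + |t| := by positivity
  rcases le_total |t| 1 with h | h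
  · have h1 : (1:ℝ) ≤ 4 * (1 + |t|)⁻¹ ^ 2 := by
      rw [inv_pow, ← div_eq_mul_inv, le_div_iff₀ (by positivity)]; nlinarith [abs_nonneg t]
    calc ‖psi t‖ ≤ 3 ^ 22 * (1 + |t|)⁻¹ ^ 6 * 1 := by rw [mul_one]; exact psi_bound t
      _ ≤ 3 ^ 22 * (1 + |t|)⁻¹ ^ 6 * (4 * (1 + |t|)⁻¹ ^ 2) := by gcongr
      _ = 3 ^ 22 * 4 * (1 + |t|)⁻¹ ^ 8 := by ring
      _ ≤ _ := by gcongr; norm_num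
  · have ht : t ≠ 0 := by intro h0; rw [h0] at h; norm_num at h
    rw [psi_of_ne ht, norm_div, Complex.norm_real, Real.norm_eq_abs]
    have h2 : ‖gg (t / 2) - gg t‖ ≤ 3 ^ 8 * (2 * (1 + |t|)⁻¹) ^ 8 + 3 ^ 8 * (1 + |t|)⁻¹ ^ 8 := by
      refine (norm_sub_le _ _).trans (add_le_add ((gg_bound _).trans ?_) (gg_bound _))
      have := half_dec (l := 1/2) (t := t) ⟨le_rfl, by norm_num⟩
      rw [show t / 2 = 1 / 2 * t by ring]
      gcongr
    calc _ ≤ ‖gg (t / 2) - gg t‖ := div_le_self (norm_nonneg _) h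
      _ ≤ _ := h2
      _ = (3 ^ 8 * 2 ^ 8 + 3 ^ 8) * (1 + |t|)⁻¹ ^ 8 := by ring
      _ ≤ _ := by gcongr; norm_num

/-- rescaled wavelet -/
noncomputable def ps (s : ℕ) (t : ℝ) : ℂ := (((2:ℝ) ^ s)⁻¹ : ℝ) * psi (t / 2 ^ s)

lemma ps_continuous (s : ℕ) : Continuous (ps s) :=
  (psi_continuous.comp (continuous_id.div_const _)).const_mul _

lemma ps_bound8 (s : ℕ) (t : ℝ) : ‖ps s t‖ ≤ 2 ^ 38 * kd s 8 t := by
  unfold ps kd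
  rw [norm_mul, Complex.norm_real, Real.norm_of_nonneg (by positivity), wt_eq]
  have := psi_bound8 (t / 2 ^ s)
  calc _ ≤ ((2:ℝ) ^ s)⁻¹ * (2 ^ 38 * (1 + |t / 2 ^ s|)⁻¹ ^ 8) := by gcongr
    _ = _ := by ring

lemma ps_bound (s : ℕ) (t : ℝ) : ‖ps s t‖ ≤ 2 ^ 38 * kd s 6 t :=
  (ps_bound8 s t).trans (by have := kd_le s (show 6 ≤ 8 by norm_num) t; gcongr)

lemma ps_lip (s : ℕ) (t v : ℝ) : ‖ps s t - ps s v‖ ≤ 2 ^ 38 * (|t - v| / 2 ^ s) * wt s (t - v) ^ 6 * kd s 6 t := by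
  unfold ps kd
  rw [← mul_sub, norm_mul, Complex.norm_real, Real.norm_of_nonneg (by positivity), wt_eq, wt_eq]
  have := psi_lip (t / 2 ^ s) (v / 2 ^ s)
  rw [← sub_div] at this
  calc _ ≤ ((2:ℝ) ^ s)⁻¹ * (3 ^ 22 * |(t - v) / 2 ^ s| * ((1 + |t / 2 ^ s|)⁻¹ ^ 6 * (1 + |(t - v) / 2 ^ s|) ^ 6)) := by gcongr
    _ ≤ ((2:ℝ) ^ s)⁻¹ * (2 ^ 38 * |(t - v) / 2 ^ s| * ((1 + |t / 2 ^ s|)⁻¹ ^ 6 * (1 + |(t - v) / 2 ^ s|) ^ 6)) := by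
        gcongr; norm_num
    _ = _ := by rw [abs_div, abs_of_pos (by positivity : (0:ℝ) < 2 ^ s)]; ring

lemma ps_BL (s : ℕ) : BL (ps s) (4 / 2 ^ s) (16 / 2 ^ s) := by
  have h := (psi_BL.affine (c := (2 ^ s)⁻¹) (by positivity) 0).const_mul ((((2:ℝ) ^ s)⁻¹ : ℝ) : ℂ)
  convert h using 1
  · ext t; simp [ps, div_eq_inv_mul]
  · ring
  · ring

lemma ps_sub_BL (s : ℕ) (x : ℝ) : BL (fun y => ps s (x - y)) (-(16 / 2 ^ s)) (-(4 / 2 ^ s)) := by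
  have h := ((ps_BL s).affine (c := 1) one_pos x).neg
  simp only [one_mul] at h
  convert h using 2 with y
  ring_nf

/-- test functions adapted to a tile -/
def WW (s : ℕ) (j : ℤ) (xi : ℝ) : Set (ℝ → ℂ) :=
  {φ | BL φ (xi - 32 / 2 ^ s) (xi - 2 / 2 ^ s) ∧ ∀ y, ‖φ y‖ ≤ kd s 6 (y - lp s j)}

/-- tile coefficient -/
noncomputable def cc (f : ℝ → ℂ) (s : ℕ) (j : ℤ) (xi : ℝ) : ℝ :=
  sSup ((fun φ : ℝ → ℂ => ‖∫ y, f y * φ y‖) '' WW s j xi)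

lemma WW_zero (s : ℕ) (j : ℤ) (xi : ℝ) : (fun _ => 0) ∈ WW s j xi :=
  ⟨BL.zero _ _, fun y => by simpa using kd_nonneg _ _ _⟩

lemma int_mul_bdd {f φ : ℝ → ℂ} (hf : Integrable f) (hφ : Continuous φ) {C : ℝ} (hC : ∀ y, ‖φ y‖ ≤ C) :
    Integrable (fun y => f y * φ y) :=
  hf.mul_bdd hφ.aestronglyMeasurable (Filter.Eventually.of_forall hC)

lemma norm_int_le {f φ : ℝ → ℂ} (hf : Integrable f) {C : ℝ} (hC : ∀ y, ‖φ y‖ ≤ C) :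
    ‖∫ y, f y * φ y‖ ≤ C * ∫ y, ‖f y‖ := by
  calc _ ≤ ∫ y, C * ‖f y‖ := by
        refine norm_integral_le_of_norm_le (hf.norm.const_mul C) (Filter.Eventually.of_forall fun y => ?_)
        rw [norm_mul, mul_comm]; gcongr; exact hC y
    _ = _ := integral_const_mul _ _

lemma WW_bdd {f : ℝ → ℂ} (hf : Integrable f) (s : ℕ) (j : ℤ) (xi : ℝ) :
    BddAbove ((fun φ : ℝ → ℂ => ‖∫ y, f y * φ y‖) '' WW s j xi) := by
  refine ⟨1 * ∫ y, ‖f y‖, ?_⟩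
  rintro _ ⟨φ, hφ, rfl⟩
  exact norm_int_le hf fun y => (hφ.2 y).trans (kd_le_one _ _ _)

lemma le_cc {f : ℝ → ℂ} (hf : Integrable f) {s : ℕ} {j : ℤ} {xi : ℝ} {φ : ℝ → ℂ} (hφ : φ ∈ WW s j xi) :
    ‖∫ y, f y * φ y‖ ≤ cc f s j xi := le_csSup (WW_bdd hf s j xi) ⟨φ, hφ, rfl⟩

lemma cc_nonneg (f : ℝ → ℂ) (s : ℕ) (j : ℤ) (xi : ℝ) : 0 ≤ cc f s j xi := by
  refine Real.sSup_nonneg ?_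
  rintro _ ⟨φ, _, rfl⟩; exact norm_nonneg _

lemma cc_le {f : ℝ → ℂ} (hf : Integrable f) (s : ℕ) (j : ℤ) (xi : ℝ) : cc f s j xi ≤ ∫ y, ‖f y‖ := by
  refine csSup_le ⟨_, ⟨_, WW_zero s j xi, rfl⟩⟩ ?_
  rintro _ ⟨φ, hφ, rfl⟩
  simpa using norm_int_le hf fun y => (hφ.2 y).trans (kd_le_one _ _ _)

lemma le_cc_mul {f : ℝ → ℂ} (hf : Integrable f) {s : ℕ} {j : ℤ} {xi A a b : ℝ} {φ : ℝ → ℂ} (hA : 0 ≤ A)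
    (hφ : BL φ a b) (ha : xi - 32 / 2 ^ s ≤ a) (hb : b ≤ xi - 2 / 2 ^ s)
    (hb : ∀ y, ‖φ y‖ ≤ A * kd s 6 (y - lp s j)) : ‖∫ y, f y * φ y‖ ≤ A * cc f s j xi := by
  rcases hA.eq_or_lt with rfl | hA
  · have : φ = fun _ => 0 := by ext y; simpa using hb y
    simp [this]
  · have h := le_cc hf (φ := fun y => ((A⁻¹ : ℝ) : ℂ) * φ y) (s := s) (j := j) (xi := xi)
      ⟨(hφ.mono ha ‹_›).const_mul _, fun y => by
        rw [norm_mul, Complex.norm_real, Real.norm_of_nonneg (by positivity), inv_mul_le_iff₀ hA]; exact hb y⟩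
    have e : ∫ y, f y * (((A⁻¹ : ℝ) : ℂ) * φ y) = ((A⁻¹ : ℝ) : ℂ) * ∫ y, f y * φ y := by
      rw [← integral_const_mul]; congr 1; ext y; ring
    rwa [e, norm_mul, Complex.norm_real, Real.norm_of_nonneg (by positivity), inv_mul_le_iff₀ hA] at h

lemma exists_near (f : ℝ → ℂ) (s : ℕ) (j : ℤ) (xi : ℝ) :
    ∃ φ ∈ WW s j xi, cc f s j xi ≤ 2 * ‖∫ y, f y * φ y‖ := by
  rcases (cc_nonneg f s j xi).eq_or_lt with h | h
  · exact ⟨_, WW_zero s j xi, by rw [← h]; positivity⟩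
  · obtain ⟨_, ⟨φ, hφ, rfl⟩, h2⟩ := exists_lt_of_lt_csSup (s := (fun φ : ℝ → ℂ => ‖∫ y, f y * φ y‖) '' WW s j xi) ⟨_, ⟨_, WW_zero s j xi, rfl⟩⟩ (half_lt_self h)
    exact ⟨φ, hφ, by unfold cc at *; simp only at h2; linarith⟩

/-- the model pieces -/
noncomputable def uu (f : ℝ → ℂ) (s : ℕ) (n : ℝ) (x : ℝ) : ℂ :=
  ∫ y, f y * (Complex.exp (I * n * y) * ps s (x - y))

lemma kd_shift6 (s : ℕ) (j : ℤ) (x y : ℝ) : kd s 6 (x - y) ≤ wt s (x - lp s j) ^ 6 * kd s 6 (y - lp s j) := by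
  unfold kd
  have h := wt_inv_shift s (x - y) (lp s j - y)
  rw [show lp s j - y - (x - y) = lp s j - x by ring, wt_sub_comm s (lp s j) x, wt_sub_comm s (lp s j) y] at h
  have := wt_inv_nonneg s (x - y)
  calc _ ≤ ((2:ℝ) ^ s)⁻¹ * ((wt s (y - lp s j))⁻¹ * wt s (x - lp s j)) ^ 6 := by gcongr
    _ = _ := by ring

lemma mod_BL (s : ℕ) (n x : ℝ) : BL (fun y => Complex.exp (I * n * y) * ps s (x - y)) (n - 16 / 2 ^ s) (n - 4 / 2 ^ s) := by
  simpa [sub_eq_add_neg] using (ps_sub_BL s x).modulate n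

lemma div_pow_le (s : ℕ) {a b : ℝ} (h : a ≤ b) : a / 2 ^ s ≤ b / 2 ^ s := by gcongr

lemma uu_bound {f : ℝ → ℂ} (hf : Integrable f) (s : ℕ) (j : ℤ) (n x : ℝ) :
    ‖uu f s n x‖ ≤ 2 ^ 38 * wt s (x - lp s j) ^ 6 * cc f s j n := by
  have := wt_pos s (x - lp s j)
  refine le_cc_mul hf (by positivity) (mod_BL s n x) ?_ ?_ fun y => ?_
  · have := div_pow_le s (show (16:ℝ) ≤ 32 by norm_num); linarith
  · have := div_pow_le s (show (2:ℝ) ≤ 4 by norm_num); linarith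
  · rw [norm_mul, norm_expI, one_mul]
    calc _ ≤ 2 ^ 38 * kd s 6 (x - y) := ps_bound s _
      _ ≤ 2 ^ 38 * (wt s (x - lp s j) ^ 6 * kd s 6 (y - lp s j)) := by gcongr; exact kd_shift6 s j x y
      _ = _ := by ring

lemma mod_int {f : ℝ → ℂ} (hf : Integrable f) (s : ℕ) (n x : ℝ) :
    Integrable (fun y => f y * (Complex.exp (I * n * y) * ps s (x - y))) := by
  refine int_mul_bdd hf (mod_BL s n x).continuous (C := 2 ^ 38) fun y => ?_
  rw [norm_mul, norm_expI, one_mul]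
  exact (ps_bound s _).trans (by have := kd_le_one s 6 (x - y); linarith)

lemma uu_bound' {f : ℝ → ℂ} (hf : Integrable f) (s : ℕ) (n x : ℝ) :
    ‖uu f s n x‖ ≤ 2 ^ 38 * ∫ y, ‖f y‖ := by
  refine norm_int_le hf fun y => ?_
  rw [norm_mul, norm_expI, one_mul]
  exact (ps_bound s _).trans (by have := kd_le_one s 6 (x - y); linarith)

lemma uu_lip {f : ℝ → ℂ} (hf : Integrable f) (s : ℕ) (j : ℤ) (n x x' : ℝ) :
    ‖uu f s n x - uu f s n x'‖ ≤
      2 ^ 38 * (|x - x'| / 2 ^ s) * wt s (x - x') ^ 6 * wt s (x - lp s j) ^ 6 * cc f s j n := by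
  have := wt_pos s (x - lp s j)
  have := wt_pos s (x - x')
  unfold uu
  rw [← integral_sub (mod_int hf s n x) (mod_int hf s n x')]
  simp_rw [← mul_sub]
  refine le_cc_mul hf (a := n - 16 / 2 ^ s) (b := n - 4 / 2 ^ s) (by positivity) ?_ ?_ ?_ fun y => ?_
  · have h := (mod_BL s n x).sub (mod_BL s n x')
    simpa [← mul_sub] using h
  · have := div_pow_le s (show (16:ℝ) ≤ 32 by norm_num); linarith
  · have := div_pow_le s (show (2:ℝ) ≤ 4 by norm_num); linarith
  · rw [norm_mul, norm_expI, one_mul]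
    have h := ps_lip s (x - y) (x' - y)
    rw [show x - y - (x' - y) = x - x' by ring] at h
    calc _ ≤ _ := h
      _ ≤ 2 ^ 38 * (|x - x'| / 2 ^ s) * wt s (x - x') ^ 6 * (wt s (x - lp s j) ^ 6 * kd s 6 (y - lp s j)) := by
          gcongr; exact kd_shift6 s j x y
      _ = _ := by ring

lemma norm_expI_sub_one (a : ℝ) : ‖Complex.exp (I * a) - 1‖ ≤ |a| := by
  simpa using Real.norm_exp_I_mul_ofReal_sub_one_le (x := a)

lemma uu_mod {f : ℝ → ℂ} (hf : Integrable f) (s : ℕ) (j : ℤ) (n xi x : ℝ) (h : |n - xi| * 2 ^ s ≤ 1) :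
    ‖uu f s n x - Complex.exp (I * (n - xi : ℝ) * x) * uu f s xi x‖ ≤
      2 ^ 38 * (|n - xi| * 2 ^ s) * wt s (x - lp s j) ^ 6 * cc f s j xi := by
  have := wt_pos s (x - lp s j)
  have hx : |n - xi| ≤ 1 / 2 ^ s := by rwa [le_div_iff₀ (by positivity)]
  rw [abs_le] at hx
  unfold uu
  rw [← integral_const_mul, ← integral_sub (mod_int hf s n x) ((mod_int hf s xi x).const_mul _)]
  have e : ∀ y : ℝ, f y * (Complex.exp (I * n * y) * ps s (x - y)) -
      Complex.exp (I * (n - xi : ℝ) * x) * (f y * (Complex.exp (I * xi * y) * ps s (x - y))) =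
      f y * (Complex.exp (I * n * y) * ps s (x - y) - Complex.exp (I * (n - xi : ℝ) * x) * (Complex.exp (I * xi * y) * ps s (x - y))) := by
    intro y; ring
  simp_rw [e]
  have d1 := div_pow_le s (show (16:ℝ) + 1 ≤ 32 by norm_num)
  have d2 := div_pow_le s (show (2:ℝ) + 1 ≤ 4 by norm_num)
  have d3 := div_pow_le s (show (2:ℝ) ≤ 4 by norm_num)
  have d4 := div_pow_le s (show (16:ℝ) ≤ 32 by norm_num)
  rw [add_div] at d1 d2
  refine le_cc_mul hf (by positivity) (BL.sub ((mod_BL s n x).mono (a' := xi - 32 / 2 ^ s) (b' := xi - 2 / 2 ^ s) ?_ ?_)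
    (((mod_BL s xi x).const_mul _).mono ?_ ?_)) le_rfl le_rfl fun y => ?_
  · linarith
  · linarith
  · linarith
  · linarith
  · have e2 : Complex.exp (I * n * y) * ps s (x - y) - Complex.exp (I * (n - xi : ℝ) * x) * (Complex.exp (I * xi * y) * ps s (x - y))
        = - (Complex.exp (I * n * y) * (Complex.exp (I * ((n - xi) * (x - y) : ℝ)) - 1) * ps s (x - y)) := by
      have : Complex.exp (I * (n - xi : ℝ) * x) * Complex.exp (I * xi * y) = Complex.exp (I * n * y) * Complex.exp (I * ((n - xi) * (x - y) : ℝ)) := by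
        rw [← Complex.exp_add, ← Complex.exp_add]; congr 1; push_cast; ring
      rw [← mul_assoc, this]; ring
    rw [e2, norm_neg, norm_mul, norm_mul, norm_expI, one_mul]
    have h1 := norm_expI_sub_one ((n - xi) * (x - y))
    rw [abs_mul] at h1
    have h2 : |x - y| ≤ 2 ^ s * wt s (x - y) := by
      unfold wt; rw [mul_add, mul_div_cancel₀ _ (by positivity)]; nlinarith [pow_pos (two_pos : (0:ℝ) < 2) s]
    have h3 : wt s (x - y) * kd s 8 (x - y) ≤ kd s 6 (x - y) := by
      refine le_trans (le_of_eq ?_) (kd_le s (show 6 ≤ 7 by norm_num) (x - y))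
      unfold kd
      have := wt_ne s (x - y)
      field_simp
    calc _ ≤ (|n - xi| * |x - y|) * (2 ^ 38 * kd s 8 (x - y)) := by
          gcongr; exact ps_bound8 s _
      _ ≤ (|n - xi| * (2 ^ s * wt s (x - y))) * (2 ^ 38 * kd s 8 (x - y)) := by
          have := kd_nonneg s 8 (x - y); gcongr
      _ = 2 ^ 38 * (|n - xi| * 2 ^ s) * (wt s (x - y) * kd s 8 (x - y)) := by ring
      _ ≤ 2 ^ 38 * (|n - xi| * 2 ^ s) * (wt s (x - lp s j) ^ 6 * kd s 6 (y - lp s j)) := by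
          exact mul_le_mul_of_nonneg_left (h3.trans (kd_shift6 s j x y)) (by positivity)
      _ = _ := by ring

lemma uu_BL {f : ℝ → ℂ} (hf : Integrable f) (s : ℕ) (n : ℝ) : BL (uu f s n) (4 / 2 ^ s) (16 / 2 ^ s) := by
  have hf' : Integrable (fun y : ℝ => f y * Complex.exp (I * n * y)) :=
    int_mul_bdd hf (by fun_prop) (C := 1) fun y => (norm_expI n y).le
  have h := (ps_BL s).conv hf'
  convert h using 2 with x
  unfold uu; congr 1; ext y; ring

end Carl

namespace Carl
open Complex (I)

lemma sq_lintegral_mul_le {g h : ℝ → ℝ≥0∞} (μ : Measure ℝ) (hg : AEMeasurable g μ) (hh : AEMeasurable h μ) :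
    (∫⁻ x, g x * h x ∂μ) ^ 2 ≤ (∫⁻ x, g x ^ 2 ∂μ) * ∫⁻ x, h x ^ 2 ∂μ := by
  have h1 := ENNReal.lintegral_mul_le_Lp_mul_Lq μ Real.HolderConjugate.two_two hg hh
  have h2 := pow_le_pow_left' h1 2
  refine h2.trans (le_of_eq ?_)
  rw [mul_pow, ← ENNReal.rpow_natCast, ← ENNReal.rpow_natCast, ← ENNReal.rpow_mul, ← ENNReal.rpow_mul]
  norm_num

lemma sq_setLIntegral_le {g : ℝ → ℝ≥0∞} (A : Set ℝ) (hg : Measurable g) :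
    (∫⁻ x in A, g x) ^ 2 ≤ volume A * ∫⁻ x, g x ^ 2 := by
  have h := sq_lintegral_mul_le (volume.restrict A) (g := 1) (h := g) aemeasurable_const hg.aemeasurable
  simp only [Pi.one_apply, one_mul, one_pow, lintegral_const, Measure.restrict_apply_univ] at h
  exact h.trans (mul_le_mul' le_rfl (setLIntegral_le_lintegral _ _))

lemma l2_int {g h : ℝ → ℂ} (hg : MemLp g 2) (hh : MemLp h 2) : Integrable (fun x => g x * starRingEnd ℂ (h x)) := by
  have := MemLp.integrable_mul hg hh.star
  exact this

lemma l2_sq {g : ℝ → ℂ} (hg : MemLp g 2) : Integrable (fun x => ‖g x‖ ^ 2) := by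
  simpa using hg.integrable_norm_pow (p := 2) (by norm_num)

lemma norm_inner_le {g h : ℝ → ℂ} (hg : MemLp g 2) (hh : MemLp h 2) :
    ‖∫ x, g x * starRingEnd ℂ (h x)‖ ≤ ((∫ x, ‖g x‖ ^ 2) + ∫ x, ‖h x‖ ^ 2) / 2 := by
  rw [← integral_add (l2_sq hg) (l2_sq hh), ← integral_div]
  refine norm_integral_le_of_norm_le (((l2_sq hg).add (l2_sq hh)).div_const 2) (Filter.Eventually.of_forall fun x => ?_)
  rw [norm_mul, RCLike.norm_conj]
  nlinarith [sq_nonneg (‖g x‖ - ‖h x‖)]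

/-- expansion of the square norm -/
lemma sq_norm_sum {ι : Type*} (S : Finset ι) (F : ι → ℝ → ℂ) (hF : ∀ i ∈ S, MemLp (F i) 2) :
    ∫ x, ‖∑ i ∈ S, F i x‖ ^ 2 ≤ ∑ i ∈ S, ∑ j ∈ S, ‖∫ x, F i x * starRingEnd ℂ (F j x)‖ := by
  have e : ((∫ x, ‖∑ i ∈ S, F i x‖ ^ 2 : ℝ) : ℂ) = ∑ i ∈ S, ∑ j ∈ S, ∫ x, F i x * starRingEnd ℂ (F j x) := by
    rw [← integral_complex_ofReal]
    have : ∀ x, ((‖∑ i ∈ S, F i x‖ ^ 2 : ℝ) : ℂ) = ∑ i ∈ S, ∑ j ∈ S, F i x * starRingEnd ℂ (F j x) := by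
      intro x
      rw [Complex.ofReal_pow, ← Complex.mul_conj', map_sum, Finset.sum_mul_sum]
    simp_rw [this]
    rw [integral_finsetSum _ fun i hi => integrable_finsetSum _ fun j hj => l2_int (hF i hi) (hF j hj)]
    exact Finset.sum_congr rfl fun i hi => integral_finsetSum _ fun j hj => l2_int (hF i hi) (hF j hj)
  have h0 : 0 ≤ ∫ x, ‖∑ i ∈ S, F i x‖ ^ 2 := integral_nonneg fun x => by positivity
  calc ∫ x, ‖∑ i ∈ S, F i x‖ ^ 2 = ‖((∫ x, ‖∑ i ∈ S, F i x‖ ^ 2 : ℝ) : ℂ)‖ := by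
        rw [Complex.norm_real, Real.norm_of_nonneg h0]
    _ ≤ _ := by
        rw [e]
        exact (norm_sum_le _ _).trans (Finset.sum_le_sum fun i _ => norm_sum_le _ _)

lemma almost_orth {ι : Type*} (S : Finset ι) (F : ι → ℝ → ℂ) (hF : ∀ i ∈ S, MemLp (F i) 2)
    (R : ι → ι → Prop) [∀ i j, Decidable (R i j)] (hR : ∀ i j, R i j → R j i) (K : ℕ) (hK : ∀ i ∈ S, (S.filter (R i)).card ≤ K)
    (h0 : ∀ i ∈ S, ∀ j ∈ S, ¬ R i j → ∫ x, F i x * starRingEnd ℂ (F j x) = 0) :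
    ∫ x, ‖∑ i ∈ S, F i x‖ ^ 2 ≤ K * ∑ i ∈ S, ∫ x, ‖F i x‖ ^ 2 := by
  set a : ι → ℝ := fun i => ∫ x, ‖F i x‖ ^ 2 with ha
  have ha0 : ∀ i, 0 ≤ a i := fun i => integral_nonneg fun x => by positivity
  have hrow : ∑ i ∈ S, ∑ j ∈ S, (if R i j then a i else 0) ≤ K * ∑ i ∈ S, a i := by
    rw [Finset.mul_sum]
    refine Finset.sum_le_sum fun i hi => ?_
    rw [← Finset.sum_filter, Finset.sum_const, nsmul_eq_mul]
    have := hK i hi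
    have := ha0 i
    gcongr
  have hcol : ∑ i ∈ S, ∑ j ∈ S, (if R i j then a j else 0) ≤ K * ∑ i ∈ S, a i := by
    rw [Finset.sum_comm]
    refine le_trans (Finset.sum_le_sum fun i hi => Finset.sum_le_sum fun j hj => ?_) hrow
    by_cases h : R j i
    · rw [if_pos h, if_pos (hR _ _ h)]
    · rw [if_neg h]; split_ifs; exacts [ha0 i, le_rfl]
  calc _ ≤ ∑ i ∈ S, ∑ j ∈ S, ‖∫ x, F i x * starRingEnd ℂ (F j x)‖ := sq_norm_sum S F hF
    _ ≤ ∑ i ∈ S, ∑ j ∈ S, ((if R i j then a i else 0) + (if R i j then a j else 0)) / 2 := by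
        refine Finset.sum_le_sum fun i hi => Finset.sum_le_sum fun j hj => ?_
        by_cases h : R i j
        · rw [if_pos h, if_pos h]; exact norm_inner_le (hF i hi) (hF j hj)
        · rw [if_neg h, if_neg h, h0 i hi j hj h]; simp
    _ = (∑ i ∈ S, ∑ j ∈ S, (if R i j then a i else 0) + ∑ i ∈ S, ∑ j ∈ S, (if R i j then a j else 0)) / 2 := by
        simp_rw [← Finset.sum_add_distrib, Finset.sum_div]
    _ ≤ _ := by linarith

/-- rescaled bump -/
noncomputable def rs (s : ℕ) (t : ℝ) : ℝ := (2 ^ s)⁻¹ * rho (t / 2 ^ s)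

lemma rs_nonneg (s : ℕ) (t : ℝ) : 0 ≤ rs s t := mul_nonneg (by positivity) (rho_nonneg _)
lemma rs_continuous (s : ℕ) : Continuous (rs s) := (rho_continuous.comp (continuous_id.div_const _)).const_mul _
lemma rs_bound (s : ℕ) (t : ℝ) : rs s t ≤ 2 ^ 62 * kd s 16 t := by
  unfold rs kd
  rw [wt_eq]
  have := rho_bound (t / 2 ^ s)
  calc _ ≤ ((2:ℝ) ^ s)⁻¹ * (2 ^ 62 * (1 + |t / 2 ^ s|)⁻¹ ^ 16) := by gcongr
    _ = _ := by ring
lemma rs_integrable (s : ℕ) : Integrable (rs s) := (rho_integrable.comp_div (by positivity)).const_mul _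
lemma rs_integral (s : ℕ) : ∫ t, rs s t = 1 := by
  unfold rs
  rw [integral_const_mul, Measure.integral_comp_div, rho_integral, abs_of_pos (by positivity)]; simp
lemma rs_int_sub (s : ℕ) (x : ℝ) : Integrable (fun y => rs s (x - y)) := (rs_integrable s).comp_sub_left x
lemma rs_integral_sub (s : ℕ) (x : ℝ) : ∫ y, rs s (x - y) = 1 := by
  rw [integral_sub_left_eq_self (rs s) volume x, rs_integral]
lemma rs_BL (s : ℕ) : BL (fun t => (rs s t : ℂ)) (-(2 / 2 ^ s)) (2 / 2 ^ s) := by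
  have h := (rho_BL.affine (c := (2 ^ s)⁻¹) (by positivity) 0).const_mul ((((2:ℝ) ^ s)⁻¹ : ℝ) : ℂ)
  convert h using 1
  · ext t; simp [rs, div_eq_inv_mul]
  · ring
  · ring
lemma rs_sub_BL (s : ℕ) (x : ℝ) : BL (fun y => (rs s (x - y) : ℂ)) (-(2 / 2 ^ s)) (2 / 2 ^ s) := by
  have h := ((rs_BL s).affine (c := 1) one_pos x).neg
  simp only [one_mul, neg_neg] at h
  convert h using 4 with y
  ring

end Carl

namespace Carl
open Complex (I)

/-- smoothed indicator -/
noncomputable def eta (Q : Finset (ℕ × ℤ)) (s : ℕ) (x : ℝ) : ℂ :=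
  ∫ y, (AA Q s).indicator (fun _ => (1:ℂ)) y * (rs s (x - y) : ℂ)

lemma AA_sub {Q : Finset (ℕ × ℤ)} {t : ℕ} {k : ℤ} (hQ : UpIn Q t k) (s : ℕ) : AA Q s ⊆ In t k :=
  fun x hx => (hQ.sub _ hx).2.2 (mem_In_Dy x s)

lemma AA_int {Q : Finset (ℕ × ℤ)} {t : ℕ} {k : ℤ} (hQ : UpIn Q t k) (s : ℕ) :
    Integrable ((AA Q s).indicator (fun _ => (1:ℂ))) := by
  rw [integrable_indicator_iff (AA_meas Q s)]
  refine integrableOn_const ?_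
  refine ne_top_of_le_ne_top ?_ (measure_mono (AA_sub hQ s))
  rw [In_vol]; exact ENNReal.pow_ne_top (by norm_num)

lemma eta_BL {Q : Finset (ℕ × ℤ)} {t : ℕ} {k : ℤ} (hQ : UpIn Q t k) (s : ℕ) :
    BL (eta Q s) (-(2 / 2 ^ s)) (2 / 2 ^ s) := (rs_BL s).conv (AA_int hQ s)

lemma eta_enorm (Q : Finset (ℕ × ℤ)) (s : ℕ) (x : ℝ) :
    ‖eta Q s x‖ₑ ≤ ∫⁻ y in AA Q s, ENNReal.ofReal (rs s (x - y)) := by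
  unfold eta
  refine (enorm_integral_le_lintegral_enorm _).trans ?_
  rw [← lintegral_indicator (AA_meas Q s)]
  refine lintegral_mono fun y => ?_
  by_cases hy : y ∈ AA Q s
  · rw [Set.indicator_of_mem hy, Set.indicator_of_mem hy, one_mul, ← ofReal_norm, Complex.norm_real,
      Real.norm_of_nonneg (rs_nonneg _ _)]
  · rw [Set.indicator_of_notMem hy, Set.indicator_of_notMem hy]; simp

lemma one_sub_eta_enorm (Q : Finset (ℕ × ℤ)) (s : ℕ) (x : ℝ) :
    ‖1 - eta Q s x‖ₑ ≤ ∫⁻ y in (AA Q s)ᶜ, ENNReal.ofReal (rs s (x - y)) := by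
  have hi : Integrable (fun y => (rs s (x - y) : ℂ)) := (rs_int_sub s x).ofReal
  have e0 : ∀ y, (AA Q s).indicator (fun _ => (1:ℂ)) y * (rs s (x - y) : ℂ) = (AA Q s).indicator (fun y => (rs s (x - y) : ℂ)) y := by
    intro y; by_cases hy : y ∈ AA Q s <;> simp [hy]
  have e : 1 - eta Q s x = ∫ y in (AA Q s)ᶜ, (rs s (x - y) : ℂ) := by
    have h1 : ∫ y, (rs s (x - y) : ℂ) = 1 := by rw [integral_complex_ofReal, rs_integral_sub]; simp
    unfold eta
    simp_rw [e0]
    rw [integral_indicator (AA_meas Q s), ← h1, ← integral_add_compl (AA_meas Q s) hi]; ring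
  rw [e]
  refine (enorm_integral_le_lintegral_enorm _).trans (le_of_eq ?_)
  congr 1; ext y
  rw [← ofReal_norm, Complex.norm_real, Real.norm_of_nonneg (rs_nonneg _ _)]

lemma eta_le_one (Q : Finset (ℕ × ℤ)) (s : ℕ) (x : ℝ) : ‖eta Q s x‖ ≤ 1 := by
  have h := (eta_enorm Q s x).trans (setLIntegral_le_lintegral _ _)
  rw [← ofReal_integral_eq_lintegral_ofReal (rs_int_sub s x) (Filter.Eventually.of_forall fun y => rs_nonneg _ _),
    rs_integral_sub, ← ofReal_norm] at h
  exact (ENNReal.ofReal_le_ofReal_iff (by norm_num)).1 h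

/-- step function of the coefficients -/
noncomputable def qq (f : ℝ → ℂ) (xi : ℝ) (Q : Finset (ℕ × ℤ)) (s : ℕ) (z : ℝ) : ℝ≥0∞ :=
  if (s, Dy z s) ∈ Q then ENNReal.ofReal (cc f s (Dy z s) xi) else 0

lemma qq_meas (f : ℝ → ℂ) (xi : ℝ) (Q : Finset (ℕ × ℤ)) (s : ℕ) : Measurable (qq f xi Q s) := by
  classical
  have : qq f xi Q s = (fun j : ℤ => if (s, j) ∈ Q then ENNReal.ofReal (cc f s j xi) else 0) ∘ (fun z => Dy z s) := rfl
  rw [this]; exact (measurable_from_top).comp (Dy_measurable s)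

noncomputable def FF (f : ℝ → ℂ) (xi : ℝ) (Q : Finset (ℕ × ℤ)) (s : ℕ) (x : ℝ) : ℂ := eta Q s x * uu f s xi x

lemma wt_lp (s : ℕ) (x y : ℝ) : wt s (x - lp s (Dy y s)) ≤ 2 * wt s (x - y) := by
  have h := wt_add_le s (x - y) (y - lp s (Dy y s))
  rw [sub_add_sub_cancel] at h
  have h2 := wt_In (mem_In_Dy y s) (lp_mem s (Dy y s))
  nlinarith [wt_pos s (x - y)]

lemma uu_bound2 {f : ℝ → ℂ} (hf : Integrable f) (s : ℕ) (n x y : ℝ) :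
    ‖uu f s n x‖ ≤ 2 ^ 44 * wt s (x - y) ^ 6 * cc f s (Dy y s) n := by
  refine (uu_bound hf s (Dy y s) n x).trans ?_
  have h0 := cc_nonneg f s (Dy y s) n
  have h1 := wt_lp s x y
  have h2 := (wt_pos s (x - lp s (Dy y s))).le
  calc _ ≤ 2 ^ 38 * (2 * wt s (x - y)) ^ 6 * cc f s (Dy y s) n := by gcongr
    _ = _ := by ring

lemma kd_mul_pow (s n m : ℕ) (t : ℝ) : kd s (m + n) t * wt s t ^ m = kd s n t := by
  unfold kd; rw [mul_assoc, wt_pow_cancel]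

lemma FF_MM {f : ℝ → ℂ} (hf : Integrable f) (xi : ℝ) (Q : Finset (ℕ × ℤ)) (s : ℕ) (x : ℝ) :
    ‖FF f xi Q s x‖ₑ ≤ 2 ^ 109 * MM (qq f xi Q s) x := by
  unfold FF
  rw [enorm_mul]
  have hrm : Measurable fun y => ENNReal.ofReal (rs s (x - y)) :=
    ((rs_continuous s).comp (continuous_const.sub continuous_id)).measurable.ennreal_ofReal
  have hkm : Measurable fun y => ENNReal.ofReal (kd s 2 (x - y)) :=
    ((kd_continuous s 2).comp (continuous_const.sub continuous_id)).measurable.ennreal_ofReal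
  calc _ ≤ (∫⁻ y in AA Q s, ENNReal.ofReal (rs s (x - y))) * ‖uu f s xi x‖ₑ := by gcongr; exact eta_enorm Q s x
    _ = ∫⁻ y in AA Q s, ENNReal.ofReal (rs s (x - y)) * ‖uu f s xi x‖ₑ := (lintegral_mul_const _ hrm).symm
    _ ≤ ∫⁻ y in AA Q s, 2 ^ 106 * (ENNReal.ofReal (kd s 2 (x - y)) * qq f xi Q s y) := by
        refine setLIntegral_mono' (AA_meas Q s) fun y hy => ?_
        rw [qq, if_pos (show (s, Dy y s) ∈ Q from hy), ← ENNReal.ofReal_mul (kd_nonneg _ _ _), ← ofReal_norm, ← ENNReal.ofReal_mul (rs_nonneg _ _),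
          show (2:ℝ≥0∞) ^ 106 = ENNReal.ofReal (2 ^ 106) by rw [ENNReal.ofReal_pow (by norm_num)]; simp,
          ← ENNReal.ofReal_mul (by positivity)]
        refine ENNReal.ofReal_le_ofReal ?_
        have h0 := cc_nonneg f s (Dy y s) xi
        have h2 := wt_pos s (x - y)
        calc _ ≤ (2 ^ 62 * kd s (6 + 10) (x - y)) * (2 ^ 44 * wt s (x - y) ^ 6 * cc f s (Dy y s) xi) := by
              have := kd_nonneg s (6 + 10) (x - y)
              gcongr
              · exact rs_bound s _
              · exact uu_bound2 hf s xi x y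
          _ = 2 ^ 106 * ((kd s (6 + 10) (x - y) * wt s (x - y) ^ 6) * cc f s (Dy y s) xi) := by ring
          _ ≤ _ := by
              rw [kd_mul_pow]
              have := kd_le s (show 2 ≤ 10 by norm_num) (x - y)
              gcongr
    _ ≤ ∫⁻ y, 2 ^ 106 * (ENNReal.ofReal (kd s 2 (x - y)) * qq f xi Q s y) := setLIntegral_le_lintegral _ _
    _ = 2 ^ 106 * ∫⁻ y, ENNReal.ofReal (kd s 2 (x - y)) * qq f xi Q s y :=
        lintegral_const_mul _ (hkm.mul (qq_meas f xi Q s))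
    _ ≤ 2 ^ 106 * (8 * MM (qq f xi Q s) x) := by gcongr; exact kd_MM _ (qq_meas f xi Q s) s x
    _ = _ := by ring

lemma FF_L2 {f : ℝ → ℂ} (hf : Integrable f) (xi : ℝ) (Q : Finset (ℕ × ℤ)) (s : ℕ) :
    ∫⁻ x, ‖FF f xi Q s x‖ₑ ^ 2 ≤ 2 ^ 227 * ∑ p ∈ Q, if p.1 = s then ENNReal.ofReal (2 ^ p.1 * cc f p.1 p.2 xi ^ 2) else 0 := by
  have hq : ∫⁻ z, qq f xi Q s z ^ 2 ≤ ∑ p ∈ Q, if p.1 = s then ENNReal.ofReal (2 ^ p.1 * cc f p.1 p.2 xi ^ 2) else 0 := by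
    calc _ ≤ ∫⁻ z, ∑ p ∈ Q, (In p.1 p.2).indicator (fun _ => if p.1 = s then ENNReal.ofReal (cc f p.1 p.2 xi) ^ 2 else 0) z := by
          refine lintegral_mono fun z => ?_
          unfold qq
          split_ifs with h
          · refine le_trans ?_ (Finset.single_le_sum (f := fun p : ℕ × ℤ => (In p.1 p.2).indicator (fun _ => if p.1 = s then ENNReal.ofReal (cc f p.1 p.2 xi) ^ 2 else 0) z) (fun _ _ => zero_le) h)
            simp only [if_true]
            rw [Set.indicator_of_mem (mem_In_Dy z s)]
          · simp
      _ = _ := by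
          rw [lintegral_finsetSum _ (fun p _ => (measurable_const).indicator (In_meas _ _))]
          refine Finset.sum_congr rfl fun p _ => ?_
          rw [lintegral_indicator_const (In_meas _ _), In_vol]
          split_ifs
          · rw [ENNReal.ofReal_mul (by positivity), ENNReal.ofReal_pow (by norm_num), ENNReal.ofReal_pow (cc_nonneg _ _ _ _)]
            simp [mul_comm]
          · simp
  calc _ ≤ ∫⁻ x, (2 ^ 109) ^ 2 * MM (qq f xi Q s) x ^ 2 := by
        refine lintegral_mono fun x => ?_
        rw [← mul_pow]
        exact pow_le_pow_left' (FF_MM hf xi Q s x) 2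
    _ = (2 ^ 109) ^ 2 * ∫⁻ x, MM (qq f xi Q s) x ^ 2 := lintegral_const_mul _ ((measurable_MM (qq_meas f xi Q s)).pow_const 2)
    _ ≤ (2 ^ 109) ^ 2 * (512 * ∫⁻ z, qq f xi Q s z ^ 2) := by
        refine mul_le_mul' le_rfl (MM_L2 (qq_meas f xi Q s) fun x => ?_)
        unfold qq; split_ifs <;> simp
    _ ≤ (2 ^ 109) ^ 2 * (512 * ∑ p ∈ Q, if p.1 = s then ENNReal.ofReal (2 ^ p.1 * cc f p.1 p.2 xi ^ 2) else 0) := by gcongr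
    _ = _ := by rw [← mul_assoc]; congr 1; norm_num

lemma FF_BL {f : ℝ → ℂ} (hf : Integrable f) (xi : ℝ) {Q : Finset (ℕ × ℤ)} {t : ℕ} {k : ℤ} (hQ : UpIn Q t k) (s : ℕ) :
    BL (FF f xi Q s) (2 / 2 ^ s) (18 / 2 ^ s) := by
  have := (eta_BL hQ s).mul (uu_BL hf s xi)
  convert this using 1
  · rfl
  · ring
  · ring

lemma memLp_two_of {g : ℝ → ℂ} (hg : Continuous g) (h : ∫⁻ x, ‖g x‖ₑ ^ 2 ≠ ⊤) : MemLp g 2 := by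
  refine ⟨hg.aestronglyMeasurable, ?_⟩
  rw [eLpNorm_lt_top_iff_lintegral_rpow_enorm_lt_top (by norm_num) (by norm_num)]
  simpa using h.lt_top

lemma FF_memLp {f : ℝ → ℂ} (hf : Integrable f) (xi : ℝ) {Q : Finset (ℕ × ℤ)} {t : ℕ} {k : ℤ} (hQ : UpIn Q t k) (s : ℕ) :
    MemLp (FF f xi Q s) 2 := by
  refine memLp_two_of (FF_BL hf xi hQ s).continuous (ne_top_of_le_ne_top ?_ (FF_L2 hf xi Q s))
  refine ENNReal.mul_ne_top (by norm_num) (ENNReal.sum_ne_top.2 fun p _ => ?_)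
  split_ifs
  · exact ENNReal.ofReal_ne_top
  · simp

lemma lint_sq {g : ℝ → ℂ} (hg : MemLp g 2) : ∫⁻ x, ‖g x‖ₑ ^ 2 = ENNReal.ofReal (∫ x, ‖g x‖ ^ 2) := by
  rw [ofReal_integral_eq_lintegral_ofReal (l2_sq hg) (Filter.Eventually.of_forall fun x => by positivity)]
  congr 1; ext x
  rw [ENNReal.ofReal_pow (norm_nonneg _), ofReal_norm]

lemma FF_sum_L2 {f : ℝ → ℂ} (hf : Integrable f) (xi : ℝ) {Q : Finset (ℕ × ℤ)} {t : ℕ} {k : ℤ} (hQ : UpIn Q t k) :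
    ∫⁻ x, ‖∑ s ∈ Finset.Icc 1 t, FF f xi Q s x‖ₑ ^ 2 ≤
      2 ^ 230 * ENNReal.ofReal (∑ p ∈ Q, 2 ^ p.1 * cc f p.1 p.2 xi ^ 2) := by
  have hM : ∀ s ∈ Finset.Icc 1 t, MemLp (FF f xi Q s) 2 := fun s _ => FF_memLp hf xi hQ s
  have hS : MemLp (fun x => ∑ s ∈ Finset.Icc 1 t, FF f xi Q s x) 2 := memLp_finsetSum _ hM
  have h1 := almost_orth (Finset.Icc 1 t) (FF f xi Q) hM (fun i j => i < j + 4 ∧ j < i + 4) (fun i j h => ⟨h.2, h.1⟩) 8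
    (by
      intro i hi
      refine (Finset.card_le_card (t := Finset.Ico (i - 3) (i + 4)) ?_).trans (by simp; omega)
      intro j; simp only [Finset.mem_filter, Finset.mem_Icc, Finset.mem_Ico]; omega)
    (by
      intro i hi j hj hR
      have hb := (FF_BL hf xi hQ i).mul (FF_BL hf xi hQ j).conj
      refine hb.integral_zero ?_ (l2_int (hM i hi) (hM j hj))
      rw [not_and_or, not_lt, not_lt] at hR
      rcases hR with h | h
      · right
        have : (2:ℝ) ^ (j + 4) ≤ 2 ^ i := pow_le_pow_right₀ (by norm_num) h
        have h3 : (18:ℝ) / 2 ^ i ≤ 18 / 2 ^ (j + 4) := by gcongr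
        have h4 : (18:ℝ) / 2 ^ (j + 4) = 18 / 16 / 2 ^ j := by rw [pow_add]; field_simp; norm_num
        have h5 : (18:ℝ) / 16 / 2 ^ j < 2 / 2 ^ j := by gcongr; norm_num
        linarith
      · left
        have : (2:ℝ) ^ (i + 4) ≤ 2 ^ j := pow_le_pow_right₀ (by norm_num) h
        have h3 : (18:ℝ) / 2 ^ j ≤ 18 / 2 ^ (i + 4) := by gcongr
        have h4 : (18:ℝ) / 2 ^ (i + 4) = 18 / 16 / 2 ^ i := by rw [pow_add]; field_simp; norm_num
        have h5 : (18:ℝ) / 16 / 2 ^ i < 2 / 2 ^ i := by gcongr; norm_num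
        linarith)
  rw [lint_sq hS]
  calc _ ≤ ENNReal.ofReal ((8:ℕ) * ∑ i ∈ Finset.Icc 1 t, ∫ x, ‖FF f xi Q i x‖ ^ 2) := ENNReal.ofReal_le_ofReal h1
    _ = 8 * ∑ i ∈ Finset.Icc 1 t, ∫⁻ x, ‖FF f xi Q i x‖ₑ ^ 2 := by
        rw [ENNReal.ofReal_mul (by norm_num), ENNReal.ofReal_sum_of_nonneg (fun i _ => integral_nonneg fun x => by positivity)]
        congr 1
        · simp
        · exact Finset.sum_congr rfl fun i hi => (lint_sq (hM i hi)).symm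
    _ ≤ 8 * ∑ i ∈ Finset.Icc 1 t, 2 ^ 227 * ∑ p ∈ Q, if p.1 = i then ENNReal.ofReal (2 ^ p.1 * cc f p.1 p.2 xi ^ 2) else 0 := by
        gcongr with i hi; exact FF_L2 hf xi Q i
    _ = 2 ^ 230 * ∑ p ∈ Q, ∑ i ∈ Finset.Icc 1 t, if p.1 = i then ENNReal.ofReal (2 ^ p.1 * cc f p.1 p.2 xi ^ 2) else 0 := by
        rw [← Finset.mul_sum, Finset.sum_comm, ← mul_assoc]; congr 1; norm_num
    _ ≤ 2 ^ 230 * ∑ p ∈ Q, ENNReal.ofReal (2 ^ p.1 * cc f p.1 p.2 xi ^ 2) := by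
        gcongr with p hp
        rw [Finset.sum_ite_eq]; split_ifs <;> simp
    _ = _ := by
        rw [ENNReal.ofReal_sum_of_nonneg (fun i _ => by positivity)]

end Carl

namespace Carl
open Complex (I)

/-- smoothing at scale `2^h` -/
noncomputable def cv (h : ℕ) (g : ℝ → ℂ) (x : ℝ) : ℂ := ∫ y, (rs h (x - y) : ℂ) * g y

lemma cv_int (h : ℕ) {g : ℝ → ℂ} (hg : Continuous g) {C : ℝ} (hC : ∀ y, ‖g y‖ ≤ C) (x : ℝ) :
    Integrable (fun y => (rs h (x - y) : ℂ) * g y) :=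
  int_mul_bdd (rs_int_sub h x).ofReal hg hC

lemma kd_lint_real (s : ℕ) {n : ℕ} (h : 2 ≤ n) (x : ℝ) : ∫ y, kd s n (x - y) ≤ 4 := by
  have h1 : Integrable (fun y => kd s n (x - y)) := (kd_integrable s h).comp_sub_left x
  have h2 : Integrable (fun y => kd s 2 (x - y)) := (kd_two_integrable s).comp_sub_left x
  calc _ ≤ ∫ y, kd s 2 (x - y) := integral_mono h1 h2 fun y => kd_le s h _
    _ ≤ 4 := by rw [integral_sub_left_eq_self (kd s 2) volume x]; exact kd_two_integral s

lemma cv_u {f : ℝ → ℂ} (hf : Integrable f) (xi : ℝ) {h s : ℕ} (hs : h ≤ s) (x : ℝ) {ε : ℝ}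
    (hc : cc f s (Dy x s) xi ≤ ε) : ‖uu f s xi x - cv h (uu f s xi) x‖ ≤ 2 ^ 108 * ε * (2 ^ h / 2 ^ s) := by
  have hε : 0 ≤ ε := (cc_nonneg _ _ _ _).trans hc
  have hc0 := cc_nonneg f s (Dy x s) xi
  have hi : Integrable (fun y => (rs h (x - y) : ℂ)) := (rs_int_sub h x).ofReal
  have h1 : ∫ y, (rs h (x - y) : ℂ) = 1 := by rw [integral_complex_ofReal, rs_integral_sub]; simp
  have e : uu f s xi x - cv h (uu f s xi) x = ∫ y, (rs h (x - y) : ℂ) * (uu f s xi x - uu f s xi y) := by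
    unfold cv
    simp_rw [mul_sub]
    rw [integral_sub (hi.mul_const _) (cv_int h (uu_BL hf s xi).continuous (uu_bound' hf s xi) x), integral_mul_const, h1, one_mul]
  rw [e]
  have hk : Integrable (fun y => kd h 9 (x - y)) := (kd_integrable h (by norm_num)).comp_sub_left x
  calc _ ≤ ∫ y, (2 ^ 106 * ε * (2 ^ h / 2 ^ s)) * kd h 9 (x - y) := by
        refine norm_integral_le_of_norm_le (hk.const_mul _) (Filter.Eventually.of_forall fun y => ?_)
        rw [norm_mul, Complex.norm_real, Real.norm_of_nonneg (rs_nonneg _ _)]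
        have a1 := rs_bound h (x - y)
        have a2 := uu_lip hf s (Dy x s) xi x y
        have a3 : wt s (x - lp s (Dy x s)) ≤ 2 := wt_In (mem_In_Dy x s) (lp_mem s _)
        have a4 := wt_anti hs (x - y)
        have a5 : |x - y| / 2 ^ s ≤ 2 ^ h / 2 ^ s * wt h (x - y) := by
          rw [div_mul_eq_mul_div]
          gcongr
          unfold wt; rw [mul_add, mul_div_cancel₀ _ (by positivity)]; nlinarith [pow_pos (two_pos : (0:ℝ) < 2) h]
        have b1 := wt_pos s (x - y)
        have b2 := wt_pos h (x - y)
        have b3 := wt_pos s (x - lp s (Dy x s))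
        have b4 := kd_nonneg h 16 (x - y)
        calc _ ≤ (2 ^ 62 * kd h 16 (x - y)) * (2 ^ 38 * (2 ^ h / 2 ^ s * wt h (x - y)) * wt h (x - y) ^ 6 * 2 ^ 6 * ε) := by
              gcongr
              refine a2.trans ?_
              gcongr
          _ = 2 ^ 106 * ε * (2 ^ h / 2 ^ s) * (kd h (7 + 9) (x - y) * wt h (x - y) ^ 7) := by ring
          _ = _ := by rw [kd_mul_pow]
    _ = (2 ^ 106 * ε * (2 ^ h / 2 ^ s)) * ∫ y, kd h 9 (x - y) := integral_const_mul _ _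
    _ ≤ (2 ^ 106 * ε * (2 ^ h / 2 ^ s)) * 4 := by gcongr; exact kd_lint_real h (by norm_num) x
    _ = _ := by ring

lemma cv_err {f : ℝ → ℂ} (hf : Integrable f) (xi : ℝ) (Q : Finset (ℕ × ℤ)) {h s : ℕ} (hs : h ≤ s) (x : ℝ) {ε : ℝ}
    (hc : cc f s (Dy x s) xi ≤ ε) : ‖cv h (fun y => (1 - eta Q s y) * uu f s xi y) x‖ₑ ≤
      2 ^ 170 * (ENNReal.ofReal ε * ∫⁻ z in (AA Q s)ᶜ, ENNReal.ofReal (kd s 4 (x - z))) := by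
  have hε : 0 ≤ ε := (cc_nonneg _ _ _ _).trans hc
  set E := ∫⁻ z in (AA Q s)ᶜ, ENNReal.ofReal (kd s 4 (x - z)) with hE
  have hkm : Measurable fun z => ENNReal.ofReal (kd s 4 (x - z)) :=
    ((kd_continuous s 4).comp (continuous_const.sub continuous_id)).measurable.ennreal_ofReal
  have hkm2 : Measurable fun z => ENNReal.ofReal (kd h 6 (x - z)) :=
    ((kd_continuous h 6).comp (continuous_const.sub continuous_id)).measurable.ennreal_ofReal
  have h1 : ∀ y, ‖1 - eta Q s y‖ₑ ≤ ENNReal.ofReal (2 ^ 62 * wt s (x - y) ^ 4) * E := by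
    intro y
    refine (one_sub_eta_enorm Q s y).trans ?_
    rw [hE, ← lintegral_const_mul _ hkm]
    refine lintegral_mono fun z => ?_
    have b1 := wt_pos s (x - y)
    rw [← ENNReal.ofReal_mul (by positivity)]
    refine ENNReal.ofReal_le_ofReal ((rs_bound s _).trans ?_)
    have h2 := wt_inv_shift s (y - z) (x - z)
    rw [show x - z - (y - z) = x - y by ring] at h2
    have h3 := wt_inv_nonneg s (y - z)
    calc _ ≤ 2 ^ 62 * kd s 4 (y - z) := by gcongr; exact kd_le s (by norm_num) _
      _ ≤ 2 ^ 62 * ((2 ^ s)⁻¹ * ((wt s (x - z))⁻¹ * wt s (x - y)) ^ 4) := by unfold kd; gcongr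
      _ = _ := by unfold kd; ring
  unfold cv
  refine (enorm_integral_le_lintegral_enorm _).trans ?_
  calc _ ≤ ∫⁻ y, (ENNReal.ofReal (kd h 6 (x - y))) * (2 ^ 168 * (ENNReal.ofReal ε * E)) := by
        refine lintegral_mono fun y => ?_
        rw [enorm_mul, enorm_mul, ← ofReal_norm, Complex.norm_real, Real.norm_of_nonneg (rs_nonneg _ _)]
        have b1 := wt_pos s (x - y)
        have b2 := wt_pos h (x - y)
        have b3 := kd_nonneg h 16 (x - y)
        have a4 := wt_anti hs (x - y)
        have h2 := uu_bound2 hf s xi y x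
        rw [wt_sub_comm s y x] at h2
        have h3 : ‖uu f s xi y‖ₑ ≤ ENNReal.ofReal (2 ^ 44 * wt s (x - y) ^ 6 * ε) := by
          rw [← ofReal_norm]; refine ENNReal.ofReal_le_ofReal (h2.trans ?_); gcongr
        calc _ ≤ ENNReal.ofReal (2 ^ 62 * kd h 16 (x - y)) * ((ENNReal.ofReal (2 ^ 62 * wt s (x - y) ^ 4) * E) *
              ENNReal.ofReal (2 ^ 44 * wt s (x - y) ^ 6 * ε)) := by
              gcongr
              · exact rs_bound h _
              · exact h1 y
          _ = ENNReal.ofReal ((2 ^ 62 * kd h 16 (x - y)) * ((2 ^ 62 * wt s (x - y) ^ 4) * (2 ^ 44 * wt s (x - y) ^ 6 * ε))) * E := by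
              rw [ENNReal.ofReal_mul (p := 2 ^ 62 * kd h 16 (x - y)) (by positivity), ENNReal.ofReal_mul (p := 2 ^ 62 * wt s (x - y) ^ 4) (by positivity)]; ring
          _ ≤ ENNReal.ofReal (kd h 6 (x - y) * (2 ^ 168 * ε)) * E := by
              refine mul_le_mul' (ENNReal.ofReal_le_ofReal ?_) le_rfl
              calc _ ≤ (2 ^ 62 * kd h 16 (x - y)) * ((2 ^ 62 * wt h (x - y) ^ 4) * (2 ^ 44 * wt h (x - y) ^ 6 * ε)) := by gcongr
                _ = (kd h (10 + 6) (x - y) * wt h (x - y) ^ 10) * (2 ^ 168 * ε) := by ring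
                _ = _ := by rw [kd_mul_pow]
          _ = _ := by
              rw [ENNReal.ofReal_mul (kd_nonneg _ _ _), ENNReal.ofReal_mul (by positivity), ENNReal.ofReal_pow (by norm_num)]
              simp; ring
    _ = (∫⁻ y, (ENNReal.ofReal (kd h 6 (x - y)))) * (2 ^ 168 * (ENNReal.ofReal ε * E)) := lintegral_mul_const _ hkm2
    _ ≤ 4 * (2 ^ 168 * (ENNReal.ofReal ε * E)) := by gcongr; exact kd_lintegral_sub h (by norm_num) x
    _ = _ := by rw [← mul_assoc]; congr 1; norm_num

lemma FF_bdd {f : ℝ → ℂ} (hf : Integrable f) (xi : ℝ) (Q : Finset (ℕ × ℤ)) (s : ℕ) (x : ℝ) :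
    ‖FF f xi Q s x‖ ≤ 2 ^ 38 * ∫ y, ‖f y‖ := by
  unfold FF
  rw [norm_mul]
  calc _ ≤ 1 * ‖uu f s xi x‖ := by gcongr; exact eta_le_one Q s x
    _ ≤ _ := by rw [one_mul]; exact uu_bound' hf s xi x

lemma cv_FF_zero {f : ℝ → ℂ} (hf : Integrable f) (xi : ℝ) {Q : Finset (ℕ × ℤ)} {t : ℕ} {k : ℤ} (hQ : UpIn Q t k) {h s : ℕ}
    (hs : s < h) (x : ℝ) : cv h (FF f xi Q s) x = 0 := by
  refine BL.integral_zero ((rs_sub_BL h x).mul (FF_BL hf xi hQ s)) (Or.inl ?_)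
    (cv_int h (FF_BL hf xi hQ s).continuous (FF_bdd hf xi Q s) x)
  have : (2:ℝ) / 2 ^ h < 2 / 2 ^ s := by
    gcongr; norm_num
  linarith

lemma cv_MM (h : ℕ) {g : ℝ → ℂ} (hg : Continuous g) (x : ℝ) : ‖cv h g x‖ₑ ≤ 2 ^ 65 * MM (fun y => ‖g y‖ₑ) x := by
  unfold cv
  refine (enorm_integral_le_lintegral_enorm _).trans ?_
  have hkm : Measurable fun z => ENNReal.ofReal (kd h 2 (x - z)) :=
    ((kd_continuous h 2).comp (continuous_const.sub continuous_id)).measurable.ennreal_ofReal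
  calc _ ≤ ∫⁻ y, 2 ^ 62 * (ENNReal.ofReal (kd h 2 (x - y)) * ‖g y‖ₑ) := by
        refine lintegral_mono fun y => ?_
        rw [enorm_mul, ← ofReal_norm, Complex.norm_real, Real.norm_of_nonneg (rs_nonneg _ _), ← mul_assoc,
          show (2:ℝ≥0∞) ^ 62 = ENNReal.ofReal (2 ^ 62) by rw [ENNReal.ofReal_pow (by norm_num)]; simp, ← ENNReal.ofReal_mul (by positivity)]
        gcongr
        exact (rs_bound h _).trans (by gcongr; exact kd_le h (by norm_num) _)
    _ = 2 ^ 62 * ∫⁻ y, (ENNReal.ofReal (kd h 2 (x - y)) * ‖g y‖ₑ) := lintegral_const_mul _ (hkm.mul hg.measurable.enorm)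
    _ ≤ 2 ^ 62 * (8 * MM (fun y => ‖g y‖ₑ) x) := by gcongr; exact kd_MM _ hg.measurable.enorm h x
    _ = _ := by ring

lemma geom_half (h : ℕ) (t : ℕ) : ∑ s ∈ Finset.Icc h t, (2:ℝ) ^ h / 2 ^ s ≤ 2 := by
  by_cases ht : h ≤ t
  · have : ∑ s ∈ Finset.Icc h t, (2:ℝ) ^ h / 2 ^ s = 2 - 2 ^ h / 2 ^ t := by
      induction t, ht using Nat.le_induction with
      | base => simp; norm_num
      | succ n hn ih =>
        rw [Finset.sum_Icc_succ_top (by omega), ih, pow_succ]; field_simp; ring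
    rw [this]; have : (0:ℝ) ≤ 2 ^ h / 2 ^ t := by positivity
    linarith
  · rw [Finset.Icc_eq_empty (by omega)]; simp

set_option maxHeartbeats 1000000 in
/-- the maximal estimate for a single frequency -/
theorem max_lemma {f : ℝ → ℂ} (hf : Integrable f) (xi : ℝ) {Q : Finset (ℕ × ℤ)} {t : ℕ} {k : ℤ} (hQ : UpIn Q t k) {ε : ℝ}
    (hε : 0 ≤ ε) (hc : ∀ p ∈ Q, cc f p.1 p.2 xi ≤ ε) (hE : ∑ p ∈ Q, 2 ^ p.1 * cc f p.1 p.2 xi ^ 2 ≤ ε ^ 2 * 2 ^ t) :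
    ∃ H : ℝ → ℝ≥0∞, Measurable H ∧ ∫⁻ x in In t k, H x ≤ 2 ^ 200 * ENNReal.ofReal ε * 2 ^ t ∧
      ∀ x ∈ In t k, ∀ σ ≤ t, (∀ s ∈ Finset.Ioc σ t, (s, Dy x s) ∈ Q) → ‖∑ s ∈ Finset.Ioc σ t, uu f s xi x‖ₑ ≤ H x := by
  set F : ℝ → ℂ := fun x => ∑ s ∈ Finset.Icc 1 t, FF f xi Q s x with hF
  have hFc : Continuous F := continuous_finsetSum _ fun s _ => (FF_BL hf xi hQ s).continuous
  have hMm : Measurable (MM (fun y => ‖F y‖ₑ)) := measurable_MM hFc.measurable.enorm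
  set E : ℕ → ℝ → ℝ≥0∞ := fun s x => ∫⁻ z in (AA Q s)ᶜ, ENNReal.ofReal (kd s 4 (x - z)) with hEdef
  have hEm : ∀ s, Measurable (E s) := by
    intro s
    refine Measurable.lintegral_prod_right' (f := fun p : ℝ × ℝ => ENNReal.ofReal (kd s 4 (p.1 - p.2))) ?_
    exact ((kd_continuous s 4).comp (continuous_fst.sub continuous_snd)).measurable.ennreal_ofReal
  have hsm : Measurable (fun x => ∑ s ∈ Finset.Icc 1 t, (AA Q s).indicator (E s) x) :=
    Finset.measurable_sum _ fun s _ => (hEm s).indicator (AA_meas Q s)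
  refine ⟨fun x => 2 ^ 109 * ENNReal.ofReal ε + 2 ^ 170 * ENNReal.ofReal ε * ∑ s ∈ Finset.Icc 1 t, (AA Q s).indicator (E s) x +
    2 ^ 65 * MM (fun y => ‖F y‖ₑ) x, ?_, ?_, ?_⟩
  · exact ((measurable_const.add (hsm.const_mul _))).add (hMm.const_mul _)
  · rw [lintegral_add_right _ (hMm.const_mul _), lintegral_add_right _ (hsm.const_mul _), lintegral_const_mul _ hsm,
      lintegral_const_mul _ hMm, setLIntegral_const, In_vol]
    have h1 : ∫⁻ x in In t k, ∑ s ∈ Finset.Icc 1 t, (AA Q s).indicator (E s) x ≤ 128 * 2 ^ t := by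
      rw [lintegral_finsetSum _ fun s _ => (hEm s).indicator (AA_meas Q s)]
      refine le_trans (Finset.sum_le_sum fun s _ => ?_) (boundary hQ)
      rw [← lintegral_indicator (AA_meas Q s)]
      exact setLIntegral_le_lintegral _ _
    have h2 : ∫⁻ x in In t k, MM (fun y => ‖F y‖ₑ) x ≤ 2 ^ 120 * ENNReal.ofReal ε * 2 ^ t := by
      have h3 := sq_setLIntegral_le (In t k) hMm
      have h4 := MM_L2 hFc.measurable.enorm (fun x => enorm_ne_top)
      have h5 : (∫⁻ x in In t k, MM (fun y => ‖F y‖ₑ) x) ^ 2 ≤ (2 ^ 120 * ENNReal.ofReal ε * 2 ^ t) ^ 2 := by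
        calc _ ≤ _ := h3
          _ ≤ 2 ^ t * (512 * (2 ^ 230 * ENNReal.ofReal (ε ^ 2 * 2 ^ t))) := by
              rw [In_vol]
              refine mul_le_mul' le_rfl (h4.trans (mul_le_mul' le_rfl ((FF_sum_L2 hf xi hQ).trans (mul_le_mul' le_rfl ?_))))
              exact ENNReal.ofReal_le_ofReal hE
          _ = (512 * 2 ^ 230) * (ENNReal.ofReal ε * 2 ^ t) ^ 2 := by
              rw [ENNReal.ofReal_mul (by positivity), ENNReal.ofReal_pow hε, ENNReal.ofReal_pow (by norm_num)]
              simp; ring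
          _ ≤ (2 ^ 240) * (ENNReal.ofReal ε * 2 ^ t) ^ 2 := by gcongr; norm_num
          _ = _ := by ring
      exact (ENNReal.pow_le_pow_left_iff two_ne_zero).1 h5
    calc _ ≤ 2 ^ 109 * ENNReal.ofReal ε * 2 ^ t + 2 ^ 170 * ENNReal.ofReal ε * (128 * 2 ^ t) + 2 ^ 65 * (2 ^ 120 * ENNReal.ofReal ε * 2 ^ t) := by
          gcongr
      _ = (2 ^ 109 + 2 ^ 170 * 128 + 2 ^ 65 * 2 ^ 120) * ENNReal.ofReal ε * 2 ^ t := by ring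
      _ ≤ _ := by gcongr; norm_num
  · intro x hx σ hσ hch
    have hzero : ∑ s ∈ Finset.Ioc σ t, cv (σ + 1) (FF f xi Q s) x = cv (σ + 1) F x := by
      have e1 : cv (σ + 1) F x = ∑ s ∈ Finset.Icc 1 t, cv (σ + 1) (FF f xi Q s) x := by
        unfold cv
        rw [← integral_finsetSum _ fun s _ => cv_int (σ + 1) (FF_BL hf xi hQ s).continuous (FF_bdd hf xi Q s) x]
        simp only [hF, Finset.mul_sum]
      rw [e1]
      refine Finset.sum_subset (fun s => ?_) fun s h1 h2 => ?_
      · simp only [Finset.mem_Ioc, Finset.mem_Icc]; omega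
      · refine cv_FF_zero hf xi hQ ?_ x
        simp only [Finset.mem_Ioc, Finset.mem_Icc] at h1 h2; omega
    have hdec : ∀ s, uu f s xi x = (uu f s xi x - cv (σ + 1) (uu f s xi) x) + cv (σ + 1) (fun y => (1 - eta Q s y) * uu f s xi y) x +
        cv (σ + 1) (FF f xi Q s) x := by
      intro s
      have e2 : cv (σ + 1) (uu f s xi) x = cv (σ + 1) (fun y => (1 - eta Q s y) * uu f s xi y) x + cv (σ + 1) (FF f xi Q s) x := by
        unfold cv
        have hi1 := cv_int (σ + 1) (uu_BL hf s xi).continuous (uu_bound' hf s xi) x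
        have hi2 := cv_int (σ + 1) (FF_BL hf xi hQ s).continuous (FF_bdd hf xi Q s) x
        rw [← integral_add _ hi2]
        · congr 1; ext y; unfold FF; ring
        · refine (hi1.sub hi2).congr (Filter.Eventually.of_forall fun y => ?_)
          simp only [Pi.sub_apply]; unfold FF; ring
      rw [e2]; ring
    have hsum : ∑ s ∈ Finset.Ioc σ t, uu f s xi x = ∑ s ∈ Finset.Ioc σ t, (uu f s xi x - cv (σ + 1) (uu f s xi) x) +
        ∑ s ∈ Finset.Ioc σ t, cv (σ + 1) (fun y => (1 - eta Q s y) * uu f s xi y) x + cv (σ + 1) F x := by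
      rw [← hzero, ← Finset.sum_add_distrib, ← Finset.sum_add_distrib]
      exact Finset.sum_congr rfl fun s _ => hdec s
    rw [hsum]
    refine (enorm_add_le _ _).trans (add_le_add ((enorm_add_le _ _).trans (add_le_add ?_ ?_)) (cv_MM _ hFc x))
    · have h1 : ‖∑ s ∈ Finset.Ioc σ t, (uu f s xi x - cv (σ + 1) (uu f s xi) x)‖ ≤ 2 ^ 109 * ε := by
        calc _ ≤ ∑ s ∈ Finset.Ioc σ t, 2 ^ 108 * ε * (2 ^ (σ + 1) / 2 ^ s) := by
              refine (norm_sum_le _ _).trans (Finset.sum_le_sum fun s hs => ?_)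
              have h4 := hc (s, Dy x s) (hch s hs)
              exact cv_u hf xi (by rw [Finset.mem_Ioc] at hs; omega) x h4
          _ = 2 ^ 108 * ε * ∑ s ∈ Finset.Icc (σ + 1) t, (2 ^ (σ + 1) / 2 ^ s) := by
              rw [Finset.mul_sum]; exact Finset.sum_congr (by ext; simp) fun _ _ => rfl
          _ ≤ 2 ^ 108 * ε * 2 := by gcongr; exact geom_half _ _
          _ = _ := by ring
      rw [← ofReal_norm]
      refine (ENNReal.ofReal_le_ofReal h1).trans (le_of_eq ?_)
      rw [ENNReal.ofReal_mul (by positivity), ENNReal.ofReal_pow (by norm_num)]; simp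
    · refine (enorm_sum_le _ _).trans ?_
      have h3 : ∀ s ∈ Finset.Ioc σ t, ‖cv (σ + 1) (fun y => (1 - eta Q s y) * uu f s xi y) x‖ₑ ≤
          2 ^ 170 * ENNReal.ofReal ε * (AA Q s).indicator (E s) x := by
        intro s hs
        have h4 := hc (s, Dy x s) (hch s hs)
        have h5 := cv_err hf xi Q (h := σ + 1) (by rw [Finset.mem_Ioc] at hs; omega) x h4
        rw [Set.indicator_of_mem (show x ∈ AA Q s from hch s hs), mul_assoc]
        exact h5
      refine (Finset.sum_le_sum h3).trans ?_
      rw [Finset.mul_sum]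
      refine Finset.sum_le_sum_of_subset fun s => ?_
      simp only [Finset.mem_Ioc, Finset.mem_Icc]; omega

end Carl

namespace Carl
open Complex (I)

/-- dyadic inclusion -/
def Sub (p q : ℕ × ℤ) : Prop := p.1 ≤ q.1 ∧ In p.1 p.2 ⊆ In q.1 q.2

lemma Sub.refl (p : ℕ × ℤ) : Sub p p := ⟨le_rfl, subset_rfl⟩
lemma Sub.trans {p q r : ℕ × ℤ} (h : Sub p q) (h' : Sub q r) : Sub p r := ⟨h.1.trans h'.1, h.2.trans h'.2⟩
lemma Sub_of {x : ℝ} {s t : ℕ} {j k : ℤ} (hx : x ∈ In s j) (hx' : x ∈ In t k) (h : s ≤ t) : Sub (s, j) (t, k) :=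
  ⟨h, In_subset h hx hx'⟩
lemma Sub_Dy (x : ℝ) {s t : ℕ} (h : s ≤ t) : Sub (s, Dy x s) (t, Dy x t) := Sub_of (mem_In_Dy x s) (mem_In_Dy x t) h
lemma Sub.dy {x : ℝ} {s : ℕ} {q : ℕ × ℤ} (h : Sub (s, Dy x s) q) : Dy x q.1 = q.2 := h.2 (mem_In_Dy x s)

abbrev Tile := (ℕ × ℤ) × ℝ

/-- the data of the discrete problem -/
structure Dat where
  f : ℝ → ℂ
  hf : Integrable f
  hf2 : MemLp f 2
  G : Set ℝ
  hG : MeasurableSet G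
  hGfin : volume G ≠ ⊤
  N : ℝ → ℝ
  hN : Measurable N
  Fr : Finset ℝ
  hNF : ∀ x, N x ∈ Fr
  s0 : ℝ → ℕ
  hs0 : Measurable s0
  S : ℕ
  R : ℕ
  hR : ∀ x ∈ G, |x| ≤ R

noncomputable def Dat.V (d : Dat) : Finset (ℕ × ℤ) := Finset.Ico 1 d.S ×ˢ Finset.Icc (-((d.R:ℤ) + 1)) (d.R + 1)
noncomputable def Dat.U (d : Dat) : Finset Tile := d.V ×ˢ d.Fr

lemma Dat.mem_V (d : Dat) (s : ℕ) (j : ℤ) : (s, j) ∈ d.V ↔ (1 ≤ s ∧ s < d.S) ∧ (-((d.R:ℤ) + 1)) ≤ j ∧ j ≤ d.R + 1 := by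
  unfold Dat.V; simp

lemma Dat.mem_U (d : Dat) (I : ℕ × ℤ) (n : ℝ) : (I, n) ∈ d.U ↔ I ∈ d.V ∧ n ∈ d.Fr := by
  unfold Dat.U; simp

lemma Dat.V_up (d : Dat) {x : ℝ} {s s' : ℕ} (h : (s, Dy x s) ∈ d.V) (hs : s ≤ s') (hS : s' < d.S) : (s', Dy x s') ∈ d.V := by
  induction s', hs using Nat.le_induction with
  | base => exact h
  | succ n hn ih =>
    have := ih (by omega)
    rw [Dat.mem_V] at this ⊢
    rw [Dy_succ]
    obtain ⟨h1, h2, h3⟩ := this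
    refine ⟨⟨by omega, hS⟩, ?_, ?_⟩ <;> omega

lemma Dat.V_sub (d : Dat) {p q : ℕ × ℤ} (h : p ∈ d.V) (hs : Sub p q) (hS : q.1 < d.S) : q ∈ d.V := by
  obtain ⟨s, j⟩ := p
  have e := Dy_lp s j
  have := d.V_up (x := lp s j) (s := s) (by rw [e]; exact h) hs.1 hS
  have h2 : Dy (lp s j) q.1 = q.2 := hs.2 (lp_mem s j)
  rwa [h2] at this

/-- tile of a point -/
noncomputable def Dat.tl (d : Dat) (x : ℝ) (s : ℕ) : Tile := ((s, Dy x s), d.N x)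

def inD (w : ℝ) (J : ℕ × ℤ) (xi : ℝ) (p : Tile) : Prop := Sub p.1 J ∧ |p.2 - xi| * 2 ^ p.1.1 ≤ w

open Classical in
noncomputable def DD (w : ℝ) (J : ℕ × ℤ) (xi : ℝ) (P : Finset Tile) : Finset Tile := P.filter (inD w J xi)

open Classical in
noncomputable def Dat.Sx (d : Dat) (P : Finset Tile) (x : ℝ) : Finset ℕ :=
  (Finset.Ico 1 d.S).filter (fun s => d.tl x s ∈ P ∧ d.s0 x ≤ s)

noncomputable def Dat.Lsum (d : Dat) (P : Finset Tile) (x : ℝ) : ℂ := ∑ s ∈ d.Sx P x, uu d.f s (d.N x) x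

/-- upward closedness -/
def Dat.UP (d : Dat) (P : Finset Tile) : Prop :=
  ∀ I n I' xi, (I, n) ∈ P → Sub I I' → I.1 < I'.1 → |n - xi| * 2 ^ I.1 ≤ 1 → (I', xi) ∈ d.U → (I', xi) ∈ P

open Classical in
noncomputable def Dat.es (d : Dat) (P : Finset Tile) (J : ℕ × ℤ) (xi : ℝ) : ℝ :=
  ∑ I ∈ d.V.filter (fun I => Sub I J ∧ (I, xi) ∈ P), 2 ^ I.1 * cc d.f I.1 I.2 xi ^ 2

def Dat.En (d : Dat) (P : Finset Tile) (ε : ℝ) : Prop := ∀ J xi, (J, xi) ∈ d.U → d.es P J xi ≤ ε ^ 2 * 2 ^ J.1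

def Dat.Ew (d : Dat) (w : ℝ) (J : ℕ × ℤ) (xi : ℝ) : Set ℝ := {x | x ∈ d.G ∧ x ∈ In J.1 J.2 ∧ |d.N x - xi| * 2 ^ J.1 ≤ w}

def Dat.Dens (d : Dat) (P : Finset Tile) (w μ : ℝ) : Prop :=
  ∀ p ∈ P, ∀ J xi, Sub p.1 J → (J, xi) ∈ d.U → |xi - p.2| * 2 ^ p.1.1 ≤ w → volume (d.Ew w J xi) ≤ ENNReal.ofReal (μ * 2 ^ J.1)

lemma Dat.UP_U (d : Dat) : d.UP d.U := fun _ _ _ _ _ _ _ _ h => h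

lemma Dat.UP_sdiff (d : Dat) {P : Finset Tile} (h : d.UP P) {w : ℝ} (hw : 2 ≤ w) (J : ℕ × ℤ) (eta : ℝ) :
    d.UP (P \ DD w J eta P) := by
  classical
  intro I n I' xi h1 h2 h3 h4 h5
  rw [Finset.mem_sdiff] at h1 ⊢
  refine ⟨h I n I' xi h1.1 h2 h3 h4 h5, fun h6 => h1.2 ?_⟩
  unfold DD at h6 ⊢
  rw [Finset.mem_filter] at h6 ⊢
  refine ⟨h1.1, h2.trans h6.2.1, ?_⟩
  have h7 : |xi - eta| * 2 ^ I'.1 ≤ w := h6.2.2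
  show |n - eta| * 2 ^ I.1 ≤ w
  have h8 : (2:ℝ) ^ (I.1 + 1) ≤ 2 ^ I'.1 := pow_le_pow_right₀ (by norm_num) h3
  have h9 : |n - eta| ≤ |n - xi| + |xi - eta| := abs_sub_le _ _ _
  have h10 : |xi - eta| * 2 ^ (I.1 + 1) ≤ w := (mul_le_mul_of_nonneg_left h8 (abs_nonneg _)).trans h7
  rw [pow_succ] at h10
  have : |n - eta| * 2 ^ I.1 ≤ (|n - xi| + |xi - eta|) * 2 ^ I.1 := by gcongr
  linarith

lemma Dat.es_nonneg (d : Dat) (P : Finset Tile) (J : ℕ × ℤ) (xi : ℝ) : 0 ≤ d.es P J xi :=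
  Finset.sum_nonneg fun _ _ => by positivity

lemma Dat.es_mono (d : Dat) {P P' : Finset Tile} (h : P' ⊆ P) (J : ℕ × ℤ) (xi : ℝ) : d.es P' J xi ≤ d.es P J xi := by
  classical
  unfold Dat.es
  refine Finset.sum_le_sum_of_subset_of_nonneg (fun I hI => ?_) fun _ _ _ => by positivity
  rw [Finset.mem_filter] at hI ⊢
  exact ⟨hI.1, hI.2.1, h hI.2.2⟩

lemma Dat.En.mono {d : Dat} {P P' : Finset Tile} {ε : ℝ} (h : d.En P ε) (hP : P' ⊆ P) : d.En P' ε :=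
  fun J xi hJ => (d.es_mono hP J xi).trans (h J xi hJ)

lemma Dat.Dens.mono {d : Dat} {P P' : Finset Tile} {w μ : ℝ} (h : d.Dens P w μ) (hP : P' ⊆ P) : d.Dens P' w μ :=
  fun p hp => h p (hP hp)

lemma Dat.En.cc_le {d : Dat} {P : Finset Tile} {ε : ℝ} (hε : 0 ≤ ε) (h : d.En P ε) (hP : P ⊆ d.U) {I : ℕ × ℤ} {n : ℝ}
    (hp : (I, n) ∈ P) : cc d.f I.1 I.2 n ≤ ε := by
  classical
  have h1 := h I n (hP hp)
  have hV := ((d.mem_U I n).1 (hP hp)).1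
  have h2 : 2 ^ I.1 * cc d.f I.1 I.2 n ^ 2 ≤ d.es P I n := by
    unfold Dat.es
    refine Finset.single_le_sum (f := fun I : ℕ × ℤ => 2 ^ I.1 * cc d.f I.1 I.2 n ^ 2) (fun _ _ => by positivity) ?_
    rw [Finset.mem_filter]; exact ⟨hV, Sub.refl I, hp⟩
  have h3 : cc d.f I.1 I.2 n ^ 2 ≤ ε ^ 2 := by
    have : (0:ℝ) < 2 ^ I.1 := by positivity
    nlinarith
  exact (pow_le_pow_iff_left₀ (cc_nonneg _ _ _ _) hε two_ne_zero).1 h3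

lemma lb1 {f : ℝ → ℂ} (hf : Integrable f) (s : ℕ) (n x : ℝ) : ‖uu f s n x‖ ≤ 2 ^ 44 * cc f s (Dy x s) n := by
  have := uu_bound2 hf s n x x
  simpa [wt] using this

lemma wt_Dy_lp (s : ℕ) (x : ℝ) : wt s (x - lp s (Dy x s)) ^ 6 ≤ 2 ^ 6 := by
  have h := wt_In (mem_In_Dy x s) (lp_mem s (Dy x s))
  have := wt_pos s (x - lp s (Dy x s))
  gcongr

lemma lb2 {f : ℝ → ℂ} (hf : Integrable f) (s : ℕ) (n x x' : ℝ) (h : Dy x s = Dy x' s) :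
    ‖uu f s n x - uu f s n x'‖ ≤ 2 ^ 50 * (|x - x'| / 2 ^ s) * cc f s (Dy x s) n := by
  refine (uu_lip hf s (Dy x s) n x x').trans ?_
  have h1 := wt_Dy_lp s x
  have h2 : wt s (x - x') ^ 6 ≤ 2 ^ 6 := by
    have h := wt_In (mem_In_Dy x s) (show x' ∈ In s (Dy x s) from h.symm)
    have := wt_pos s (x - x')
    gcongr
  have h3 := cc_nonneg f s (Dy x s) n
  have h4 := wt_pos s (x - x')
  have h5 := wt_pos s (x - lp s (Dy x s))
  calc _ ≤ 2 ^ 38 * (|x - x'| / 2 ^ s) * 2 ^ 6 * 2 ^ 6 * cc f s (Dy x s) n := by gcongr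
    _ = _ := by ring

lemma lb3 {f : ℝ → ℂ} (hf : Integrable f) (s : ℕ) (n xi x : ℝ) (h : |n - xi| * 2 ^ s ≤ 1) :
    ‖uu f s n x - Complex.exp (I * (n - xi : ℝ) * x) * uu f s xi x‖ ≤ 2 ^ 44 * (|n - xi| * 2 ^ s) * cc f s (Dy x s) xi := by
  refine (uu_mod hf s (Dy x s) n xi x h).trans ?_
  have h1 := wt_Dy_lp s x
  have h3 := cc_nonneg f s (Dy x s) xi
  have h5 := wt_pos s (x - lp s (Dy x s))
  calc _ ≤ 2 ^ 38 * (|n - xi| * 2 ^ s) * 2 ^ 6 * cc f s (Dy x s) xi := by gcongr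
    _ = _ := by ring

lemma geom_up (σ τ : ℕ) : ∑ s ∈ Finset.Ioc σ τ, (2:ℝ) ^ s ≤ 2 * 2 ^ τ := by
  by_cases h : σ ≤ τ
  · have : ∑ s ∈ Finset.Ioc σ τ, (2:ℝ) ^ s = 2 * 2 ^ τ - 2 * 2 ^ σ := by
      induction τ, h using Nat.le_induction with
      | base => simp
      | succ n hn ih => rw [Finset.sum_Ioc_succ_top (by omega), ih, pow_succ]; ring
    rw [this]; have : (0:ℝ) ≤ 2 * 2 ^ σ := by positivity
    linarith
  · rw [Finset.Ioc_eq_empty (by omega)]; simp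

lemma chain_move {f : ℝ → ℂ} (hf : Integrable f) (xi x x' : ℝ) {r σ t : ℕ} (hr : r ≤ σ) (hx : Dy x r = Dy x' r) {ε : ℝ}
    (hε : 0 ≤ ε) (hc : ∀ s ∈ Finset.Ioc σ t, cc f s (Dy x s) xi ≤ ε) :
    ‖∑ s ∈ Finset.Ioc σ t, uu f s xi x‖ ≤ ‖∑ s ∈ Finset.Ioc σ t, uu f s xi x'‖ + 2 ^ 51 * ε := by
  have h1 : ‖∑ s ∈ Finset.Ioc σ t, uu f s xi x - ∑ s ∈ Finset.Ioc σ t, uu f s xi x'‖ ≤ 2 ^ 51 * ε := by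
    rw [← Finset.sum_sub_distrib]
    have hd : |x - x'| ≤ 2 ^ r := In_dist (mem_In_Dy x r) (show x' ∈ In r (Dy x r) from hx.symm)
    calc _ ≤ ∑ s ∈ Finset.Ioc σ t, 2 ^ 50 * ε * (2 ^ r / 2 ^ s) := by
          refine (norm_sum_le _ _).trans (Finset.sum_le_sum fun s hs => ?_)
          have hs' : r ≤ s := by rw [Finset.mem_Ioc] at hs; omega
          refine (lb2 hf s xi x x' (Dy_mono hx hs')).trans ?_
          have := hc s hs
          have h0 := cc_nonneg f s (Dy x s) xi
          calc _ ≤ 2 ^ 50 * (2 ^ r / 2 ^ s) * ε := by gcongr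
            _ = _ := by ring
      _ ≤ ∑ s ∈ Finset.Icc r t, 2 ^ 50 * ε * (2 ^ r / 2 ^ s) := by
          refine Finset.sum_le_sum_of_subset_of_nonneg (fun s => ?_) fun _ _ _ => by positivity
          simp only [Finset.mem_Ioc, Finset.mem_Icc]; omega
      _ = 2 ^ 50 * ε * ∑ s ∈ Finset.Icc r t, (2 ^ r / 2 ^ s) := by rw [Finset.mul_sum]
      _ ≤ 2 ^ 50 * ε * 2 := by gcongr; exact geom_half _ _
      _ = _ := by ring
  have := norm_sub_norm_le (∑ s ∈ Finset.Ioc σ t, uu f s xi x) (∑ s ∈ Finset.Ioc σ t, uu f s xi x')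
  linarith

lemma chain_pt {f : ℝ → ℂ} (hf : Integrable f) (n xi x x' : ℝ) {r σ τ t : ℕ} (hr : r ≤ σ) (hστ : σ ≤ τ) (hτ : τ ≤ t)
    (hx : Dy x r = Dy x' r) {ε : ℝ} (hε : 0 ≤ ε) (hc0 : cc f σ (Dy x σ) n ≤ ε)
    (hc : ∀ s ∈ Finset.Ioc σ t, cc f s (Dy x s) xi ≤ ε) (hn : |n - xi| * 2 ^ τ ≤ 1) :
    ‖∑ s ∈ Finset.Icc σ τ, uu f s n x‖ ≤ 2 ^ 53 * ε + (‖∑ s ∈ Finset.Ioc σ t, uu f s xi x'‖ + ‖∑ s ∈ Finset.Ioc τ t, uu f s xi x'‖) := by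
  have e0 : ∑ s ∈ Finset.Icc σ τ, uu f s n x = uu f σ n x + ∑ s ∈ Finset.Ioc σ τ, uu f s n x := by
    rw [← Finset.Ioc_insert_left hστ, Finset.sum_insert (by simp)]
  set e := Complex.exp (I * (n - xi : ℝ) * x) with he
  have hen : ‖e‖ = 1 := norm_expI _ _
  have e1 : ∑ s ∈ Finset.Ioc σ τ, uu f s xi x = ∑ s ∈ Finset.Ioc σ t, uu f s xi x - ∑ s ∈ Finset.Ioc τ t, uu f s xi x := by
    rw [eq_sub_iff_add_eq, Finset.sum_Ioc_consecutive _ hστ hτ]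
  have e2 : ∑ s ∈ Finset.Icc σ τ, uu f s n x = uu f σ n x + ∑ s ∈ Finset.Ioc σ τ, (uu f s n x - e * uu f s xi x) +
      e * (∑ s ∈ Finset.Ioc σ t, uu f s xi x - ∑ s ∈ Finset.Ioc τ t, uu f s xi x) := by
    rw [e0, Finset.sum_sub_distrib, ← Finset.mul_sum, e1]; ring
  have b1 : ‖uu f σ n x‖ ≤ 2 ^ 44 * ε := (lb1 hf σ n x).trans (by gcongr)
  have b2 : ‖∑ s ∈ Finset.Ioc σ τ, (uu f s n x - e * uu f s xi x)‖ ≤ 2 ^ 45 * ε := by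
    calc _ ≤ ∑ s ∈ Finset.Ioc σ τ, 2 ^ 44 * |n - xi| * ε * 2 ^ s := by
          refine (norm_sum_le _ _).trans (Finset.sum_le_sum fun s hs => ?_)
          have hs2 := Finset.mem_Ioc.1 hs
          have h1 : |n - xi| * 2 ^ s ≤ 1 := le_trans (by gcongr; · norm_num
                                                         · exact hs2.2) hn
          refine (lb3 hf s n xi x h1).trans ?_
          have := hc s (Finset.mem_Ioc.2 ⟨hs2.1, hs2.2.trans hτ⟩)
          calc _ ≤ 2 ^ 44 * (|n - xi| * 2 ^ s) * ε := by gcongr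
            _ = _ := by ring
      _ = 2 ^ 44 * |n - xi| * ε * ∑ s ∈ Finset.Ioc σ τ, 2 ^ s := by rw [Finset.mul_sum]
      _ ≤ 2 ^ 44 * |n - xi| * ε * (2 * 2 ^ τ) := by gcongr; exact geom_up σ τ
      _ = 2 ^ 45 * ε * (|n - xi| * 2 ^ τ) := by ring
      _ ≤ 2 ^ 45 * ε * 1 := by gcongr
      _ = _ := by ring
  have b3 := chain_move hf xi x x' hr hx hε hc
  have b4 := chain_move hf xi x x' (hr.trans hστ) hx hε (t := t) (fun s hs => hc s (by
    rw [Finset.mem_Ioc] at hs ⊢; omega))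
  rw [e2]
  refine (norm_add_le _ _).trans ?_
  rw [norm_mul, hen, one_mul]
  have b5 := norm_add_le (uu f σ n x) (∑ s ∈ Finset.Ioc σ τ, (uu f s n x - e * uu f s xi x))
  have b6 := norm_sub_le (∑ s ∈ Finset.Ioc σ t, uu f s xi x) (∑ s ∈ Finset.Ioc τ t, uu f s xi x)
  have : (2:ℝ) ^ 44 * ε + 2 ^ 45 * ε + (2 ^ 51 * ε + 2 ^ 51 * ε) ≤ 2 ^ 53 * ε := by nlinarith
  linarith

lemma card_A (A : Finset ℕ) (δ : ℝ) (i : ℕ) (h : ∀ s ∈ A, 1 < δ * 2 ^ s ∧ δ * 2 ^ s ≤ 2 ^ i) : A.card ≤ i := by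
  rcases A.eq_empty_or_nonempty with rfl | hne
  · simp
  · set a := A.min' hne
    have ha := h a (A.min'_mem hne)
    have hsub : A ⊆ Finset.Ico a (a + i) := by
      intro s hs
      rw [Finset.mem_Ico]
      have h1 := A.min'_le s hs
      refine ⟨h1, ?_⟩
      by_contra hcon
      push Not at hcon
      have h2 : (2:ℝ) ^ (a + i) ≤ 2 ^ s := pow_le_pow_right₀ (by norm_num) hcon
      rw [pow_add] at h2
      have h3 : 0 < δ := by
        by_contra h4
        push Not at h4
        have : δ * 2 ^ a ≤ 0 := mul_nonpos_of_nonpos_of_nonneg h4 (by positivity)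
        linarith [ha.1]
      have h4 := (h s hs).2
      have h5 : (0:ℝ) < 2 ^ i := by positivity
      have h6 : δ * (2 ^ a * 2 ^ i) ≤ δ * 2 ^ s := by gcongr
      nlinarith [ha.1]
    exact (Finset.card_le_card hsub).trans (by simp)

end Carl

namespace Carl
open Complex (I)

lemma mem_Sx (d : Dat) (P : Finset Tile) (x : ℝ) (s : ℕ) :
    s ∈ d.Sx P x ↔ (1 ≤ s ∧ s < d.S) ∧ d.tl x s ∈ P ∧ d.s0 x ≤ s := by
  unfold Dat.Sx; simp

lemma mem_DD (w : ℝ) (J : ℕ × ℤ) (xi : ℝ) (P : Finset Tile) (p : Tile) : p ∈ DD w J xi P ↔ p ∈ P ∧ inD w J xi p := by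
  unfold DD; simp

lemma measurableSet_tl (d : Dat) (P : Finset Tile) (s : ℕ) : MeasurableSet {x | d.tl x s ∈ P ∧ d.s0 x ≤ s} := by
  have h1 : Measurable (fun x => d.tl x s) := by
    unfold Dat.tl
    exact (measurable_const.prodMk (Dy_measurable s)).prodMk d.hN
  exact (h1 P.measurableSet).inter (d.hs0 (measurableSet_Iic (a := s)))

lemma measurable_uuN (d : Dat) (s : ℕ) : Measurable (fun x => uu d.f s (d.N x) x) := by
  classical
  have : (fun x => uu d.f s (d.N x) x) = fun x => ∑ n ∈ d.Fr, (d.N ⁻¹' {n}).indicator (fun x => uu d.f s n x) x := by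
    ext x
    rw [Finset.sum_eq_single_of_mem (d.N x) (d.hNF x)]
    · rw [Set.indicator_of_mem (by simp)]
    · intro n _ hn
      rw [Set.indicator_of_notMem (by simpa using hn.symm)]
  rw [this]
  exact Finset.measurable_sum _ fun n _ => (uu_BL d.hf s n).continuous.measurable.indicator (d.hN (measurableSet_singleton n))

lemma Lsum_eq (d : Dat) (P : Finset Tile) (x : ℝ) :
    d.Lsum P x = ∑ s ∈ Finset.Ico 1 d.S, {x | d.tl x s ∈ P ∧ d.s0 x ≤ s}.indicator (fun x => uu d.f s (d.N x) x) x := by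
  classical
  unfold Dat.Lsum Dat.Sx
  rw [Finset.sum_filter]
  refine Finset.sum_congr rfl fun s _ => ?_
  rw [Set.indicator_apply]
  rfl

lemma measurable_Lsum (d : Dat) (P : Finset Tile) : Measurable (d.Lsum P) := by
  have : d.Lsum P = fun x => ∑ s ∈ Finset.Ico 1 d.S, {x | d.tl x s ∈ P ∧ d.s0 x ≤ s}.indicator (fun x => uu d.f s (d.N x) x) x := by
    ext x; exact Lsum_eq d P x
  rw [this]
  exact Finset.measurable_sum _ fun s _ => (measurable_uuN d s).indicator (measurableSet_tl d P s)

lemma tree_pt (d : Dat) {P : Finset Tile} (hP : P ⊆ d.U) (hUP : d.UP P) {ε : ℝ} (hε : 0 ≤ ε) (hEn : d.En P ε) (i : ℕ)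
    {t : ℕ} {k : ℤ} {xi : ℝ} (hJ : ((t, k), xi) ∈ d.U) {x x' : ℝ} {r : ℕ} (hx : Dy x r = Dy x' r)
    (hr : ∀ s ∈ d.Sx (DD (2 ^ i) (t, k) xi P) x, r ≤ s) {H : ℝ → ℝ≥0∞}
    (hH : ∀ y ∈ In t k, ∀ σ ≤ t, (∀ s ∈ Finset.Ioc σ t, ((s, Dy y s), xi) ∈ P) → ‖∑ s ∈ Finset.Ioc σ t, uu d.f s xi y‖ₑ ≤ H y) :
    ‖d.Lsum (DD (2 ^ i) (t, k) xi P) x‖ₑ ≤ ENNReal.ofReal (2 ^ 54 * (1 + i) * ε) + 2 * H x' := by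
  classical
  set T := DD (2 ^ i) (t, k) xi P with hT
  have hf := d.hf
  have htS : t < d.S := ((d.mem_V t k).1 ((d.mem_U _ _).1 hJ).1).1.2
  have hT2 : ∀ s ∈ d.Sx T x, ((s, Dy x s), d.N x) ∈ P ∧ s ≤ t ∧ x ∈ In t k ∧ |d.N x - xi| * 2 ^ s ≤ 2 ^ i := by
    intro s hs
    rw [mem_Sx, hT, mem_DD] at hs
    obtain ⟨_, ⟨h1, h2, h3⟩, _⟩ := hs
    exact ⟨h1, h2.1, h2.2 (mem_In_Dy x s), h3⟩
  set A := (d.Sx T x).filter (fun s => ¬ |d.N x - xi| * 2 ^ s ≤ 1) with hA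
  set B := (d.Sx T x).filter (fun s => |d.N x - xi| * 2 ^ s ≤ 1) with hB
  have hsplit : d.Lsum T x = ∑ s ∈ B, uu d.f s (d.N x) x + ∑ s ∈ A, uu d.f s (d.N x) x := by
    unfold Dat.Lsum; rw [Finset.sum_filter_add_sum_filter_not]
  have hAc : A.card ≤ i := by
    refine card_A A |d.N x - xi| i fun s hs => ?_
    rw [hA, Finset.mem_filter] at hs
    exact ⟨not_le.1 hs.2, (hT2 s hs.1).2.2.2⟩
  have hAb : ‖∑ s ∈ A, uu d.f s (d.N x) x‖ ≤ 2 ^ 44 * i * ε := by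
    calc _ ≤ ∑ s ∈ A, 2 ^ 44 * ε := by
          refine (norm_sum_le _ _).trans (Finset.sum_le_sum fun s hs => (lb1 hf s _ x).trans ?_)
          rw [hA, Finset.mem_filter] at hs
          have := hEn.cc_le hε hP (hT2 s hs.1).1
          gcongr
      _ = A.card * (2 ^ 44 * ε) := by simp
      _ ≤ i * (2 ^ 44 * ε) := by gcongr
      _ = _ := by ring
  have hBb : ‖∑ s ∈ B, uu d.f s (d.N x) x‖ₑ ≤ ENNReal.ofReal (2 ^ 53 * ε) + 2 * H x' := by
    rcases B.eq_empty_or_nonempty with hBe | hne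
    · rw [hBe]; simp
    · obtain ⟨σ, hσ, hσm⟩ : ∃ σ ∈ B, ∀ s ∈ B, σ ≤ s := ⟨B.min' hne, B.min'_mem hne, fun s hs => B.min'_le s hs⟩
      obtain ⟨τ, hτ, hτm⟩ : ∃ τ ∈ B, ∀ s ∈ B, s ≤ τ := ⟨B.max' hne, B.max'_mem hne, fun s hs => B.le_max' s hs⟩
      have hστ : σ ≤ τ := hσm _ hτ
      rw [hB, Finset.mem_filter] at hσ hτ
      obtain ⟨hσP, hσt, hxJ, _⟩ := hT2 σ hσ.1
      obtain ⟨hτP, hτt, _, _⟩ := hT2 τ hτ.1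
      have hσ1 := (mem_Sx d T x σ).1 hσ.1
      have hτ1 := (mem_Sx d T x τ).1 hτ.1
      have hBI : B = Finset.Icc σ τ := by
        ext s
        refine ⟨fun h => Finset.mem_Icc.2 ⟨hσm _ h, hτm _ h⟩, fun h => ?_⟩
        rw [Finset.mem_Icc] at h
        have h1 : |d.N x - xi| * 2 ^ s ≤ 1 := le_trans (by gcongr; · norm_num
                                                           · exact h.2) hτ.2
        have h2 : ((s, Dy x s), d.N x) ∈ P := by
          rcases h.1.eq_or_lt with h3 | h3
          · rw [← h3]; exact hσP
          · refine hUP _ _ _ _ hσP (Sub_Dy x h.1) h3 (by simp) ?_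
            have h4 := (d.mem_U _ _).1 (hP hσP)
            exact (d.mem_U _ _).2 ⟨d.V_up h4.1 h.1 (by omega), h4.2⟩
        rw [hB, Finset.mem_filter, mem_Sx, hT, mem_DD]
        refine ⟨⟨⟨by omega, by omega⟩, ⟨h2, Sub_of (mem_In_Dy x s) hxJ (by omega), ?_⟩, by omega⟩, h1⟩
        exact h1.trans (one_le_pow₀ (by norm_num))
      have hch : ∀ s ∈ Finset.Ioc σ t, ((s, Dy x s), xi) ∈ P := by
        intro s hs
        rw [Finset.mem_Ioc] at hs
        refine hUP _ _ _ _ hσP (Sub_Dy x hs.1.le) hs.1 hσ.2 ?_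
        have h4 := (d.mem_U _ _).1 (hP hσP)
        exact (d.mem_U _ _).2 ⟨d.V_up h4.1 hs.1.le (by omega), ((d.mem_U _ _).1 hJ).2⟩
      have hrσ : r ≤ σ := hr σ hσ.1
      have hx' : ∀ s, r ≤ s → Dy x' s = Dy x s := fun s hs => (Dy_mono hx hs).symm
      have hx'J : x' ∈ In t k := (hx' t (by omega)).trans hxJ
      have b1 := hH x' hx'J σ hσt (fun s hs => by
        rw [hx' s (by rw [Finset.mem_Ioc] at hs; omega)]; exact hch s hs)
      have b2 := hH x' hx'J τ hτt (fun s hs => by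
        rw [hx' s (by rw [Finset.mem_Ioc] at hs; omega)]
        exact hch s (by rw [Finset.mem_Ioc] at hs ⊢; omega))
      have c1 := hEn.cc_le hε hP hσP
      have c2 : ∀ s ∈ Finset.Ioc σ t, cc d.f s (Dy x s) xi ≤ ε := fun s hs => by
        have := hEn.cc_le hε hP (hch s hs)
        exact this
      have b3 := chain_pt hf (d.N x) xi x x' hrσ hστ hτt hx hε c1 c2 hτ.2
      rw [hBI, ← ofReal_norm]
      refine (ENNReal.ofReal_le_ofReal b3).trans ?_
      rw [ENNReal.ofReal_add (by positivity) (by positivity), ENNReal.ofReal_add (by positivity) (by positivity),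
        ofReal_norm, ofReal_norm, two_mul]
      gcongr
  rw [hsplit]
  refine (enorm_add_le _ _).trans ?_
  have hAb' : ‖∑ s ∈ A, uu d.f s (d.N x) x‖ₑ ≤ ENNReal.ofReal (2 ^ 44 * i * ε) := by
    rw [← ofReal_norm]; exact ENNReal.ofReal_le_ofReal hAb
  calc _ ≤ (ENNReal.ofReal (2 ^ 53 * ε) + 2 * H x') + ENNReal.ofReal (2 ^ 44 * i * ε) := add_le_add hBb hAb'
    _ = ENNReal.ofReal (2 ^ 53 * ε + 2 ^ 44 * i * ε) + 2 * H x' := by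
        rw [ENNReal.ofReal_add (by positivity) (by positivity)]; ring
    _ ≤ _ := by
        gcongr
        have : 0 ≤ (i:ℝ) * ε := by positivity
        nlinarith

/-- the set of tiles frequencies at xi below (t,k) -/
lemma UpIn_I (d : Dat) {P : Finset Tile} (hUP : d.UP P)
    {t : ℕ} {k : ℤ} {xi : ℝ} (hJ : ((t, k), xi) ∈ d.U) (Q : Finset (ℕ × ℤ))
    (hQ : ∀ I, I ∈ Q ↔ I ∈ d.V ∧ Sub I (t, k) ∧ (I, xi) ∈ P) : UpIn Q t k := by
  have htS : t < d.S := ((d.mem_V t k).1 ((d.mem_U _ _).1 hJ).1).1.2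
  constructor
  · intro p hp
    rw [hQ] at hp
    exact ⟨((d.mem_V p.1 p.2).1 hp.1).1.1, hp.2.1.1, hp.2.1.2⟩
  · intro x s s' h1 h2 h3
    rw [hQ] at h1 ⊢
    have hV := d.V_up h1.1 h2 (by omega)
    have hx : x ∈ In t k := h1.2.1.2 (mem_In_Dy x s)
    refine ⟨hV, Sub_of (mem_In_Dy x s') hx h3, ?_⟩
    rcases h2.eq_or_lt with rfl | h4
    · exact h1.2.2
    · exact hUP _ _ _ _ h1.2.2 (Sub_Dy x h2) h4 (by simp) ((d.mem_U _ _).2 ⟨hV, ((d.mem_U _ _).1 hJ).2⟩)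

/-- The tree lemma -/
theorem tree_lemma (d : Dat) {P : Finset Tile} (hP : P ⊆ d.U) (hUP : d.UP P) {ε : ℝ} (hε : 0 ≤ ε) (hEn : d.En P ε) (i : ℕ)
    {μ : ℝ} (hμ : 0 ≤ μ) (hD : d.Dens P (2 ^ i) μ) {J : ℕ × ℤ} {xi : ℝ} (hJ : (J, xi) ∈ d.U) :
    ∫⁻ x in d.G, ‖d.Lsum (DD (2 ^ i) J xi P) x‖ₑ ≤ ENNReal.ofReal (2 ^ 210 * (1 + i) * ε * μ * 2 ^ J.1) := by
  classical
  obtain ⟨t, k⟩ := J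
  have htS : t < d.S := ((d.mem_V t k).1 ((d.mem_U _ _).1 hJ).1).1.2
  set T := DD (2 ^ i) (t, k) xi P with hT
  -- maximal function
  set Q := d.V.filter (fun I => Sub I (t, k) ∧ (I, xi) ∈ P) with hQd
  have hQ : ∀ I, I ∈ Q ↔ I ∈ d.V ∧ Sub I (t, k) ∧ (I, xi) ∈ P := fun I => by rw [hQd, Finset.mem_filter]
  have hQU := UpIn_I d hUP hJ Q hQ
  obtain ⟨H, hHm, hHi, hHb⟩ := max_lemma d.hf xi hQU hε (fun p hp => hEn.cc_le hε hP ((hQ p).1 hp).2.2) (hEn (t, k) xi hJ)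
  have hH : ∀ y ∈ In t k, ∀ σ ≤ t, (∀ s ∈ Finset.Ioc σ t, ((s, Dy y s), xi) ∈ P) →
      ‖∑ s ∈ Finset.Ioc σ t, uu d.f s xi y‖ₑ ≤ H y := by
    intro y hy σ hσ h
    refine hHb y hy σ hσ fun s hs => (hQ _).2 ⟨((d.mem_U _ _).1 (hP (h s hs))).1, ?_, h s hs⟩
    exact Sub_of (mem_In_Dy y s) hy (Finset.mem_Ioc.1 hs).2
  -- stopping intervals
  set Q' := d.V.filter (fun I => Sub I (t, k) ∧ ∃ p ∈ T, Sub p.1 I) with hQ'd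
  have hQ' : ∀ I, I ∈ Q' ↔ I ∈ d.V ∧ Sub I (t, k) ∧ ∃ p ∈ T, Sub p.1 I := fun I => by rw [hQ'd, Finset.mem_filter]
  have hQU' : UpIn Q' t k := by
    constructor
    · intro p hp
      rw [hQ'] at hp
      exact ⟨((d.mem_V p.1 p.2).1 hp.1).1.1, hp.2.1.1, hp.2.1.2⟩
    · intro x s s' h1 h2 h3
      rw [hQ'] at h1 ⊢
      have hV := d.V_up h1.1 h2 (by omega)
      have hx : x ∈ In t k := h1.2.1.2 (mem_In_Dy x s)
      obtain ⟨p, hp, hps⟩ := h1.2.2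
      exact ⟨hV, Sub_of (mem_In_Dy x s') hx h3, p, hp, hps.trans (Sub_Dy x h2)⟩
  have hTI : ∀ p ∈ T, Sub p.1 (t, k) := fun p hp => by rw [hT, mem_DD] at hp; exact hp.2.1
  rcases T.eq_empty_or_nonempty with hTe | ⟨p0, hp0⟩
  · rw [hTe]
    have : ∀ x, d.Lsum ∅ x = 0 := fun x => by
      unfold Dat.Lsum Dat.Sx; simp
    simp [this]
  have htk : (t, k) ∈ Q' := (hQ' _).2 ⟨((d.mem_U _ _).1 hJ).1, Sub.refl _, p0, hp0, hTI p0 hp0⟩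
  -- active scales above stopping scales
  have hscale : ∀ p ∈ stp Q', ∀ x ∈ In p.1 p.2, ∀ s ∈ d.Sx T x, p.1 < s := by
    intro p hp x hx s hs
    by_contra hcon
    push Not at hcon
    rw [mem_Sx] at hs
    rw [mem_stp hQU'] at hp
    have hsub : Sub (s, Dy x s) p := Sub_of (mem_In_Dy x s) hx hcon
    refine hp.1 ((hQ' p).2 ⟨?_, ?_, _, hs.2.1, hsub⟩)
    · have h1 := (stp_sub hQU' ((mem_stp hQU' p).2 hp)).1
      have hs2 := hs.2.1
      rw [hT, mem_DD] at hs2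
      exact d.V_sub ((d.mem_U _ _).1 (hP hs2.1)).1 hsub (by omega)
    · have h1 := (stp_sub hQU' ((mem_stp hQU' p).2 hp))
      exact ⟨h1.1.le, h1.2⟩
  set c : ℝ≥0∞ := ENNReal.ofReal (2 ^ 54 * (1 + i) * ε) with hc
  set m : ℝ≥0∞ := ENNReal.ofReal μ with hm
  have hstep : ∀ p ∈ stp Q', ∫⁻ x in d.G ∩ In p.1 p.2, ‖d.Lsum T x‖ₑ ≤ 2 * m * (c * 2 ^ p.1 + 2 * ∫⁻ x in In p.1 p.2, H x) := by
    intro p hp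
    obtain ⟨r, j⟩ := p
    simp only at *
    have hp2 := (mem_stp hQU' _).1 hp
    obtain ⟨hV, hsubP, p1, hp1, hsub1⟩ := (hQ' _).1 hp2.2
    have hp1' := hp1
    rw [hT, mem_DD] at hp1'
    -- the active set
    have hvol : volume (d.Ew (2 ^ i) (r + 1, j / 2) xi) ≤ 2 * m * 2 ^ r := by
      refine (hD p1 hp1'.1 (r + 1, j / 2) xi hsub1 ((d.mem_U _ _).2 ⟨hV, ((d.mem_U _ _).1 hJ).2⟩) ?_).trans (le_of_eq ?_)
      · rw [abs_sub_comm]; exact hp1'.2.2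
      · rw [ENNReal.ofReal_mul hμ, ENNReal.ofReal_pow (by norm_num), hm, pow_succ]; simp; ring
    have hintg : ∀ x' ∈ In r j, ∫⁻ x in d.G ∩ In r j, ‖d.Lsum T x‖ₑ ≤ (2 * m * 2 ^ r) * (c + 2 * H x') := by
      intro x' hx'
      calc _ ≤ ∫⁻ x in d.G ∩ In r j, (d.Ew (2 ^ i) (r + 1, j / 2) xi).indicator (fun _ => c + 2 * H x') x := by
            refine setLIntegral_mono' (d.hG.inter (In_meas r j)) fun x hx => ?_
            by_cases hmem : x ∈ d.Ew (2 ^ i) (r + 1, j / 2) xi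
            · rw [Set.indicator_of_mem hmem]
              refine tree_pt d hP hUP hε hEn i hJ (r := r) ?_ (fun s hs => (hscale _ hp x hx.2 s hs).le) hH
              exact (show Dy x r = j from hx.2).trans (show Dy x' r = j from hx').symm
            · rw [Set.indicator_of_notMem hmem]
              have : d.Sx T x = ∅ := by
                rw [Finset.eq_empty_iff_forall_notMem]
                intro s hs
                refine hmem ⟨hx.1, ?_, ?_⟩
                · show Dy x (r + 1) = j / 2
                  rw [Dy_succ, show Dy x r = j from hx.2]
                · have h1 := hscale _ hp x hx.2 s hs
                  rw [mem_Sx, hT, mem_DD] at hs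
                  have h2 : |d.N x - xi| * 2 ^ s ≤ 2 ^ i := hs.2.1.2.2
                  refine le_trans ?_ h2
                  have h3 : r + 1 ≤ s := h1
                  show |d.N x - xi| * 2 ^ (r + 1) ≤ _
                  gcongr
                  norm_num
              unfold Dat.Lsum; rw [this]; simp
        _ ≤ ∫⁻ x, (d.Ew (2 ^ i) (r + 1, j / 2) xi).indicator (fun _ => c + 2 * H x') x := setLIntegral_le_lintegral _ _
        _ ≤ (c + 2 * H x') * volume (d.Ew (2 ^ i) (r + 1, j / 2) xi) := lintegral_indicator_const_le _ _
        _ ≤ (c + 2 * H x') * (2 * m * 2 ^ r) := by gcongr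
        _ = _ := mul_comm _ _
    have h2r : (2:ℝ≥0∞) ^ r ≠ 0 := by positivity
    have h2r' : (2:ℝ≥0∞) ^ r ≠ ⊤ := by simp
    have hav : (∫⁻ x in d.G ∩ In r j, ‖d.Lsum T x‖ₑ) * 2 ^ r ≤ (2 * m * (c * 2 ^ r + 2 * ∫⁻ x in In r j, H x)) * 2 ^ r := by
      calc _ = ∫⁻ x' in In r j, (∫⁻ x in d.G ∩ In r j, ‖d.Lsum T x‖ₑ) := by rw [setLIntegral_const, In_vol]
        _ ≤ ∫⁻ x' in In r j, (2 * m * 2 ^ r) * (c + 2 * H x') := setLIntegral_mono' (In_meas r j) hintg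
        _ = (2 * m * 2 ^ r) * (c * 2 ^ r + 2 * ∫⁻ x in In r j, H x) := by
            have hme : Measurable fun x' => c + 2 * H x' := measurable_const.add (hHm.const_mul _)
            rw [lintegral_const_mul _ hme, lintegral_add_left measurable_const,
              lintegral_const_mul _ hHm, setLIntegral_const, In_vol]
        _ = _ := by ring
    exact (ENNReal.mul_le_mul_iff_left h2r h2r').1 hav
  -- sum up
  have hcover : ∀ x, ‖d.Lsum T x‖ₑ ≠ 0 → ∃ p ∈ stp Q', x ∈ In p.1 p.2 := by
    intro x hx
    have hne : (d.Sx T x).Nonempty := by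
      by_contra hcon
      rw [Finset.not_nonempty_iff_eq_empty] at hcon
      refine hx ?_
      unfold Dat.Lsum; rw [hcon]; simp
    obtain ⟨s, hs⟩ := hne
    rw [mem_Sx] at hs
    have hxJ : x ∈ In t k := (hTI _ hs.2.1).2 (mem_In_Dy x s)
    obtain ⟨r', _, _, h3⟩ := exists_stp hQU' htk hxJ (Nat.zero_le t) (fun h => by
      have := (hQU'.sub _ h).1
      simp at this)
    exact ⟨_, h3, mem_In_Dy x r'⟩
  calc ∫⁻ x in d.G, ‖d.Lsum T x‖ₑ ≤ ∫⁻ x in d.G, ∑ p ∈ stp Q', (In p.1 p.2).indicator (fun x => ‖d.Lsum T x‖ₑ) x := by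
        refine lintegral_mono fun x => ?_
        by_cases h0 : ‖d.Lsum T x‖ₑ = 0
        · simp only [h0]; exact bot_le
        · obtain ⟨p, hp, hxp⟩ := hcover x h0
          refine le_trans (le_of_eq ?_) (Finset.single_le_sum (fun _ _ => bot_le) hp)
          rw [Set.indicator_of_mem hxp]
    _ ≤ ∑ p ∈ stp Q', ∫⁻ x in d.G ∩ In p.1 p.2, ‖d.Lsum T x‖ₑ := by
        rw [lintegral_finsetSum _ fun p _ => (measurable_Lsum d T).enorm.indicator (In_meas p.1 p.2)]
        refine Finset.sum_le_sum fun p _ => le_of_eq ?_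
        rw [setLIntegral_indicator (In_meas p.1 p.2), Set.inter_comm]
    _ ≤ ∑ p ∈ stp Q', 2 * m * (c * 2 ^ p.1 + 2 * ∫⁻ x in In p.1 p.2, H x) := Finset.sum_le_sum hstep
    _ = 2 * m * (c * ∑ p ∈ stp Q', 2 ^ p.1 + 2 * ∑ p ∈ stp Q', ∫⁻ x in In p.1 p.2, H x) := by
        rw [← Finset.mul_sum, Finset.sum_add_distrib, Finset.mul_sum, Finset.mul_sum]
    _ ≤ 2 * m * (c * 2 ^ t + 2 * (2 ^ 200 * ENNReal.ofReal ε * 2 ^ t)) := by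
        gcongr
        · exact sum_stp_len hQU'
        · exact (sum_stp_le hQU' H).trans hHi
    _ = ENNReal.ofReal (2 * μ * (2 ^ 54 * (1 + i) * ε * 2 ^ t + 2 * (2 ^ 200 * ε * 2 ^ t))) := by
        rw [hm, hc, ENNReal.ofReal_mul (p := 2 * μ) (by positivity), ENNReal.ofReal_mul (p := 2) (q := μ) (by positivity), ENNReal.ofReal_add (p := 2 ^ 54 * (1 + i) * ε * 2 ^ t) (by positivity) (by positivity),
          ENNReal.ofReal_mul (p := 2 ^ 54 * (1 + i) * ε) (by positivity), ENNReal.ofReal_mul (p := 2) (by positivity), ENNReal.ofReal_mul (p := 2 ^ 200 * ε) (by positivity),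
          ENNReal.ofReal_mul (p := 2 ^ 200) (by positivity), ENNReal.ofReal_pow (p := 2) (by norm_num), ENNReal.ofReal_pow (p := 2) (by norm_num)]
        simp
    _ ≤ _ := by
        refine ENNReal.ofReal_le_ofReal ?_
        show _ ≤ 2 ^ 210 * (1 + i) * ε * μ * 2 ^ t
        have h0 : 0 ≤ ε * μ * 2 ^ t := by positivity
        have h1 : 0 ≤ i * (ε * μ * 2 ^ t) := by positivity
        nlinarith

end Carl

namespace Carl
open Complex (I)

/-- mass of a tail kernel on a set -/
noncomputable def Qr (s : ℕ) (j : ℤ) (A : Set ℝ) : ℝ := (∫⁻ z in A, ENNReal.ofReal (kd s 4 (z - lp s j))).toReal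

lemma Q_le (s : ℕ) (j : ℤ) (A : Set ℝ) : ∫⁻ z in A, ENNReal.ofReal (kd s 4 (z - lp s j)) ≤ 4 := by
  refine (setLIntegral_le_lintegral _ _).trans ?_
  refine le_trans (le_of_eq (lintegral_congr fun z => ?_)) (kd_lintegral_sub s (n := 4) (by norm_num) (lp s j))
  unfold kd; rw [wt_sub_comm]

lemma Q_ne (s : ℕ) (j : ℤ) (A : Set ℝ) : ∫⁻ z in A, ENNReal.ofReal (kd s 4 (z - lp s j)) ≠ ⊤ :=
  ((Q_le s j A).trans_lt (by norm_num)).ne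

lemma Qr_nonneg (s : ℕ) (j : ℤ) (A : Set ℝ) : 0 ≤ Qr s j A := ENNReal.toReal_nonneg

lemma Qr_le (s : ℕ) (j : ℤ) (A : Set ℝ) : Qr s j A ≤ 4 := by
  have := ENNReal.toReal_mono (by norm_num) (Q_le s j A)
  simpa [Qr] using this

lemma Qr_sum (s : ℕ) (j : ℤ) {ι : Type*} (T : Finset ι) (A : ι → Set ℝ) (hA : ∀ i ∈ T, MeasurableSet (A i))
    (hd : (T : Set ι).PairwiseDisjoint A) (B : Set ℝ) (hB : ∀ i ∈ T, A i ⊆ B) : ∑ i ∈ T, Qr s j (A i) ≤ Qr s j B := by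
  have h := sum_lintegral_le T A hA hd B hB (fun z => ENNReal.ofReal (kd s 4 (z - lp s j)))
  unfold Qr
  rw [← ENNReal.toReal_sum (fun i _ => Q_ne s j _)]
  exact ENNReal.toReal_mono (Q_ne s j B) h

lemma qpair_pt {s s' : ℕ} {j j' : ℤ} (hs : s' ≤ s) {z : ℝ} (hz : z ∈ In s' j') (y : ℝ) :
    kd s 6 (y - lp s j) * kd s' 6 (y - lp s' j') ≤ 16 * kd s 4 (z - lp s j) * kd s' 2 (y - lp s' j') := by
  have h1 := wt_inv_shift s (y - lp s j) (z - lp s j)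
  rw [show z - lp s j - (y - lp s j) = z - y by ring] at h1
  have h2 : wt s (z - y) ≤ 2 * wt s' (y - lp s' j') := by
    refine (wt_anti hs _).trans ?_
    have := wt_add_le s' (z - lp s' j') (lp s' j' - y)
    rw [show z - lp s' j' + (lp s' j' - y) = z - y by ring, wt_sub_comm s' (lp s' j') y] at this
    refine this.trans ?_
    have := wt_In hz (lp_mem s' j')
    have := wt_pos s' (y - lp s' j')
    gcongr
  have h3 : kd s 6 (y - lp s j) ≤ 16 * kd s 4 (z - lp s j) * wt s' (y - lp s' j') ^ 4 := by
    refine (kd_le s (show 4 ≤ 6 by norm_num) _).trans ?_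
    unfold kd
    have p1 := wt_inv_nonneg s (y - lp s j)
    have p2 := wt_inv_nonneg s (z - lp s j)
    calc _ ≤ ((2:ℝ) ^ s)⁻¹ * ((wt s (z - lp s j))⁻¹ * (2 * wt s' (y - lp s' j'))) ^ 4 := by
          gcongr; exact h1.trans (by gcongr)
      _ = _ := by ring
  have h4 := kd_mul_pow s' 2 4 (y - lp s' j')
  norm_num at h4
  have p3 := kd_nonneg s' 6 (y - lp s' j')
  calc _ ≤ (16 * kd s 4 (z - lp s j) * wt s' (y - lp s' j') ^ 4) * kd s' 6 (y - lp s' j') := by gcongr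
    _ = _ := by rw [← h4]; ring

lemma qpair {s s' : ℕ} {j j' : ℤ} (hs : s' ≤ s) {φ φ' : ℝ → ℂ} (h : ∀ y, ‖φ y‖ ≤ kd s 6 (y - lp s j))
    (h' : ∀ y, ‖φ' y‖ ≤ kd s' 6 (y - lp s' j')) :
    2 ^ s' * ‖∫ y, φ y * (starRingEnd ℂ) (φ' y)‖ ≤ 64 * Qr s j (In s' j') := by
  have key : (2:ℝ≥0∞) ^ s' * ‖∫ y, φ y * (starRingEnd ℂ) (φ' y)‖ₑ ≤ 64 * ∫⁻ z in In s' j', ENNReal.ofReal (kd s 4 (z - lp s j)) := by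
    calc (2:ℝ≥0∞) ^ s' * ‖∫ y, φ y * (starRingEnd ℂ) (φ' y)‖ₑ
        = ∫⁻ z in In s' j', ‖∫ y, φ y * (starRingEnd ℂ) (φ' y)‖ₑ := by rw [setLIntegral_const, In_vol, mul_comm]
      _ ≤ ∫⁻ z in In s' j', 64 * ENNReal.ofReal (kd s 4 (z - lp s j)) := by
          refine setLIntegral_mono (by have := (kd_continuous s 4).measurable; fun_prop) fun z hz => ?_
          refine (enorm_integral_le_lintegral_enorm _).trans ?_
          calc ∫⁻ y, ‖φ y * (starRingEnd ℂ) (φ' y)‖ₑ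
              ≤ ∫⁻ y, ENNReal.ofReal (16 * kd s 4 (z - lp s j)) * ENNReal.ofReal (kd s' 2 (lp s' j' - y)) := by
                refine lintegral_mono fun y => ?_
                rw [← ENNReal.ofReal_mul (p := 16 * kd s 4 (z - lp s j)) (by have := kd_nonneg s 4 (z - lp s j); positivity), ← ofReal_norm]
                refine ENNReal.ofReal_le_ofReal ?_
                have e : kd s' 2 (lp s' j' - y) = kd s' 2 (y - lp s' j') := by unfold kd; rw [wt_sub_comm]
                rw [e, norm_mul, RCLike.norm_conj]
                refine le_trans ?_ (qpair_pt hs hz y)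
                have := kd_nonneg s 6 (y - lp s j)
                gcongr
                · exact h y
                · exact h' y
            _ = ENNReal.ofReal (16 * kd s 4 (z - lp s j)) * ∫⁻ y, ENNReal.ofReal (kd s' 2 (lp s' j' - y)) := by
                rw [lintegral_const_mul]; have := (kd_continuous s' 2).measurable; fun_prop
            _ ≤ ENNReal.ofReal (16 * kd s 4 (z - lp s j)) * 4 := by gcongr; exact kd_two_lintegral_sub _ _
            _ = _ := by rw [ENNReal.ofReal_mul (p := 16) (by norm_num)]; norm_num; ring
      _ = _ := by rw [lintegral_const_mul]; have := (kd_continuous s 4).measurable; fun_prop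
  have := ENNReal.toReal_mono (ENNReal.mul_ne_top (by norm_num) (Q_ne s j _)) key
  simpa [Qr, ENNReal.toReal_mul] using this

lemma WW_int {s : ℕ} {j : ℤ} {xi : ℝ} {φ : ℝ → ℂ} (h : φ ∈ WW s j xi) : MemLp φ 2 := by
  refine memLp_two_of h.1.continuous (ne_of_lt ?_)
  calc ∫⁻ y, ‖φ y‖ₑ ^ 2 ≤ ∫⁻ y, ENNReal.ofReal (kd s 6 (lp s j - y)) := by
        refine lintegral_mono fun y => ?_
        have e : kd s 6 (lp s j - y) = kd s 6 (y - lp s j) := by unfold kd; rw [wt_sub_comm]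
        rw [e, ← ofReal_norm, ← ENNReal.ofReal_pow (norm_nonneg _)]
        refine ENNReal.ofReal_le_ofReal ?_
        have h1 := h.2 y
        have h2 := kd_le_one s 6 (y - lp s j)
        nlinarith [norm_nonneg (φ y)]
    _ ≤ 4 := kd_lintegral_sub s (by norm_num) _
    _ < ⊤ := by norm_num

lemma orth {s s' : ℕ} {j j' : ℤ} {xi xi' : ℝ} {φ φ' : ℝ → ℂ} (h : φ ∈ WW s j xi) (h' : φ' ∈ WW s' j' xi')
    (hne : ∫ y, φ y * (starRingEnd ℂ) (φ' y) ≠ 0) : xi - 32 / 2 ^ s ≤ xi' - 2 / 2 ^ s' ∧ xi' - 32 / 2 ^ s' ≤ xi - 2 / 2 ^ s := by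
  by_contra hcon
  refine hne ((h.1.mul h'.1.conj).integral_zero ?_ (l2_int (WW_int h) (WW_int h')))
  rw [not_and_or] at hcon
  rcases hcon with h1 | h1
  · left; push Not at h1; linarith
  · right; push Not at h1; linarith

/-- cross sum -/
lemma cross_sum (A : Finset (ℕ × ℤ)) (J : ℕ × ℤ) (hA : ∀ p ∈ A, Sub p J) :
    ∑ p ∈ A, 2 ^ p.1 * Qr p.1 p.2 (In J.1 J.2)ᶜ ≤ 1024 * 2 ^ J.1 := by
  classical
  have key : ∑ p ∈ A, (2:ℝ≥0∞) ^ p.1 * ∫⁻ z in (In J.1 J.2)ᶜ, ENNReal.ofReal (kd p.1 4 (z - lp p.1 p.2)) ≤ 1024 * 2 ^ J.1 := by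
    have h1 : ∀ p ∈ A, (2:ℝ≥0∞) ^ p.1 * ∫⁻ z in (In J.1 J.2)ᶜ, ENNReal.ofReal (kd p.1 4 (z - lp p.1 p.2)) ≤
        16 * ∫⁻ x in In p.1 p.2, ∫⁻ z in (In J.1 J.2)ᶜ, ENNReal.ofReal (kd p.1 4 (x - z)) := by
      intro p hp
      have hk := (kd_continuous p.1 4).measurable
      have hm : Measurable fun x => ∫⁻ z in (In J.1 J.2)ᶜ, ENNReal.ofReal (kd p.1 4 (x - z)) := by
        refine Measurable.lintegral_prod_right' (f := fun q : ℝ × ℝ => ENNReal.ofReal (kd p.1 4 (q.1 - q.2))) (by fun_prop)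
      rw [← lintegral_const_mul _ hm, mul_comm, ← In_vol p.1 p.2, ← setLIntegral_const]
      refine setLIntegral_mono (hm.const_mul _) fun x hx => ?_
      rw [← lintegral_const_mul _ (by fun_prop)]
      refine lintegral_mono fun z => ?_
      rw [show (16:ℝ≥0∞) = ENNReal.ofReal 16 by norm_num, ← ENNReal.ofReal_mul (p := 16) (by norm_num)]
      refine ENNReal.ofReal_le_ofReal ?_
      unfold kd
      have h2 := wt_inv_shift p.1 (z - lp p.1 p.2) (z - x)
      rw [show z - x - (z - lp p.1 p.2) = lp p.1 p.2 - x by ring] at h2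
      have h3 := wt_In (lp_mem p.1 p.2) hx
      have p1 := wt_inv_nonneg p.1 (z - lp p.1 p.2)
      have p2 := wt_inv_nonneg p.1 (z - x)
      rw [wt_sub_comm p.1 x z]
      calc _ ≤ ((2:ℝ) ^ p.1)⁻¹ * ((wt p.1 (z - x))⁻¹ * 2) ^ 4 := by
            gcongr; exact h2.trans (by gcongr)
        _ = _ := by ring
    refine (Finset.sum_le_sum h1).trans ?_
    rw [← Finset.mul_sum]
    have hmaps : ∀ p ∈ A, p.1 ∈ Finset.range (J.1 + 1) := fun p hp => Finset.mem_range.2 (Nat.lt_succ_of_le (hA p hp).1)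
    have h2 : ∀ s, ∑ p ∈ A with p.1 = s, ∫⁻ x in In p.1 p.2, ∫⁻ z in (In J.1 J.2)ᶜ, ENNReal.ofReal (kd p.1 4 (x - z)) ≤ 32 * 2 ^ s := by
      intro s
      have e0 : ∀ p ∈ A.filter (fun p => p.1 = s), ∫⁻ x in In p.1 p.2, ∫⁻ z in (In J.1 J.2)ᶜ, ENNReal.ofReal (kd p.1 4 (x - z)) =
          ∫⁻ x in In p.1 p.2, ∫⁻ z in (In J.1 J.2)ᶜ, ENNReal.ofReal (kd s 4 (x - z)) := by
        rintro ⟨s', j⟩ hp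
        have e1 : s' = s := (Finset.mem_filter.1 hp).2
        subst e1; rfl
      rw [Finset.sum_congr rfl e0]
      have h3 := sum_lintegral_le (A.filter (fun p => p.1 = s)) (fun p => In p.1 p.2) (fun p _ => In_meas _ _) ?_ (In J.1 J.2) (fun p hp => (hA p (Finset.mem_filter.1 hp).1).2) (fun x => ∫⁻ z in (In J.1 J.2)ᶜ, ENNReal.ofReal (kd s 4 (x - z)))
      · exact h3.trans (crossI s J.1 J.2)
      · rintro ⟨s1, j1⟩ hp ⟨s2, j2⟩ hq hpq
        have e1 : s1 = s := (Finset.mem_filter.1 hp).2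
        have e2 : s2 = s := (Finset.mem_filter.1 hq).2
        subst e1; subst e2
        exact In_disj fun e => hpq (Prod.ext rfl e)
    calc _ = 16 * ∑ s ∈ Finset.range (J.1 + 1), ∑ p ∈ A with p.1 = s, ∫⁻ x in In p.1 p.2, ∫⁻ z in (In J.1 J.2)ᶜ, ENNReal.ofReal (kd p.1 4 (x - z)) := by
          rw [Finset.sum_fiberwise_of_maps_to hmaps]
      _ ≤ 16 * ∑ s ∈ Finset.range (J.1 + 1), (32 * 2 ^ s : ℝ≥0∞) := by
          gcongr with s hs
          exact h2 s
      _ = 512 * ∑ s ∈ Finset.range (J.1 + 1), (2 ^ s : ℝ≥0∞) := by rw [← Finset.mul_sum]; ring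
      _ ≤ 512 * (2 * 2 ^ J.1) := by gcongr; exact geom_sum_le _
      _ = _ := by ring
  have h := ENNReal.toReal_mono (ENNReal.mul_ne_top (by norm_num) (by simp)) key
  rw [ENNReal.toReal_sum (fun p _ => ENNReal.mul_ne_top (by simp) (Q_ne _ _ _))] at h
  simpa [Qr, ENNReal.toReal_mul] using h
end Carl

namespace Carl
open Complex (I)

noncomputable def ip {ι : Type*} (φ : ι → ℝ → ℂ) (p q : ι) : ℝ := ‖∫ y, φ p y * (starRingEnd ℂ) (φ q y)‖

lemma ip_nonneg {ι : Type*} (φ : ι → ℝ → ℂ) (p q : ι) : 0 ≤ ip φ p q := norm_nonneg _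

lemma ip_comm {ι : Type*} (φ : ι → ℝ → ℂ) (p q : ι) : ip φ p q = ip φ q p := by
  unfold ip
  rw [← RCLike.norm_conj, ← integral_conj]
  congr 2; ext y; simp [mul_comm]

/-- data of a collection of selected tiles -/
structure Orth (S : Finset (ℕ × (ℕ × ℤ))) (J : ℕ → ℕ × ℤ) (xi : ℕ → ℝ) (φ : ℕ × (ℕ × ℤ) → ℝ → ℂ) : Prop where
  hφ : ∀ p ∈ S, φ p ∈ WW p.2.1 p.2.2 (xi p.1)
  h0 : ∀ p ∈ S, Sub p.2 (J p.1)
  h1 : ∀ p ∈ S, ∀ q ∈ S, q.1 < p.1 → Sub p.2 (J q.1) → 64 < |xi p.1 - xi q.1| * 2 ^ p.2.1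
  h2 : ∀ p ∈ S, ∀ q ∈ S, p.1 < q.1 → xi p.1 ≤ xi q.1

variable {S : Finset (ℕ × (ℕ × ℤ))} {J : ℕ → ℕ × ℤ} {xi : ℕ → ℝ} {φ : ℕ × (ℕ × ℤ) → ℝ → ℂ}

lemma Orth.pair (h : Orth S J xi φ) {p q : ℕ × (ℕ × ℤ)} (hp : p ∈ S) (hq : q ∈ S) (hne : ip φ p q ≠ 0) :
    xi p.1 - 32 / 2 ^ p.2.1 ≤ xi q.1 - 2 / 2 ^ q.2.1 ∧ xi q.1 - 32 / 2 ^ q.2.1 ≤ xi p.1 - 2 / 2 ^ p.2.1 :=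
  orth (h.hφ p hp) (h.hφ q hq) (norm_ne_zero_iff.1 hne)

lemma Orth.same (h : Orth S J xi φ) {p : ℕ × (ℕ × ℤ)} (hp : p ∈ S) :
    ∑ q ∈ S with q.2.1 = p.2.1, 2 ^ q.2.1 * ip φ p q ≤ 256 := by
  classical
  have e : ∑ q ∈ S with q.2.1 = p.2.1, 2 ^ q.2.1 * ip φ p q = ∑ q ∈ (S.filter (fun q => q.2.1 = p.2.1)).filter (fun q => ip φ p q ≠ 0), 2 ^ q.2.1 * ip φ p q := by
    symm; apply Finset.sum_filter_of_ne
    intro q _ hq h0; rw [h0, mul_zero] at hq; exact hq rfl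
  rw [e]
  have key : ∀ q ∈ (S.filter (fun q => q.2.1 = p.2.1)).filter (fun q => ip φ p q ≠ 0), ∀ q' ∈ (S.filter (fun q => q.2.1 = p.2.1)).filter (fun q => ip φ p q ≠ 0),
      q.2.2 = q'.2.2 → ¬ q.1 < q'.1 := by
    intro q hq q' hq' hj hlt
    simp only [Finset.mem_filter] at hq hq'
    have eqq : q'.2 = q.2 := Prod.ext (hq'.1.2.trans hq.1.2.symm) hj.symm
    have hs : Sub q'.2 (J q.1) := by rw [eqq]; exact h.h0 q hq.1.1
    have h3 := h.h1 q' hq'.1.1 q hq.1.1 hlt hs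
    have a := h.pair hp hq.1.1 hq.2
    have b := h.pair hp hq'.1.1 hq'.2
    rw [hq.1.2] at a
    rw [hq'.1.2] at b h3
    have hpos : (0:ℝ) < 2 ^ p.2.1 := by positivity
    have e32 : (32:ℝ) / 2 ^ p.2.1 = 16 * (2 / 2 ^ p.2.1) := by ring
    have h4 : |xi q'.1 - xi q.1| ≤ 60 / 2 ^ p.2.1 := by
      have : (60:ℝ) / 2 ^ p.2.1 = 30 * (2 / 2 ^ p.2.1) := by ring
      rw [abs_le]; constructor <;> linarith [a.1, a.2, b.1, b.2]
    rw [le_div_iff₀ hpos] at h4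
    linarith
  calc _ ≤ ∑ q ∈ (S.filter (fun q => q.2.1 = p.2.1)).filter (fun q => ip φ p q ≠ 0), 64 * Qr p.2.1 p.2.2 (In q.2.1 q.2.2) := by
        refine Finset.sum_le_sum fun q hq => ?_
        simp only [Finset.mem_filter] at hq
        exact qpair hq.1.2.le (h.hφ p hp).2 (h.hφ q hq.1.1).2
    _ ≤ 64 * Qr p.2.1 p.2.2 Set.univ := by
        rw [← Finset.mul_sum]
        refine mul_le_mul_of_nonneg_left (Qr_sum _ _ _ (fun q : ℕ × (ℕ × ℤ) => In q.2.1 q.2.2) (fun q _ => In_meas _ _) ?_ _ (fun _ _ => Set.subset_univ _)) (by norm_num)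
        intro q hq q' hq' hqq
        show Disjoint (In q.2.1 q.2.2) (In q'.2.1 q'.2.2)
        have e1 : q.2.1 = p.2.1 := (Finset.mem_filter.1 (Finset.mem_filter.1 hq).1).2
        have e2 : q'.2.1 = p.2.1 := (Finset.mem_filter.1 (Finset.mem_filter.1 hq').1).2
        rw [e1, e2]
        refine In_disj fun ej => hqq ?_
        have a := key q hq q' hq' ej
        have b := key q' hq' q hq ej.symm
        exact Prod.ext (by omega) (Prod.ext (e1.trans e2.symm) ej)
    _ ≤ _ := by have := Qr_le p.2.1 p.2.2 Set.univ; linarith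

lemma pow_gap {a b : ℕ} (h : a + 6 ≤ b) : (64:ℝ) / 2 ^ b ≤ 1 / 2 ^ a := by
  rw [div_le_div_iff₀ (by positivity) (by positivity), one_mul]
  calc (64:ℝ) * 2 ^ a = 2 ^ (a + 6) := by ring
    _ ≤ 2 ^ b := pow_le_pow_right₀ (by norm_num) h

lemma Orth.small (h : Orth S J xi φ) (hr : ∀ p ∈ S, ∀ q ∈ S, q.2.1 < p.2.1 → q.2.1 + 6 ≤ p.2.1)
    {p : ℕ × (ℕ × ℤ)} (hp : p ∈ S) :
    ∑ q ∈ S with q.2.1 < p.2.1, 2 ^ q.2.1 * ip φ p q ≤ 64 * Qr p.2.1 p.2.2 (In (J p.1).1 (J p.1).2)ᶜ := by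
  classical
  have e : ∑ q ∈ S with q.2.1 < p.2.1, 2 ^ q.2.1 * ip φ p q = ∑ q ∈ (S.filter (fun q => q.2.1 < p.2.1)).filter (fun q => ip φ p q ≠ 0), 2 ^ q.2.1 * ip φ p q := by
    symm; apply Finset.sum_filter_of_ne
    intro q _ hq h0; rw [h0, mul_zero] at hq; exact hq rfl
  rw [e]
  obtain ⟨T, hT⟩ : ∃ T, T = (S.filter (fun q => q.2.1 < p.2.1)).filter (fun q => ip φ p q ≠ 0) := ⟨_, rfl⟩
  rw [← hT]
  have mT : ∀ q ∈ T, q ∈ S ∧ q.2.1 < p.2.1 ∧ 3 / 2 / 2 ^ q.2.1 ≤ xi q.1 - xi p.1 ∧ xi q.1 - xi p.1 ≤ 32 / 2 ^ q.2.1 := by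
    intro q hq
    rw [hT] at hq
    simp only [Finset.mem_filter] at hq
    have a := h.pair hp hq.1.1 hq.2
    have g := pow_gap (hr p hp q hq.1.1 hq.1.2)
    have pp : (0:ℝ) < 1 / 2 ^ p.2.1 := by positivity
    have e1 : (32:ℝ) / 2 ^ p.2.1 = 32 * (1 / 2 ^ p.2.1) := by ring
    have e2 : (64:ℝ) / 2 ^ p.2.1 = 64 * (1 / 2 ^ p.2.1) := by ring
    have e3 : (2:ℝ) / 2 ^ p.2.1 = 2 * (1 / 2 ^ p.2.1) := by ring
    have e4 : (2:ℝ) / 2 ^ q.2.1 = 2 * (1 / 2 ^ q.2.1) := by ring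
    have e5 : (3 / 2:ℝ) / 2 ^ q.2.1 = 3 / 2 * (1 / 2 ^ q.2.1) := by ring
    have e6 : (32:ℝ) / 2 ^ q.2.1 = 32 * (1 / 2 ^ q.2.1) := by ring
    refine ⟨hq.1.1, hq.1.2, ?_, ?_⟩
    · linarith [a.1, a.2]
    · linarith [a.1, a.2]
  have hbig : ∀ q ∈ T, p.1 < q.1 := by
    intro q hq
    obtain ⟨a, b, c, d⟩ := mT q hq
    have c' : 0 < xi q.1 - xi p.1 := lt_of_lt_of_le (by positivity) c
    rcases lt_trichotomy p.1 q.1 with h3 | h3 | h3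
    · exact h3
    · rw [h3] at c'; linarith
    · have := h.h2 q a p hp h3; linarith
  have hout : ∀ q ∈ T, In q.2.1 q.2.2 ⊆ (In (J p.1).1 (J p.1).2)ᶜ := by
    intro q hq x hx hxJ
    obtain ⟨a, b, c, d⟩ := mT q hq
    have hle : q.2.1 ≤ (J p.1).1 := b.le.trans (h.h0 p hp).1
    have hsub : Sub q.2 (J p.1) := ⟨hle, In_subset hle hx hxJ⟩
    have h3 := h.h1 q a p hp (hbig q hq) hsub
    have c' : 0 < xi q.1 - xi p.1 := lt_of_lt_of_le (by positivity) c
    rw [abs_of_pos c'] at h3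
    rw [le_div_iff₀ (by positivity)] at d
    linarith
  -- key disjointness
  have key : ∀ q ∈ T, ∀ q' ∈ T, q.1 < q'.1 → Disjoint (In q.2.1 q.2.2) (In q'.2.1 q'.2.2) := by
    intro q hq q' hq' hlt
    rw [Set.disjoint_left]
    intro x hx hx'
    obtain ⟨a, b, c, d⟩ := mT q hq
    obtain ⟨a', b', c', d'⟩ := mT q' hq'
    rcases le_or_gt q'.2.1 q.2.1 with hle | hlt2
    · have hs : Sub q'.2 (J q.1) := Sub.trans ⟨hle, In_subset hle hx' hx⟩ (h.h0 q a)
      have h3 := h.h1 q' a' q a hlt hs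
      have h4 := h.h2 q a q' a' hlt
      have h5 : |xi q'.1 - xi q.1| ≤ 32 / 2 ^ q'.2.1 := by
        rw [abs_of_nonneg (by linarith)]
        have : (0:ℝ) < 3 / 2 / 2 ^ q.2.1 := by positivity
        linarith
      rw [le_div_iff₀ (by positivity)] at h5
      linarith
    · have g := pow_gap (hr q' a' q a hlt2)
      have h4 := h.h2 q a q' a' hlt
      have e5 : (3 / 2:ℝ) / 2 ^ q.2.1 = 3 / 2 * (1 / 2 ^ q.2.1) := by ring
      have e6 : (32:ℝ) / 2 ^ q'.2.1 = 1 / 2 * (64 / 2 ^ q'.2.1) := by ring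
      have : (0:ℝ) < 1 / 2 ^ q.2.1 := by positivity
      linarith
  have key2 : ∀ q ∈ T, ∀ q' ∈ T, q.1 = q'.1 → ¬ q.2.1 < q'.2.1 := by
    intro q hq q' hq' he hlt
    obtain ⟨a, b, c, d⟩ := mT q hq
    obtain ⟨a', b', c', d'⟩ := mT q' hq'
    have g := pow_gap (hr q' a' q a hlt)
    rw [he] at c
    have e5 : (3 / 2:ℝ) / 2 ^ q.2.1 = 3 / 2 * (1 / 2 ^ q.2.1) := by ring
    have e6 : (32:ℝ) / 2 ^ q'.2.1 = 1 / 2 * (64 / 2 ^ q'.2.1) := by ring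
    have : (0:ℝ) < 1 / 2 ^ q.2.1 := by positivity
    linarith
  calc _ ≤ ∑ q ∈ T, 64 * Qr p.2.1 p.2.2 (In q.2.1 q.2.2) := by
        refine Finset.sum_le_sum fun q hq => ?_
        obtain ⟨a, b, c, d⟩ := mT q hq
        exact qpair b.le (h.hφ p hp).2 (h.hφ q a).2
    _ ≤ _ := by
        rw [← Finset.mul_sum]
        refine mul_le_mul_of_nonneg_left (Qr_sum _ _ _ (fun q : ℕ × (ℕ × ℤ) => In q.2.1 q.2.2) (fun q _ => In_meas _ _) ?_ _ hout) (by norm_num)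
        intro q hq q' hq' hqq
        show Disjoint (In q.2.1 q.2.2) (In q'.2.1 q'.2.2)
        rcases lt_trichotomy q.1 q'.1 with h3 | h3 | h3
        · exact key q hq q' hq' h3
        · have es : q.2.1 = q'.2.1 := by
            have := key2 q hq q' hq' h3
            have := key2 q' hq' q hq h3.symm
            omega
          rw [es]
          refine In_disj fun ej => hqq (Prod.ext h3 (Prod.ext es ej))
        · exact (key q' hq' q hq h3).symm

lemma Orth.mono (h : Orth S J xi φ) {S' : Finset (ℕ × (ℕ × ℤ))} (hS : S' ⊆ S) : Orth S' J xi φ :=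
  ⟨fun p hp => h.hφ p (hS hp), fun p hp => h.h0 p (hS hp), fun p hp q hq => h.h1 p (hS hp) q (hS hq),
    fun p hp q hq => h.h2 p (hS hp) q (hS hq)⟩

/-- the double sum bound -/
lemma Orth.double (h : Orth S J xi φ) (hr : ∀ p ∈ S, ∀ q ∈ S, q.2.1 < p.2.1 → q.2.1 + 6 ≤ p.2.1)
    {Sidx : Finset ℕ} (hi : ∀ p ∈ S, p.1 ∈ Sidx) {ε : ℝ} (a : ℕ × (ℕ × ℤ) → ℝ) (ha0 : ∀ p, 0 ≤ a p) (ha : ∀ p ∈ S, a p ≤ ε) :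
    ∑ p ∈ S, ∑ q ∈ S, 2 ^ p.2.1 * 2 ^ q.2.1 * (a p * a q) * ip φ p q ≤
      512 * ∑ p ∈ S, 2 ^ p.2.1 * a p ^ 2 + 2 ^ 17 * (ε ^ 2 * ∑ i ∈ Sidx, 2 ^ (J i).1) := by
  classical
  obtain ⟨X, hX⟩ : ∃ X : (ℕ × (ℕ × ℤ)) → (ℕ × (ℕ × ℤ)) → ℝ, X = fun p q => (if q.2.1 = p.2.1 then 2 ^ p.2.1 * a p ^ 2 * (2 ^ q.2.1 * ip φ p q) else 0) +
    (if q.2.1 < p.2.1 then ε ^ 2 * 2 ^ p.2.1 * (2 ^ q.2.1 * ip φ p q) else 0) := ⟨_, rfl⟩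
  have hX0 : ∀ p q, 0 ≤ X p q := by
    intro p q
    have := ip_nonneg φ p q
    simp only [hX]
    refine add_nonneg ?_ ?_ <;> split_ifs <;> positivity
  have hW : ∀ p ∈ S, ∀ q ∈ S, 2 ^ p.2.1 * 2 ^ q.2.1 * (a p * a q) * ip φ p q ≤ X p q + X q p := by
    intro p hp q hq
    have i0 := ip_nonneg φ p q
    have a1 := ha0 p
    have a2 := ha0 q
    have a3 := ha p hp
    have a4 := ha q hq
    have hpq : a p * a q ≤ ε ^ 2 := by rw [sq]; gcongr; linarith
    rcases lt_trichotomy q.2.1 p.2.1 with hlt | heq | hlt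
    · refine le_trans ?_ (le_add_of_nonneg_right (hX0 q p))
      simp only [hX]
      rw [if_neg hlt.ne, if_pos hlt, zero_add]
      calc _ ≤ 2 ^ p.2.1 * 2 ^ q.2.1 * ε ^ 2 * ip φ p q := by gcongr
        _ = _ := by ring
    · simp only [hX, ip_comm φ q p]
      rw [if_pos heq, if_pos heq.symm, heq]
      simp only [lt_irrefl, if_false, add_zero]
      have : a p * a q ≤ a p ^ 2 + a q ^ 2 := by nlinarith [sq_nonneg (a p - a q)]
      calc _ ≤ 2 ^ p.2.1 * 2 ^ p.2.1 * (a p ^ 2 + a q ^ 2) * ip φ p q := by gcongr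
        _ = _ := by ring
    · refine le_trans ?_ (le_add_of_nonneg_left (hX0 p q))
      simp only [hX, ip_comm φ q p]
      rw [if_neg hlt.ne, if_pos hlt, zero_add]
      calc _ ≤ 2 ^ p.2.1 * 2 ^ q.2.1 * ε ^ 2 * ip φ p q := by gcongr
        _ = _ := by ring
  have hsum : ∑ p ∈ S, ∑ q ∈ S, X p q ≤ 256 * ∑ p ∈ S, 2 ^ p.2.1 * a p ^ 2 + 2 ^ 16 * (ε ^ 2 * ∑ i ∈ Sidx, 2 ^ (J i).1) := by
    have hp1 : ∀ p ∈ S, ∑ q ∈ S, X p q ≤ 256 * (2 ^ p.2.1 * a p ^ 2) + 64 * ε ^ 2 * (2 ^ p.2.1 * Qr p.2.1 p.2.2 (In (J p.1).1 (J p.1).2)ᶜ) := by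
      intro p hp
      simp only [hX]
      rw [Finset.sum_add_distrib, ← Finset.sum_filter, ← Finset.sum_filter, ← Finset.mul_sum, ← Finset.mul_sum]
      have b1 := h.same hp
      have b2 := h.small hr hp
      calc _ ≤ 2 ^ p.2.1 * a p ^ 2 * 256 + ε ^ 2 * 2 ^ p.2.1 * (64 * Qr p.2.1 p.2.2 (In (J p.1).1 (J p.1).2)ᶜ) := by gcongr
        _ = _ := by ring
    refine (Finset.sum_le_sum hp1).trans ?_
    rw [Finset.sum_add_distrib, ← Finset.mul_sum, ← Finset.mul_sum]
    have h3 : ∑ p ∈ S, 2 ^ p.2.1 * Qr p.2.1 p.2.2 (In (J p.1).1 (J p.1).2)ᶜ ≤ ∑ i ∈ Sidx, 1024 * 2 ^ (J i).1 := by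
      rw [← Finset.sum_fiberwise_of_maps_to hi]
      refine Finset.sum_le_sum fun i _ => ?_
      refine le_trans (le_of_eq ?_) (cross_sum ((S.filter (fun p => p.1 = i)).image Prod.snd) (J i) ?_)
      · rw [Finset.sum_image]
        · refine Finset.sum_congr rfl fun p hp => ?_
          rw [(Finset.mem_filter.1 hp).2]
        · intro p hp q hq e
          have e1 := (Finset.mem_filter.1 hp).2
          have e2 := (Finset.mem_filter.1 hq).2
          exact Prod.ext (e1.trans e2.symm) e
      · intro I hI
        obtain ⟨p, hp, rfl⟩ := Finset.mem_image.1 hI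
        have := h.h0 p (Finset.mem_filter.1 hp).1
        rwa [(Finset.mem_filter.1 hp).2] at this
    rw [← Finset.mul_sum] at h3
    calc _ ≤ 256 * ∑ p ∈ S, 2 ^ p.2.1 * a p ^ 2 + 64 * ε ^ 2 * (1024 * ∑ i ∈ Sidx, 2 ^ (J i).1) := by gcongr
      _ = _ := by ring
  calc _ ≤ ∑ p ∈ S, ∑ q ∈ S, (X p q + X q p) := Finset.sum_le_sum fun p hp => Finset.sum_le_sum fun q hq => hW p hp q hq
    _ = 2 * ∑ p ∈ S, ∑ q ∈ S, X p q := by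
        simp only [Finset.sum_add_distrib]
        rw [Finset.sum_comm (f := fun p q => X q p)]; ring
    _ ≤ _ := by linarith
end Carl

namespace Carl
open Complex (I)

variable {S : Finset (ℕ × (ℕ × ℤ))} {J : ℕ → ℕ × ℤ} {xi : ℕ → ℝ} {φ : ℕ × (ℕ × ℤ) → ℝ → ℂ}

lemma norm_bilin_le {g h : ℝ → ℂ} (hg : MemLp g 2) (hh : MemLp h 2) :
    ‖∫ x, g x * h x‖ ≤ 2 ^ 23 * (∫ x, ‖g x‖ ^ 2) + 2⁻¹ ^ 25 * ∫ x, ‖h x‖ ^ 2 := by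
  have i1 := (l2_sq hg).const_mul (2 ^ 23)
  have i2 := (l2_sq hh).const_mul (2⁻¹ ^ 25)
  rw [← integral_const_mul, ← integral_const_mul, ← integral_add i1 i2]
  refine norm_integral_le_of_norm_le (i1.add i2) (Filter.Eventually.of_forall fun x => ?_)
  rw [norm_mul]
  show _ ≤ 2 ^ 23 * ‖g x‖ ^ 2 + 2⁻¹ ^ 25 * ‖h x‖ ^ 2
  nlinarith [sq_nonneg (2 ^ 12 * ‖g x‖ - 2⁻¹ ^ 12 * ‖h x‖)]

lemma Orth.part (h : Orth S J xi φ) (hr : ∀ p ∈ S, ∀ q ∈ S, q.2.1 < p.2.1 → q.2.1 + 6 ≤ p.2.1)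
    {Sidx : Finset ℕ} (hi : ∀ p ∈ S, p.1 ∈ Sidx) {ε : ℝ} {f : ℝ → ℂ} (hf : Integrable f) (hf2 : MemLp f 2)
    (ha : ∀ p ∈ S, ‖∫ y, f y * φ p y‖ ≤ ε) :
    ∑ p ∈ S, 2 ^ p.2.1 * ‖∫ y, f y * φ p y‖ ^ 2 ≤ 2 ^ 23 * (∫ x, ‖f x‖ ^ 2) +
      2⁻¹ ^ 25 * (512 * ∑ p ∈ S, 2 ^ p.2.1 * ‖∫ y, f y * φ p y‖ ^ 2 + 2 ^ 17 * (ε ^ 2 * ∑ i ∈ Sidx, 2 ^ (J i).1)) := by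
  obtain ⟨α, hα⟩ : ∃ α : ℕ × (ℕ × ℤ) → ℂ, α = fun p => ∫ y, f y * φ p y := ⟨_, rfl⟩
  have ea : ∀ p, ∫ y, f y * φ p y = α p := fun p => by rw [hα]
  simp only [ea] at ha ⊢
  have hd := h.double hr hi (fun p => ‖α p‖) (fun p => norm_nonneg _) ha
  obtain ⟨F, hF⟩ : ∃ F : ℕ × (ℕ × ℤ) → ℝ → ℂ, F = fun p y => (2 ^ p.2.1 * (starRingEnd ℂ) (α p)) * φ p y := ⟨_, rfl⟩
  have hFm : ∀ p ∈ S, MemLp (F p) 2 := fun p hp => by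
    rw [hF]; exact (WW_int (h.hφ p hp)).const_mul _
  have hsq := sq_norm_sum S F hFm
  have e1 : ∀ p q, ‖∫ x, F p x * starRingEnd ℂ (F q x)‖ = 2 ^ p.2.1 * 2 ^ q.2.1 * (‖α p‖ * ‖α q‖) * ip φ p q := by
    intro p q
    have : ∀ x, F p x * starRingEnd ℂ (F q x) = ((2 ^ p.2.1 * (starRingEnd ℂ) (α p)) * (2 ^ q.2.1 * α q)) * (φ p x * starRingEnd ℂ (φ q x)) := by
      intro x; simp only [hF, map_mul, map_pow, Complex.conj_ofNat, Complex.conj_conj]; ring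
    simp_rw [this]
    rw [integral_const_mul]
    simp only [norm_mul, norm_pow, RCLike.norm_conj, Complex.norm_ofNat, ip]
    ring
  simp only [e1] at hsq
  have hG : MemLp (fun x => ∑ p ∈ S, F p x) 2 := memLp_finsetSum S hFm
  have hb := norm_bilin_le hf2 hG
  have e2 : ∫ x, f x * ∑ p ∈ S, F p x = ((∑ p ∈ S, 2 ^ p.2.1 * ‖α p‖ ^ 2 : ℝ) : ℂ) := by
    simp_rw [Finset.mul_sum]
    rw [integral_finsetSum]
    · push_cast
      refine Finset.sum_congr rfl fun p hp => ?_
      have : ∀ x, f x * F p x = (2 ^ p.2.1 * (starRingEnd ℂ) (α p)) * (f x * φ p x) := by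
        intro x; simp only [hF]; ring
      simp_rw [this]
      rw [integral_const_mul, ea, mul_assoc, Complex.conj_mul']
    · intro p hp
      have i := int_mul_bdd hf (h.hφ p hp).1.continuous (fun y => ((h.hφ p hp).2 y).trans (kd_le_one _ _ _))
      have := i.const_mul (2 ^ p.2.1 * (starRingEnd ℂ) (α p))
      refine this.congr (Filter.Eventually.of_forall fun x => ?_)
      simp only [hF]; ring
  rw [e2, Complex.norm_real, Real.norm_of_nonneg (Finset.sum_nonneg fun p _ => by positivity)] at hb
  refine hb.trans ?_
  gcongr
  exact hsq.trans hd

theorem energy_orth {f : ℝ → ℂ} (hf : Integrable f) (hf2 : MemLp f 2) (S : Finset (ℕ × (ℕ × ℤ))) (Sidx : Finset ℕ)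
    (J : ℕ → ℕ × ℤ) (xi : ℕ → ℝ) {ε : ℝ}
    (hi : ∀ p ∈ S, p.1 ∈ Sidx) (h0 : ∀ p ∈ S, Sub p.2 (J p.1))
    (h1 : ∀ p ∈ S, ∀ q ∈ S, q.1 < p.1 → Sub p.2 (J q.1) → 64 < |xi p.1 - xi q.1| * 2 ^ p.2.1)
    (h2 : ∀ p ∈ S, ∀ q ∈ S, p.1 < q.1 → xi p.1 ≤ xi q.1)
    (hc : ∀ p ∈ S, cc f p.2.1 p.2.2 (xi p.1) ≤ ε)
    (hlow : ε ^ 2 / 4 * ∑ i ∈ Sidx, 2 ^ (J i).1 ≤ ∑ p ∈ S, 2 ^ p.2.1 * cc f p.2.1 p.2.2 (xi p.1) ^ 2) :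
    ε ^ 2 * ∑ i ∈ Sidx, 2 ^ (J i).1 ≤ 2 ^ 31 * ∫ x, ‖f x‖ ^ 2 := by
  classical
  choose φ hφ hn using fun p : ℕ × (ℕ × ℤ) => exists_near f p.2.1 p.2.2 (xi p.1)
  have hO : Orth S J xi φ := ⟨fun p _ => hφ p, h0, h1, h2⟩
  obtain ⟨D, hD⟩ : ∃ D, D = ε ^ 2 * ∑ i ∈ Sidx, (2:ℝ) ^ (J i).1 := ⟨_, rfl⟩
  obtain ⟨b, hb⟩ : ∃ b : ℕ × (ℕ × ℤ) → ℝ, b = fun p => 2 ^ p.2.1 * ‖∫ y, f y * φ p y‖ ^ 2 := ⟨_, rfl⟩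
  have hDB : D ≤ 16 * ∑ p ∈ S, b p := by
    have : ∑ p ∈ S, 2 ^ p.2.1 * cc f p.2.1 p.2.2 (xi p.1) ^ 2 ≤ ∑ p ∈ S, 4 * b p := by
      refine Finset.sum_le_sum fun p hp => ?_
      have c0 := cc_nonneg f p.2.1 p.2.2 (xi p.1)
      have c1 := hn p
      calc _ ≤ 2 ^ p.2.1 * (2 * ‖∫ y, f y * φ p y‖) ^ 2 := by gcongr
        _ = _ := by rw [hb]; ring
    rw [← Finset.mul_sum] at this
    rw [hD]; linarith
  have hpart : ∀ r ∈ Finset.range 6, ∑ p ∈ S with p.2.1 % 6 = r, b p ≤ 2 ^ 23 * (∫ x, ‖f x‖ ^ 2) +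
      2⁻¹ ^ 25 * (512 * ∑ p ∈ S with p.2.1 % 6 = r, b p + 2 ^ 17 * D) := by
    intro r _
    have := (hO.mono (Finset.filter_subset (fun p => p.2.1 % 6 = r) S)).part (Sidx := Sidx) (ε := ε) (f := f) ?_ ?_ hf hf2 ?_
    · rw [← hD] at this; simp only [hb]; exact this
    · intro p hp q hq hlt
      have e1 := (Finset.mem_filter.1 hp).2
      have e2 := (Finset.mem_filter.1 hq).2
      omega
    · intro p hp; exact hi p (Finset.mem_filter.1 hp).1
    · intro p hp; exact (le_cc hf (hφ p)).trans (hc p (Finset.mem_filter.1 hp).1)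
  have hs := Finset.sum_le_sum hpart
  have hmaps : ∀ p ∈ S, p.2.1 % 6 ∈ Finset.range 6 := fun p _ => Finset.mem_range.2 (Nat.mod_lt _ (by norm_num))
  rw [Finset.sum_fiberwise_of_maps_to hmaps, Finset.sum_add_distrib, ← Finset.mul_sum, ← Finset.mul_sum, Finset.sum_add_distrib, ← Finset.mul_sum,
    Finset.sum_fiberwise_of_maps_to hmaps] at hs
  simp only [Finset.sum_const, Finset.card_range, nsmul_eq_mul] at hs
  have hB : 0 ≤ ∑ p ∈ S, b p := Finset.sum_nonneg fun p _ => by rw [hb]; positivity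
  have hf0 : 0 ≤ ∫ x, ‖f x‖ ^ 2 := integral_nonneg fun x => by positivity
  rw [← hD]
  norm_num at hs ⊢
  linarith
end Carl

namespace Carl
open Complex (I)

lemma Dat.Lsum_split (d : Dat) {P Q : Finset Tile} (hQ : Q ⊆ P) (x : ℝ) :
    d.Lsum P x = d.Lsum (P \ Q) x + d.Lsum Q x := by
  classical
  unfold Dat.Lsum
  rw [← Finset.sum_union]
  · congr 1
    ext s
    simp only [Finset.mem_union, mem_Sx, Finset.mem_sdiff]
    constructor
    · intro h
      by_cases hq : d.tl x s ∈ Q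
      · exact Or.inr (by tauto)
      · exact Or.inl (by tauto)
    · rintro (h | h)
      · tauto
      · have := @hQ (d.tl x s); tauto
  · rw [Finset.disjoint_left]
    intro s h1 h2
    simp only [mem_Sx, Finset.mem_sdiff] at h1 h2
    tauto

noncomputable def Dat.Lop (d : Dat) (P : Finset Tile) : ℝ≥0∞ := ∫⁻ x in d.G, ‖d.Lsum P x‖ₑ

lemma Dat.Lop_split (d : Dat) {P Q : Finset Tile} (hQ : Q ⊆ P) : d.Lop P ≤ d.Lop (P \ Q) + d.Lop Q := by
  unfold Dat.Lop
  rw [← lintegral_add_left (measurable_Lsum d _).enorm]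
  refine lintegral_mono fun x => ?_
  rw [d.Lsum_split hQ x]
  exact enorm_add_le _ _

lemma DD_sub (w : ℝ) (J : ℕ × ℤ) (xi : ℝ) (P : Finset Tile) : DD w J xi P ⊆ P := fun p hp => ((mem_DD _ _ _ _ _).1 hp).1

/-- prepend to a sequence -/
def consN {α : Type*} (a : α) (f : ℕ → α) : ℕ → α
  | 0 => a
  | n + 1 => f n

lemma consN_zero {α : Type*} (a : α) (f : ℕ → α) : consN a f 0 = a := rfl
lemma consN_succ {α : Type*} (a : α) (f : ℕ → α) (n : ℕ) : consN a f (n + 1) = f n := rfl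

lemma Dat.sel (d : Dat) {ε : ℝ} : ∀ (n : ℕ) (P : Finset Tile), P.card ≤ n → ∃ (K : ℕ) (Pn : ℕ → Finset Tile) (J : ℕ → ℕ × ℤ) (xi : ℕ → ℝ),
    Pn 0 = P ∧ (∀ i < K, (J i, xi i) ∈ d.U ∧ (ε / 2) ^ 2 * 2 ^ (J i).1 < d.es (Pn i) (J i) (xi i) ∧
      (∀ J' xi', (J', xi') ∈ d.U → (ε / 2) ^ 2 * 2 ^ J'.1 < d.es (Pn i) J' xi' → xi i ≤ xi') ∧
      Pn (i + 1) = Pn i \ DD 64 (J i) (xi i) (Pn i)) ∧ d.En (Pn K) (ε / 2) := by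
  classical
  intro n
  induction n with
  | zero =>
    intro P hP
    have hP0 : P = ∅ := Finset.card_eq_zero.1 (Nat.le_zero.1 hP)
    refine ⟨0, fun _ => P, fun _ => (0, 0), fun _ => 0, rfl, fun i hi => absurd hi (Nat.not_lt_zero _), ?_⟩
    intro J xi _
    unfold Dat.es
    rw [Finset.sum_eq_zero]
    · positivity
    · intro I hI; subst hP0; simp at hI
  | succ n ih =>
    intro P hP
    by_cases hE : d.En P (ε / 2)
    · exact ⟨0, fun _ => P, fun _ => (0, 0), fun _ => 0, rfl, fun i hi => absurd hi (Nat.not_lt_zero _), hE⟩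
    · have hne : (d.U.filter (fun q => (ε / 2) ^ 2 * 2 ^ q.1.1 < d.es P q.1 q.2)).Nonempty := by
        unfold Dat.En at hE
        push Not at hE
        obtain ⟨J, xi, h1, h2⟩ := hE
        exact ⟨(J, xi), Finset.mem_filter.2 ⟨h1, h2⟩⟩
      obtain ⟨⟨J0, xi0⟩, hm, hmin⟩ := Finset.exists_min_image _ (fun q : Tile => q.2) hne
      obtain ⟨hmU, hmv⟩ := Finset.mem_filter.1 hm
      have hlt : (P \ DD 64 J0 xi0 P).card < P.card := by
        apply Finset.card_lt_card
        refine ⟨Finset.sdiff_subset, fun hsub => ?_⟩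
        have hz : d.es P J0 xi0 = 0 := by
          unfold Dat.es
          refine Finset.sum_eq_zero fun I hI => ?_
          exfalso
          obtain ⟨_, h3, h4⟩ := Finset.mem_filter.1 hI
          have h5 := hsub h4
          rw [Finset.mem_sdiff] at h5
          refine h5.2 ((mem_DD _ _ _ _ _).2 ⟨h4, h3, ?_⟩)
          simp
        have : 0 ≤ (ε / 2) ^ 2 * (2:ℝ) ^ J0.1 := by positivity
        simp only at hmv
        linarith
      obtain ⟨K, Pn, J, xi, e0, h, hEn⟩ := ih (P \ DD 64 J0 xi0 P) (by omega)
      refine ⟨K + 1, consN P Pn, consN J0 J, consN xi0 xi, consN_zero _ _, ?_, ?_⟩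
      · intro i hi
        cases i with
        | zero =>
          simp only [consN_zero, consN_succ]
          refine ⟨hmU, hmv, ?_, ?_⟩
          · intro J' xi' hU hv
            exact hmin (J', xi') (Finset.mem_filter.2 ⟨hU, hv⟩)
          · rw [e0]
        | succ i =>
          simp only [consN_succ]
          exact h i (by omega)
      · rw [consN_succ]; exact hEn

lemma Dat.energy_step (d : Dat) {P : Finset Tile} (hP : P ⊆ d.U) (hUP : d.UP P) {ε μ : ℝ} (hε : 0 < ε) (hμ : 0 ≤ μ)
    (hEn : d.En P ε) (hD : d.Dens P 64 μ) :
    ∃ P' ⊆ P, d.UP P' ∧ d.En P' (ε / 2) ∧ d.Lop P ≤ d.Lop P' + ENNReal.ofReal (2 ^ 244 * μ / ε * ∫ x, ‖d.f x‖ ^ 2) := by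
  classical
  obtain ⟨K, Pn, J, xi, e0, h, hEnK⟩ := d.sel (ε := ε) P.card P le_rfl
  have hanti : ∀ i j, i ≤ j → j ≤ K → Pn j ⊆ Pn i := by
    intro i j hij
    induction j, hij using Nat.le_induction with
    | base => exact fun _ => subset_rfl
    | succ j hij ih =>
      intro hj
      rw [(h j (by omega)).2.2.2]
      exact Finset.sdiff_subset.trans (ih (by omega))
  have hsub : ∀ i ≤ K, Pn i ⊆ P := fun i hi => by have := hanti 0 i (Nat.zero_le _) hi; rwa [e0] at this
  have hup : ∀ i ≤ K, d.UP (Pn i) := by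
    intro i
    induction i with
    | zero => intro _; rwa [e0]
    | succ i ih =>
      intro hi
      rw [(h i (by omega)).2.2.2]
      exact d.UP_sdiff (ih (by omega)) (by norm_num) _ _
  have hcost : ∀ i ≤ K, d.Lop P ≤ d.Lop (Pn i) + ∑ k ∈ Finset.range i, ENNReal.ofReal (2 ^ 210 * (1 + (6:ℕ)) * ε * μ * 2 ^ (J k).1) := by
    intro i
    induction i with
    | zero => intro _; rw [e0]; simp
    | succ i ih =>
      intro hi
      refine (ih (by omega)).trans ?_
      rw [Finset.sum_range_succ, add_comm (∑ k ∈ Finset.range i, _), ← add_assoc]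
      gcongr
      rw [(h i (by omega)).2.2.2]
      refine (d.Lop_split (DD_sub 64 (J i) (xi i) (Pn i))).trans ?_
      gcongr
      have e64 : (64:ℝ) = 2 ^ 6 := by norm_num
      have t := tree_lemma d ((hsub i (by omega)).trans hP) (hup i (by omega)) hε.le (hEn.mono (hsub i (by omega))) 6 hμ
        (J := J i) (xi := xi i) (by rw [← e64]; exact hD.mono (hsub i (by omega))) (h i (by omega)).1
      rw [e64]
      exact t
  refine ⟨Pn K, hsub K le_rfl, hup K le_rfl, hEnK, (hcost K le_rfl).trans ?_⟩
  gcongr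
  rw [← ENNReal.ofReal_sum_of_nonneg (fun k _ => by positivity)]
  refine ENNReal.ofReal_le_ofReal ?_
  rw [← Finset.mul_sum]
  -- orthogonality
  have hO : ε ^ 2 * ∑ i ∈ Finset.range K, (2:ℝ) ^ (J i).1 ≤ 2 ^ 31 * ∫ x, ‖d.f x‖ ^ 2 := by
    obtain ⟨S, hS⟩ : ∃ S : Finset (ℕ × (ℕ × ℤ)), S = (Finset.range K ×ˢ d.V).filter (fun p => Sub p.2 (J p.1) ∧ (p.2, xi p.1) ∈ Pn p.1) := ⟨_, rfl⟩
    have mS : ∀ p, p ∈ S ↔ (p.1 < K ∧ p.2 ∈ d.V) ∧ Sub p.2 (J p.1) ∧ (p.2, xi p.1) ∈ Pn p.1 := by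
      intro p; rw [hS]; simp [Finset.mem_filter, Finset.mem_product]
    refine energy_orth d.hf d.hf2 S (Finset.range K) J xi ?_ ?_ ?_ ?_ ?_ ?_
    · intro p hp; exact Finset.mem_range.2 ((mS p).1 hp).1.1
    · intro p hp; exact ((mS p).1 hp).2.1
    · intro p hp q hq hlt hs
      obtain ⟨⟨a, b⟩, c, e⟩ := (mS p).1 hp
      have h3 := hanti (q.1 + 1) p.1 hlt a.le e
      rw [(h q.1 (by omega)).2.2.2, Finset.mem_sdiff, mem_DD] at h3
      by_contra hcon
      push Not at hcon
      exact h3.2 ⟨h3.1, hs, hcon⟩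
    · intro p hp q hq hlt
      obtain ⟨⟨a, b⟩, c, e⟩ := (mS p).1 hp
      obtain ⟨⟨a', b'⟩, c', e'⟩ := (mS q).1 hq
      have hv := (h q.1 a').2.1
      have hm := d.es_mono (hanti p.1 q.1 hlt.le a'.le) (J q.1) (xi q.1)
      exact (h p.1 a).2.2.1 _ _ (h q.1 a').1 (hv.trans_le hm)
    · intro p hp
      obtain ⟨⟨a, b⟩, c, e⟩ := (mS p).1 hp
      exact Dat.En.cc_le hε.le hEn hP (hsub p.1 a.le e)
    · have e1 : ∑ p ∈ S, 2 ^ p.2.1 * cc d.f p.2.1 p.2.2 (xi p.1) ^ 2 = ∑ i ∈ Finset.range K, d.es (Pn i) (J i) (xi i) := by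
        rw [hS, Finset.sum_filter, Finset.sum_product]
        refine Finset.sum_congr rfl fun i _ => ?_
        unfold Dat.es
        rw [Finset.sum_filter]
      rw [e1, Finset.mul_sum]
      refine Finset.sum_le_sum fun i hi => ?_
      have := (h i (Finset.mem_range.1 hi)).2.1
      have e2 : (ε / 2) ^ 2 = ε ^ 2 / 4 := by ring
      rw [e2] at this
      exact this.le
  have hO2 : ∑ i ∈ Finset.range K, (2:ℝ) ^ (J i).1 ≤ (2 ^ 31 * ∫ x, ‖d.f x‖ ^ 2) / ε ^ 2 := by
    rw [le_div_iff₀ (by positivity)]; linarith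
  have hf0 : 0 ≤ ∫ x, ‖d.f x‖ ^ 2 := integral_nonneg fun x => by positivity
  calc _ ≤ 2 ^ 210 * (1 + (6:ℕ)) * ε * μ * ((2 ^ 31 * ∫ x, ‖d.f x‖ ^ 2) / ε ^ 2) := by gcongr
    _ = (2 ^ 210 * 7 * 2 ^ 31) * (μ / ε * ∫ x, ‖d.f x‖ ^ 2) := by field_simp; norm_num; ring
    _ ≤ 2 ^ 244 * (μ / ε * ∫ x, ‖d.f x‖ ^ 2) := by gcongr; norm_num
    _ = _ := by ring
end Carl

namespace Carl
open Complex (I)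

lemma Dat.remove_trees (d : Dat) {P : Finset Tile} (hP : P ⊆ d.U) (hUP : d.UP P) {ε μ : ℝ} (hε : 0 ≤ ε) (hμ : 0 ≤ μ)
    (hEn : d.En P ε) {i : ℕ} (hi : 1 ≤ i) (hD : d.Dens P (2 ^ i) μ) (u : Finset Tile) (hu : u ⊆ d.U) :
    ∃ P' ⊆ P, d.UP P' ∧ (∀ p ∈ P', ∀ b ∈ u, ¬ inD (2 ^ i) b.1 b.2 p) ∧
      d.Lop P ≤ d.Lop P' + ∑ b ∈ u, ENNReal.ofReal (2 ^ 210 * (1 + i) * ε * μ * 2 ^ b.1.1) := by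
  classical
  induction u using Finset.induction_on with
  | empty => exact ⟨P, subset_rfl, hUP, by simp, by simp⟩
  | insert b u hb ih =>
    obtain ⟨P1, h1, h2, h3, h4⟩ := ih ((Finset.subset_insert _ _).trans hu)
    refine ⟨P1 \ DD (2 ^ i) b.1 b.2 P1, Finset.sdiff_subset.trans h1, d.UP_sdiff h2 ?_ _ _, ?_, ?_⟩
    · calc (2:ℝ) = 2 ^ 1 := by norm_num
        _ ≤ 2 ^ i := pow_le_pow_right₀ (by norm_num) hi
    · intro p hp b' hb'
      rw [Finset.mem_sdiff, mem_DD] at hp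
      rcases Finset.mem_insert.1 hb' with rfl | hb'
      · exact fun h => hp.2 ⟨hp.1, h⟩
      · exact h3 p hp.1 b' hb'
    · rw [Finset.sum_insert hb, ← add_assoc]
      refine h4.trans ?_
      gcongr
      refine (d.Lop_split (DD_sub (2 ^ i) b.1 b.2 P1)).trans ?_
      gcongr
      have hbU : (b.1, b.2) ∈ d.U := hu (Finset.mem_insert_self _ _)
      exact tree_lemma d (h1.trans hP) h2 hε (hEn.mono h1) i hμ (hD.mono h1) hbU

lemma Dat.Ew_meas (d : Dat) (w : ℝ) (J : ℕ × ℤ) (xi : ℝ) : MeasurableSet (d.Ew w J xi) := by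
  have h1 := d.hG
  have h2 := In_meas J.1 J.2
  have h3 : MeasurableSet {x | |d.N x - xi| * 2 ^ J.1 ≤ w} := by
    have := d.hN
    exact measurableSet_le (by fun_prop) measurable_const
  exact h1.inter (h2.inter h3)

lemma Dat.Ew_vol (d : Dat) (w : ℝ) (J : ℕ × ℤ) (xi : ℝ) : volume (d.Ew w J xi) ≤ ENNReal.ofReal (2 ^ J.1) := by
  refine (measure_mono (fun x hx => hx.2.1 : d.Ew w J xi ⊆ In J.1 J.2)).trans ?_
  rw [In_vol, ENNReal.ofReal_pow (by norm_num)]; norm_num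

lemma Dat.mass_one (d : Dat) {P : Finset Tile} (hP : P ⊆ d.U) (hUP : d.UP P) {ε m : ℝ} (hε : 0 ≤ ε) (hm : 0 < m)
    (hEn : d.En P ε) (i : ℕ) (hD : d.Dens P (2 ^ (i + 2)) (2 ^ (i + 2) * m)) :
    ∃ P' ⊆ P, d.UP P' ∧ d.Dens P' (2 ^ i) (2 ^ i * (m / 4)) ∧
      d.Lop P ≤ d.Lop P' + ENNReal.ofReal (2 ^ 214 * (i + 3) * ε * (volume d.G).toReal) := by
  classical
  obtain ⟨H, hH⟩ : ∃ H : Set Tile, H = {q | q ∈ d.U ∧ ENNReal.ofReal (2 ^ i * (m / 4) * 2 ^ q.1.1) < volume (d.Ew (2 ^ i) q.1 q.2)} := ⟨_, rfl⟩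
  have hHne : ∀ q ∈ H, (d.Ew (2 ^ i) q.1 q.2).Nonempty := by
    intro q hq
    rw [hH] at hq
    by_contra hcon
    rw [Set.not_nonempty_iff_eq_empty] at hcon
    have := hq.2
    rw [hcon] at this
    simp at this
  obtain ⟨u, huH, hdisj, hcov⟩ := Vitali.exists_disjoint_subfamily_covering_enlargement (fun q : Tile => d.Ew (2 ^ i) q.1 q.2) H
    (fun q => (2:ℝ) ^ q.1.1) (3 / 2) (by norm_num) (fun q _ => by positivity) (2 ^ d.S)
    (fun q hq => by
      rw [hH] at hq
      have := ((d.mem_V _ _).1 ((d.mem_U _ _).1 hq.1).1).1.2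
      exact pow_le_pow_right₀ (by norm_num) this.le) hHne
  have huU : u ⊆ d.U := fun q hq => by have := huH hq; rw [hH] at this; exact this.1
  have hufin : u.Finite := (Finset.finite_toSet d.U).subset huU
  obtain ⟨P', h1, h2, h3, h4⟩ := d.remove_trees hP hUP hε (by positivity) hEn (i := i + 2) (by omega) hD hufin.toFinset
    (fun q hq => huU (hufin.mem_toFinset.1 hq))
  refine ⟨P', h1, h2, ?_, h4.trans ?_⟩
  · intro p hp J xi hs hU hx
    by_contra hcon
    push Not at hcon
    have hmem : ((J, xi) : Tile) ∈ H := by rw [hH]; exact ⟨hU, hcon⟩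
    obtain ⟨b, hb, ⟨x, hxa, hxb⟩, hle⟩ := hcov _ hmem
    refine h3 p hp b (hufin.mem_toFinset.2 hb) ?_
    have hJb : J.1 ≤ b.1.1 := by
      by_contra hlt
      push Not at hlt
      have : (2:ℝ) ^ (b.1.1 + 1) ≤ 2 ^ J.1 := pow_le_pow_right₀ (by norm_num) hlt
      rw [pow_succ] at this
      have hpos : (0:ℝ) < 2 ^ b.1.1 := by positivity
      simp only at hle
      linarith
    have hsb : Sub J b.1 := ⟨hJb, In_subset hJb hxa.2.1 hxb.2.1⟩
    refine ⟨hs.trans hsb, ?_⟩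
    have hpJ : p.1.1 ≤ J.1 := hs.1
    have a1 : |d.N x - xi| * 2 ^ J.1 ≤ 2 ^ i := hxa.2.2
    have a2 : |d.N x - b.2| * 2 ^ b.1.1 ≤ 2 ^ i := hxb.2.2
    have q1 : (2:ℝ) ^ p.1.1 ≤ 2 ^ J.1 := pow_le_pow_right₀ (by norm_num) hpJ
    have q2 : (2:ℝ) ^ p.1.1 ≤ 2 ^ b.1.1 := pow_le_pow_right₀ (by norm_num) (hpJ.trans hJb)
    have b1 : |d.N x - xi| * 2 ^ p.1.1 ≤ 2 ^ i := le_trans (by gcongr) a1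
    have b2 : |d.N x - b.2| * 2 ^ p.1.1 ≤ 2 ^ i := le_trans (by gcongr) a2
    have tri : |p.2 - b.2| ≤ |xi - p.2| + |d.N x - xi| + |d.N x - b.2| := by
      rw [abs_sub_comm xi p.2, abs_sub_comm (d.N x) xi]
      calc |p.2 - b.2| = |(p.2 - xi) + (xi - d.N x) + (d.N x - b.2)| := by congr 1; ring
        _ ≤ _ := abs_add_three _ _ _
    calc |p.2 - b.2| * 2 ^ p.1.1 ≤ (|xi - p.2| + |d.N x - xi| + |d.N x - b.2|) * 2 ^ p.1.1 := by gcongr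
      _ ≤ 3 * 2 ^ i := by linarith
      _ ≤ 2 ^ (i + 2) := by rw [pow_add]; have : (0:ℝ) < 2 ^ i := by positivity
                            linarith
  · gcongr
    rw [← ENNReal.ofReal_sum_of_nonneg (fun k _ => by positivity)]
    refine ENNReal.ofReal_le_ofReal ?_
    rw [← Finset.mul_sum]
    have hsum : ∑ b ∈ hufin.toFinset, ENNReal.ofReal (2 ^ i * (m / 4) * 2 ^ b.1.1) ≤ volume d.G := by
      calc _ ≤ ∑ b ∈ hufin.toFinset, volume (d.Ew (2 ^ i) b.1 b.2) := by
            refine Finset.sum_le_sum fun b hb => ?_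
            have := huH (hufin.mem_toFinset.1 hb)
            rw [hH] at this
            exact this.2.le
        _ = volume (⋃ b ∈ hufin.toFinset, d.Ew (2 ^ i) b.1 b.2) := by
            rw [measure_biUnion_finset]
            · intro b hb b' hb' hne
              exact hdisj (hufin.mem_toFinset.1 hb) (hufin.mem_toFinset.1 hb') hne
            · intro b _; exact d.Ew_meas _ _ _
        _ ≤ _ := by
            refine measure_mono ?_
            intro x hx
            simp only [Set.mem_iUnion] at hx
            obtain ⟨b, _, hx⟩ := hx
            exact hx.1
    rw [← ENNReal.ofReal_sum_of_nonneg (fun k _ => by positivity), ENNReal.ofReal_le_iff_le_toReal d.hGfin, ← Finset.mul_sum] at hsum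
    push_cast
    calc 2 ^ 210 * (1 + ((i:ℝ) + 2)) * ε * (2 ^ (i + 2) * m) * ∑ b ∈ hufin.toFinset, (2:ℝ) ^ b.1.1
        = 2 ^ 214 * (i + 3) * ε * (2 ^ i * (m / 4) * ∑ b ∈ hufin.toFinset, (2:ℝ) ^ b.1.1) := by ring
      _ ≤ _ := by gcongr

def Dat.DensAll (d : Dat) (P : Finset Tile) (m : ℝ) : Prop := ∀ i : ℕ, d.Dens P (2 ^ i) (2 ^ i * m)

lemma Dat.DensAll.mono {d : Dat} {P P' : Finset Tile} {m : ℝ} (h : d.DensAll P m) (hP : P' ⊆ P) : d.DensAll P' m :=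
  fun i => (h i).mono hP

lemma Dat.mass_step (d : Dat) {P : Finset Tile} (hP : P ⊆ d.U) (hUP : d.UP P) {ε m : ℝ} (hε : 0 ≤ ε) (hm : 0 < m)
    (hEn : d.En P ε) (hD : d.DensAll P m) (L : ℕ) (hL : 1 ≤ 2 ^ L * (m / 4)) :
    ∃ P' ⊆ P, d.UP P' ∧ d.DensAll P' (m / 4) ∧
      d.Lop P ≤ d.Lop P' + ENNReal.ofReal (2 ^ 214 * (L + 2) ^ 2 * ε * (volume d.G).toReal) := by
  have key : ∀ k ≤ L, ∃ P' ⊆ P, d.UP P' ∧ (∀ i < k, d.Dens P' (2 ^ i) (2 ^ i * (m / 4))) ∧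
      d.Lop P ≤ d.Lop P' + ENNReal.ofReal (2 ^ 214 * (k * (L + 2)) * ε * (volume d.G).toReal) := by
    intro k
    induction k with
    | zero => intro _; exact ⟨P, subset_rfl, hUP, by simp, le_self_add⟩
    | succ k ih =>
      intro hk
      obtain ⟨P1, h1, h2, h3, h4⟩ := ih (by omega)
      obtain ⟨P2, g1, g2, g3, g4⟩ := d.mass_one (h1.trans hP) h2 hε hm (hEn.mono h1) k ((hD (k + 2)).mono h1)
      refine ⟨P2, g1.trans h1, g2, ?_, ?_⟩
      · intro i hi
        rcases Nat.lt_succ_iff_lt_or_eq.1 hi with hi | rfl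
        · exact (h3 i hi).mono g1
        · exact g3
      · refine h4.trans ((add_le_add_left g4 _).trans ?_)
        rw [add_assoc, ← ENNReal.ofReal_add (by positivity) (by positivity)]
        gcongr
        have : (k:ℝ) + 3 ≤ L + 2 := by have : ((k + 1 : ℕ) : ℝ) ≤ L := by exact_mod_cast hk
                                       push_cast at this; linarith
        push_cast
        calc 2 ^ 214 * ((k:ℝ) + 3) * ε * (volume d.G).toReal + 2 ^ 214 * (k * (L + 2)) * ε * (volume d.G).toReal
            ≤ 2 ^ 214 * ((L:ℝ) + 2) * ε * (volume d.G).toReal + 2 ^ 214 * (k * (L + 2)) * ε * (volume d.G).toReal := by gcongr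
          _ = _ := by ring
  obtain ⟨P', h1, h2, h3, h4⟩ := key L le_rfl
  refine ⟨P', h1, h2, ?_, h4.trans ?_⟩
  · intro i
    rcases lt_or_ge i L with hi | hi
    · exact h3 i hi
    · intro p _ J xi _ _ _
      refine (d.Ew_vol _ _ _).trans (ENNReal.ofReal_le_ofReal ?_)
      have : (2:ℝ) ^ L ≤ 2 ^ i := pow_le_pow_right₀ (by norm_num) hi
      have h5 : 1 ≤ 2 ^ i * (m / 4) := hL.trans (by gcongr)
      exact le_mul_of_one_le_left (by positivity) h5
  · gcongr
    have : (0:ℝ) ≤ L := by positivity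
    nlinarith
end Carl

namespace Carl
open Complex (I)

lemma Dat.DensAll_U (d : Dat) (P : Finset Tile) : d.DensAll P 1 := by
  intro i p _ J xi _ _ _
  refine (d.Ew_vol _ _ _).trans (ENNReal.ofReal_le_ofReal ?_)
  have h5 : (1:ℝ) ≤ 2 ^ i * 1 := by rw [mul_one]; exact one_le_pow₀ (by norm_num)
  exact le_mul_of_one_le_left (by positivity) h5

lemma Dat.energy_cost (d : Dat) {e : ℝ} (he : 0 < e) (hf : ∫ x, ‖d.f x‖ ^ 2 ≤ e ^ 2 * (volume d.G).toReal) {μ t : ℝ} (hμ : 0 ≤ μ) (ht : 0 < t) :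
    2 ^ 244 * (2 ^ 6 * μ) / (t * e) * ∫ x, ‖d.f x‖ ^ 2 ≤ 2 ^ 250 * (e * (volume d.G).toReal) * (μ / t) := by
  calc _ ≤ 2 ^ 244 * (2 ^ 6 * μ) / (t * e) * (e ^ 2 * (volume d.G).toReal) := by gcongr
    _ = _ := by field_simp

lemma Dat.phase1 (d : Dat) {e : ℝ} (he : 0 < e) (hf : ∫ x, ‖d.f x‖ ^ 2 ≤ e ^ 2 * (volume d.G).toReal) (n : ℕ) :
    ∀ P ⊆ d.U, d.UP P → d.En P (2 ^ n * e) → ∃ P' ⊆ d.U, d.UP P' ∧ d.En P' e ∧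
      d.Lop P ≤ d.Lop P' + ENNReal.ofReal (2 ^ 250 * (e * (volume d.G).toReal) * (1 - 1 / 2 ^ n)) := by
  induction n with
  | zero =>
    intro P hP hUP hE
    refine ⟨P, hP, hUP, by simpa using hE, by simp⟩
  | succ n ih =>
    intro P hP hUP hE
    have h64 : (64:ℝ) = 2 ^ 6 := by norm_num
    obtain ⟨P1, h1, h2, h3, h4⟩ := d.energy_step hP hUP (ε := 2 ^ (n + 1) * e) (μ := 2 ^ 6 * 1) (by positivity) (by positivity) hE
      (by rw [h64]; exact d.DensAll_U P 6)
    rw [show (2:ℝ) ^ (n + 1) * e / 2 = 2 ^ n * e by ring] at h3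
    obtain ⟨P2, g1, g2, g3, g4⟩ := ih P1 (h1.trans hP) h2 h3
    refine ⟨P2, g1, g2, g3, ?_⟩
    have hn : (1:ℝ) / 2 ^ n ≤ 1 := by rw [div_le_one (by positivity)]; exact one_le_pow₀ (by norm_num)
    refine h4.trans ((add_le_add_left g4 _).trans ?_)
    rw [add_assoc, ← ENNReal.ofReal_add]
    · gcongr
      have := d.energy_cost he hf (μ := 1) (t := 2 ^ (n + 1)) (by norm_num) (by positivity)
      refine (add_le_add_right this _).trans (le_of_eq ?_)
      have : (1:ℝ) / 2 ^ n = 2 * (1 / 2 ^ (n + 1)) := by rw [pow_succ]; field_simp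
      rw [this]; ring
    · have : (0:ℝ) ≤ 1 - 1 / 2 ^ n := by linarith
      positivity
    · have : 0 ≤ ∫ x, ‖d.f x‖ ^ 2 := integral_nonneg fun x => by positivity
      positivity

lemma Dat.start (d : Dat) {e : ℝ} (he : 0 < e) : ∃ n : ℕ, d.En d.U (2 ^ n * e) := by
  classical
  obtain ⟨M, hM⟩ : ∃ M, M = ∑ q ∈ d.U, ∑ I ∈ d.V, (2:ℝ) ^ I.1 * cc d.f I.1 I.2 q.2 ^ 2 := ⟨_, rfl⟩
  obtain ⟨n, hn⟩ := pow_unbounded_of_one_lt (M / e ^ 2) (by norm_num : (1:ℝ) < 2)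
  refine ⟨n, fun J xi hU => ?_⟩
  have h1 : d.es d.U J xi ≤ M := by
    rw [hM]
    refine le_trans ?_ (Finset.single_le_sum (f := fun q : Tile => ∑ I ∈ d.V, (2:ℝ) ^ I.1 * cc d.f I.1 I.2 q.2 ^ 2) (fun q _ => Finset.sum_nonneg fun I _ => by positivity) hU)
    unfold Dat.es
    exact Finset.sum_le_sum_of_subset_of_nonneg (Finset.filter_subset _ _) fun I _ _ => by positivity
  rw [div_lt_iff₀ (by positivity)] at hn
  have p1 : (1:ℝ) ≤ 2 ^ n := one_le_pow₀ (by norm_num)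
  have p2 : (1:ℝ) ≤ 2 ^ J.1 := one_le_pow₀ (by norm_num)
  calc d.es d.U J xi ≤ 2 ^ n * e ^ 2 := h1.trans hn.le
    _ ≤ (2 ^ n * e ^ 2) * (2 ^ n * 2 ^ J.1) := le_mul_of_one_le_right (by positivity) (one_le_mul_of_one_le_of_one_le p1 p2)
    _ = _ := by ring

lemma Dat.leftover (d : Dat) {P : Finset Tile} (hP : P ⊆ d.U) {ε : ℝ} (hε : 0 ≤ ε) (hEn : d.En P ε) :
    d.Lop P ≤ ENNReal.ofReal (d.S * (2 ^ 44 * ε) * (volume d.G).toReal) := by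
  have hb : ∀ x, ‖d.Lsum P x‖ ≤ d.S * (2 ^ 44 * ε) := by
    intro x
    unfold Dat.Lsum
    refine (norm_sum_le _ _).trans ?_
    calc _ ≤ ∑ s ∈ d.Sx P x, 2 ^ 44 * ε := by
          refine Finset.sum_le_sum fun s hs => ?_
          rw [mem_Sx] at hs
          have h1 := lb1 d.hf s (d.N x) x
          have h2 : d.tl x s ∈ P := by tauto
          have h3 := Dat.En.cc_le hε hEn hP h2
          refine h1.trans ?_
          simp only at h3
          linarith
      _ ≤ _ := by
          rw [Finset.sum_const, nsmul_eq_mul]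
          gcongr
          unfold Dat.Sx
          refine (Finset.card_filter_le _ _).trans ?_
          simp
  unfold Dat.Lop
  calc _ ≤ ∫⁻ x in d.G, ENNReal.ofReal (d.S * (2 ^ 44 * ε)) := by
        refine lintegral_mono fun x => ?_
        rw [← ofReal_norm]
        exact ENNReal.ofReal_le_ofReal (hb x)
    _ = _ := by
        rw [setLIntegral_const, ENNReal.ofReal_mul (p := d.S * (2 ^ 44 * ε)) (by positivity), ENNReal.ofReal_toReal d.hGfin]

lemma phase2_hT (n : ℕ) : (0:ℝ) ≤ 90 - (8 * n ^ 2 + 48 * n + 90) / 2 ^ n := by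
  rw [sub_nonneg, div_le_iff₀ (by positivity)]
  induction n with
  | zero => norm_num
  | succ k ih => rw [pow_succ (2:ℝ)]; push_cast; nlinarith [(Nat.cast_nonneg k : (0:ℝ) ≤ k)]

lemma phase2_key (n : ℕ) : (1:ℝ) / 2 ^ n + (2 * n + 4) ^ 2 / 2 ^ n + (90 - (8 * n ^ 2 + 48 * n + 90) / 2 ^ n) ≤ 90 - (8 * ((n + 1 : ℕ) : ℝ) ^ 2 + 48 * ((n + 1 : ℕ) : ℝ) + 90) / 2 ^ (n + 1) := by
  refine le_of_eq ?_
  push_cast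
  rw [pow_succ]
  field_simp
  ring

lemma phase2_e4 (n : ℕ) {e v : ℝ} (he : 0 < e) (hv : 0 ≤ v) :
    2 ^ 214 * (((2 * n + 2 : ℕ) : ℝ) + 2) ^ 2 * (e / 2 ^ n) * v ≤ 2 ^ 250 * (e * v) * ((2 * n + 4) ^ 2 / 2 ^ n) := by
  have h : (2:ℝ) ^ 214 ≤ 2 ^ 250 := pow_le_pow_right₀ (by norm_num) (by norm_num)
  push_cast
  calc _ = 2 ^ 214 * ((e * v) * ((2 * (n:ℝ) + 4) ^ 2 / 2 ^ n)) := by ring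
    _ ≤ 2 ^ 250 * ((e * v) * ((2 * (n:ℝ) + 4) ^ 2 / 2 ^ n)) := mul_le_mul_of_nonneg_right h (by positivity)
    _ = _ := by ring

lemma ofReal_add3 {a b c D A B C : ℝ} {L : ℝ≥0∞} (ha : a ≤ A) (hb : b ≤ B) (hc : c ≤ C) (hA : 0 ≤ A) (hB : 0 ≤ B) (hC : 0 ≤ C) (h : A + B + C ≤ D) :
    L + ENNReal.ofReal a + ENNReal.ofReal b + ENNReal.ofReal c ≤ L + ENNReal.ofReal D := by
  calc _ ≤ L + ENNReal.ofReal A + ENNReal.ofReal B + ENNReal.ofReal C := by gcongr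
    _ = L + ENNReal.ofReal (A + B + C) := by
      rw [ENNReal.ofReal_add (by positivity) hC, ENNReal.ofReal_add hA hB]; ring
    _ ≤ _ := by gcongr

lemma Dat.phase2 (d : Dat) {e : ℝ} (he : 0 < e) (hf : ∫ x, ‖d.f x‖ ^ 2 ≤ e ^ 2 * (volume d.G).toReal)
    {P : Finset Tile} (hP : P ⊆ d.U) (hUP : d.UP P) (hEn : d.En P e) (n : ℕ) :
    ∃ P' ⊆ d.U, d.UP P' ∧ d.En P' (e / 2 ^ n) ∧ d.DensAll P' (1 / 4 ^ n) ∧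
      d.Lop P ≤ d.Lop P' + ENNReal.ofReal (2 ^ 250 * (e * (volume d.G).toReal) * (90 - (8 * n ^ 2 + 48 * n + 90) / 2 ^ n)) := by
  induction n with
  | zero => exact ⟨P, hP, hUP, by simpa using hEn, by simpa using d.DensAll_U P, by simp⟩
  | succ n ih =>
    obtain ⟨P1, h1, h2, h3, h4, h5⟩ := ih
    have h64 : (64:ℝ) = 2 ^ 6 := by norm_num
    have e1 : (2:ℝ) ^ (2 * n + 2) * (1 / 4 ^ n / 4) = 1 := by
      rw [pow_add, pow_mul]; norm_num; field_simp
    obtain ⟨P2, a1, a2, a3, a4⟩ := d.mass_step h1 h2 (ε := e / 2 ^ n) (m := 1 / 4 ^ n) (by positivity) (by positivity) h3 h4 (2 * n + 2) e1.ge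
    obtain ⟨P3, b1, b2, b3, b4⟩ := d.energy_step (a1.trans h1) a2 (ε := e / 2 ^ n) (μ := 2 ^ 6 * (1 / 4 ^ n)) (by positivity) (by positivity) (h3.mono a1)
      (by rw [h64]; exact (h4 6).mono a1)
    refine ⟨P3, b1.trans (a1.trans h1), b2, ?_, ?_, ?_⟩
    · rw [show e / 2 ^ (n + 1) = e / 2 ^ n / 2 by rw [pow_succ]; field_simp]; exact b3
    · rw [show (1:ℝ) / 4 ^ (n + 1) = 1 / 4 ^ n / 4 by rw [pow_succ]; field_simp]; exact a3.mono b1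
    · refine h5.trans ((add_le_add_left (a4.trans (add_le_add_left b4 _)) _).trans ?_)
      have hc := d.energy_cost he hf (μ := 1 / 4 ^ n) (t := 1 / 2 ^ n) (by positivity) (by positivity)
      have hg0 : 0 ≤ (volume d.G).toReal := ENNReal.toReal_nonneg
      have e2 : (1:ℝ) / 4 ^ n / (1 / 2 ^ n) = 1 / 2 ^ n := by
        rw [show (4:ℝ) = 2 * 2 by norm_num, mul_pow]; field_simp
      rw [e2] at hc
      have e3 : (1:ℝ) / 2 ^ n * e = e / 2 ^ n := by ring
      rw [e3] at hc
      have e4 := phase2_e4 n he hg0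
      obtain ⟨X, hX⟩ : ∃ X, X = 2 ^ 250 * (e * (volume d.G).toReal) := ⟨_, rfl⟩
      have hX0 : 0 ≤ X := by rw [hX]; exact mul_nonneg (pow_nonneg zero_le_two 250) (mul_nonneg he.le hg0)
      rw [← hX] at hc e4 ⊢
      refine ofReal_add3 hc e4 le_rfl (mul_nonneg hX0 (by positivity)) (mul_nonneg hX0 (by positivity)) (mul_nonneg hX0 (phase2_hT n)) ?_
      have := mul_le_mul_of_nonneg_left (phase2_key n) hX0
      rw [mul_add, mul_add] at this
      exact this

/-- the discrete Carleson theorem -/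
theorem Dat.discrete (d : Dat) {e : ℝ} (he : 0 < e) (hf : ∫ x, ‖d.f x‖ ^ 2 ≤ e ^ 2 * (volume d.G).toReal) :
    d.Lop d.U ≤ ENNReal.ofReal (2 ^ 258 * (e * (volume d.G).toReal)) := by
  obtain ⟨n0, hn0⟩ := d.start he
  obtain ⟨P1, h1, h2, h3, h4⟩ := d.phase1 he hf n0 d.U subset_rfl d.UP_U hn0
  obtain ⟨n, hn⟩ := pow_unbounded_of_one_lt (d.S : ℝ) (by norm_num : (1:ℝ) < 2)
  obtain ⟨P2, g1, g2, g3, _, g5⟩ := d.phase2 he hf h1 h2 h3 n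
  have hl := d.leftover g1 (by positivity) g3
  have hg0 : 0 ≤ (volume d.G).toReal := ENNReal.toReal_nonneg
  obtain ⟨Y, hY⟩ : ∃ Y, Y = e * (volume d.G).toReal := ⟨_, rfl⟩
  have hY0 : 0 ≤ Y := by rw [hY]; positivity
  have hl2 : d.Lop P2 ≤ ENNReal.ofReal (2 ^ 44 * Y) := by
    refine hl.trans (ENNReal.ofReal_le_ofReal ?_)
    have : (d.S : ℝ) / 2 ^ n ≤ 1 := by rw [div_le_one (by positivity)]; exact hn.le
    calc _ = (d.S / 2 ^ n) * (2 ^ 44 * Y) := by rw [hY]; ring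
      _ ≤ 1 * (2 ^ 44 * Y) := by gcongr
      _ = _ := one_mul _
  rw [← hY] at h4 g5 ⊢
  have h4' : ENNReal.ofReal (2 ^ 250 * Y * (1 - 1 / 2 ^ n0)) ≤ ENNReal.ofReal (2 ^ 250 * Y) := by
    refine ENNReal.ofReal_le_ofReal (mul_le_of_le_one_right (by positivity) ?_)
    have : (0:ℝ) ≤ 1 / 2 ^ n0 := by positivity
    linarith
  have g5' : ENNReal.ofReal (2 ^ 250 * Y * (90 - (8 * n ^ 2 + 48 * n + 90) / 2 ^ n)) ≤ ENNReal.ofReal (2 ^ 250 * Y * 90) := by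
    refine ENNReal.ofReal_le_ofReal (mul_le_mul_of_nonneg_left ?_ (by positivity))
    have : (0:ℝ) ≤ (8 * n ^ 2 + 48 * n + 90) / 2 ^ n := by positivity
    linarith
  calc d.Lop d.U ≤ ENNReal.ofReal (2 ^ 44 * Y) + ENNReal.ofReal (2 ^ 250 * Y * 90) + ENNReal.ofReal (2 ^ 250 * Y) :=
        h4.trans (add_le_add (g5.trans (add_le_add hl2 g5')) h4')
    _ = ENNReal.ofReal (2 ^ 44 * Y + 2 ^ 250 * Y * 90 + 2 ^ 250 * Y) := by
        rw [ENNReal.ofReal_add (by positivity) (by positivity), ENNReal.ofReal_add (by positivity) (by positivity)]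
    _ ≤ _ := by
        refine ENNReal.ofReal_le_ofReal ?_
        rw [show (2:ℝ) ^ 258 = 2 ^ 214 * 2 ^ 44 by rw [← pow_add], show (2:ℝ) ^ 250 = 2 ^ 206 * 2 ^ 44 by rw [← pow_add]]
        nlinarith
end Carl

namespace Carl
open Complex (I)

lemma one_sub_exp_lower {t : ℝ} (h1 : |t| ≤ 1) : |t| / 2 ≤ ‖1 - Complex.exp (I * t)‖ := by
  have h2 : |t| ≤ π / 2 := by have := Real.pi_gt_three; linarith
  have h3 := Real.mul_abs_le_abs_sin h2
  have h4 : (1:ℝ) / 2 ≤ 2 / π := by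
    rw [div_le_div_iff₀ (by norm_num) Real.pi_pos]; have := Real.pi_le_four; linarith
  have h5 : |Real.sin t| ≤ ‖1 - Complex.exp (I * t)‖ := by
    have := Complex.abs_im_le_norm (1 - Complex.exp (I * t))
    rw [mul_comm I] at this ⊢
    rw [Complex.sub_im, Complex.exp_ofReal_mul_I_im] at this
    simpa using this
  have := abs_nonneg t
  nlinarith

lemma hk_bound {t : ℝ} (h0 : 0 < |t|) (h1 : |t| < 1) : ‖hilbertKernel t - I / t‖ ≤ 4 := by
  have ht : t ≠ 0 := abs_pos.1 h0
  have htc : (t:ℂ) ≠ 0 := by exact_mod_cast ht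
  have hl := one_sub_exp_lower h1.le
  obtain ⟨w, hw⟩ : ∃ w, w = 1 - Complex.exp (I * t) := ⟨_, rfl⟩
  rw [← hw] at hl
  have hwp : 0 < ‖w‖ := by linarith
  have hw0 : w ≠ 0 := norm_pos_iff.1 hwp
  have h2 : ‖(t:ℂ) - I * w‖ ≤ |t| ^ 2 := by
    have := Complex.norm_exp_sub_one_sub_id_le (x := I * t) (by simpa using h1.le)
    have e : (t:ℂ) - I * w = I * (Complex.exp (I * t) - 1 - I * t) := by
      rw [hw]; ring_nf; rw [Complex.I_sq]; ring
    rw [e, norm_mul, Complex.norm_I, one_mul]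
    simpa using this
  unfold hilbertKernel
  rw [if_pos ⟨h0, h1⟩, ← hw]
  have e : (1 - (|t|:ℝ)) / w - I / t = ((t:ℂ) - I * w) / (t * w) - (|t|:ℝ) / w := by field_simp; ring
  rw [e]
  refine (norm_sub_le _ _).trans ?_
  rw [norm_div, norm_div, norm_mul, Complex.norm_real, Complex.norm_real, Real.norm_eq_abs, Real.norm_eq_abs, abs_abs]
  have a1 : ‖(t:ℂ) - I * w‖ / (|t| * ‖w‖) ≤ 2 := by
    rw [div_le_iff₀ (by positivity)]; nlinarith
  have a2 : |t| / ‖w‖ ≤ 2 := by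
    rw [div_le_iff₀ (by positivity)]; linarith
  linarith

lemma sum_ps (a K : ℕ) (h : a ≤ K) {u : ℝ} (hu : u ≠ 0) :
    ∑ s ∈ Finset.Ico a K, ps s u = (gg (u / 2 ^ K) - gg (u / 2 ^ a)) / u := by
  induction K, h using Nat.le_induction with
  | base => simp
  | succ n hn ih =>
    rw [Finset.sum_Ico_succ_top hn, ih]
    unfold ps
    rw [psi_of_ne (by positivity), div_div, ← pow_succ]
    have : (u:ℂ) ≠ 0 := by exact_mod_cast hu
    push_cast
    field_simp
    ring

/-- rescaled truncated kernel -/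
noncomputable def Hk (K : ℕ) (r : ℝ) (u : ℝ) : ℂ :=
  if r < |u| ∧ |u| < 2 ^ K then (((2:ℝ) ^ K)⁻¹ : ℝ) * hilbertKernel (u / 2 ^ K) else 0

lemma kd_far (s : ℕ) {u : ℝ} (h : 2 ^ s ≤ |u|) : ‖gg (u / 2 ^ s)‖ / |u| ≤ 2 * 3 ^ 8 * kd s 2 u := by
  have hA : (0:ℝ) < 2 ^ s := by positivity
  have hu : 0 < |u| := by linarith
  have hb := gg_bound (u / 2 ^ s)
  rw [← wt_eq] at hb
  have hw := wt_inv_nonneg s u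
  have hw1 := wt_inv_le_one s u
  have h2 : 1 / |u| ≤ 2 * ((2 ^ s)⁻¹ * (wt s u)⁻¹) := by
    rw [← mul_inv, ← div_eq_mul_inv, div_le_div_iff₀ hu (by have := wt_pos s u; positivity)]
    unfold wt
    field_simp
    linarith
  have h3 : (wt s u)⁻¹ ^ 8 ≤ (wt s u)⁻¹ := pow_le_of_le_one hw hw1 (by norm_num)
  calc _ = ‖gg (u / 2 ^ s)‖ * (1 / |u|) := by ring
    _ ≤ (3 ^ 8 * (wt s u)⁻¹ ^ 8) * (2 * ((2 ^ s)⁻¹ * (wt s u)⁻¹)) := by gcongr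
    _ ≤ (3 ^ 8 * (wt s u)⁻¹) * (2 * ((2 ^ s)⁻¹ * (wt s u)⁻¹)) := by gcongr
    _ = _ := by unfold kd; ring

lemma kd_near (s : ℕ) {u : ℝ} (h : |u| ≤ 2 * 2 ^ s) : ((2:ℝ) ^ s)⁻¹ ≤ 9 * kd s 2 u := by
  have hA : (0:ℝ) < 2 ^ s := by positivity
  unfold kd
  have h1 : wt s u ≤ 3 := by
    unfold wt
    have : |u| / 2 ^ s ≤ 2 := by rw [div_le_iff₀ hA]; exact h
    linarith
  have h2 : (3:ℝ)⁻¹ ≤ (wt s u)⁻¹ := inv_anti₀ (wt_pos s u) h1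
  have h3 : ((3:ℝ)⁻¹) ^ 2 ≤ (wt s u)⁻¹ ^ 2 := by gcongr
  calc ((2:ℝ) ^ s)⁻¹ = 9 * ((2 ^ s)⁻¹ * ((3:ℝ)⁻¹) ^ 2) := by ring
    _ ≤ _ := by gcongr

lemma gg_near (s : ℕ) {u : ℝ} (hu : u ≠ 0) (h : |u| ≤ 2 * 2 ^ s) : ‖gg (u / 2 ^ s) - 1‖ / |u| ≤ 3 ^ 12 * 9 * kd s 2 u := by
  have h1 := gg_sub_one (u / 2 ^ s)
  have hp : 0 < |u| := abs_pos.2 hu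
  have hA : (0:ℝ) < 2 ^ s := by positivity
  rw [abs_div, abs_of_pos hA] at h1
  calc _ ≤ (3 ^ 12 * (|u| / 2 ^ s)) / |u| := by gcongr
    _ = 3 ^ 12 * (2 ^ s)⁻¹ := by field_simp
    _ ≤ 3 ^ 12 * (9 * kd s 2 u) := by have := kd_near s h; gcongr
    _ = _ := by ring

lemma Hk_bound {K a : ℕ} (haK : a ≤ K) {r : ℝ} (h1 : 2 ^ a ≤ r) (h2 : r ≤ 2 * 2 ^ a) (h3 : r ≤ 2 ^ K) {u : ℝ} (hu : u ≠ 0) :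
    ‖Hk K r u - I * ∑ s ∈ Finset.Ico a K, ps s u‖ ≤ 2 ^ 24 * (kd a 2 u + kd K 2 u) := by
  have hp : 0 < |u| := abs_pos.2 hu
  have huc : (u:ℂ) ≠ 0 := by exact_mod_cast hu
  have hD : (0:ℝ) < 2 ^ K := by positivity
  have ka := kd_nonneg a 2 u
  have kK := kd_nonneg K 2 u
  rw [sum_ps a K haK hu]
  unfold Hk
  have n1 : ‖(u:ℂ)‖ = |u| := by rw [Complex.norm_real, Real.norm_eq_abs]
  by_cases c1 : r < |u|
  · have fa := kd_far a (h1.trans c1.le)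
    by_cases c2 : |u| < 2 ^ K
    · rw [if_pos ⟨c1, c2⟩]
      have b1 := gg_near K hu (by linarith)
      have e : |u / 2 ^ K| = |u| / 2 ^ K := by rw [abs_div, abs_of_pos hD]
      have b2 := hk_bound (t := u / 2 ^ K) (by rw [e]; positivity) (by rw [e, div_lt_one hD]; exact c2)
      have b3 := kd_near K (u := u) (by linarith)
      have e2 : (((2:ℝ) ^ K)⁻¹ : ℝ) * hilbertKernel (u / 2 ^ K) - I * ((gg (u / 2 ^ K) - gg (u / 2 ^ a)) / u) =
          (((2:ℝ) ^ K)⁻¹ : ℝ) * (hilbertKernel (u / 2 ^ K) - I / (u / 2 ^ K : ℝ)) - I * ((gg (u / 2 ^ K) - 1) / u) + I * (gg (u / 2 ^ a) / u) := by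
        push_cast; field_simp; ring
      rw [e2]
      refine (norm_add_le _ _).trans ((add_le_add_left (norm_sub_le _ _) _).trans ?_)
      rw [norm_mul, norm_mul, norm_mul, norm_div, norm_div, Complex.norm_I, one_mul, one_mul, n1, Complex.norm_real, Real.norm_of_nonneg (by positivity)]
      have b4 : ((2:ℝ) ^ K)⁻¹ * ‖hilbertKernel (u / 2 ^ K) - I / (u / 2 ^ K : ℝ)‖ ≤ (9 * kd K 2 u) * 4 := by gcongr
      linarith
    · rw [if_neg (by tauto), zero_sub, norm_neg, norm_mul, norm_div, Complex.norm_I, one_mul, n1]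
      have fK := kd_far K (not_lt.1 c2)
      have := norm_sub_le (gg (u / 2 ^ K)) (gg (u / 2 ^ a))
      calc _ ≤ (‖gg (u / 2 ^ K)‖ + ‖gg (u / 2 ^ a)‖) / |u| := by gcongr
        _ = ‖gg (u / 2 ^ K)‖ / |u| + ‖gg (u / 2 ^ a)‖ / |u| := add_div _ _ _
        _ ≤ _ := by linarith
  · rw [if_neg (by tauto), zero_sub, norm_neg, norm_mul, norm_div, Complex.norm_I, one_mul, n1]
    have b1 := gg_near K hu (by linarith)
    have b2 := gg_near a hu (by linarith)
    have := norm_sub_le (gg (u / 2 ^ K) - 1) (gg (u / 2 ^ a) - 1)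
    rw [sub_sub_sub_cancel_right] at this
    calc _ ≤ (‖gg (u / 2 ^ K) - 1‖ + ‖gg (u / 2 ^ a) - 1‖) / |u| := by gcongr
      _ = ‖gg (u / 2 ^ K) - 1‖ / |u| + ‖gg (u / 2 ^ a) - 1‖ / |u| := add_div _ _ _
      _ ≤ _ := by linarith
end Carl

namespace Carl
open Complex (I)

noncomputable def tsum' (f : ℝ → ℂ) (K : ℕ) (p : ℝ × ℕ) (x : ℝ) : ℂ := ∑ s ∈ (Finset.Ico 1 K).filter (p.2 ≤ ·), uu f s p.1 x

lemma trunc_main {f : ℝ → ℂ} (hf : Integrable f) (hfm : Measurable f) {K a : ℕ} (ha1 : 1 ≤ a) (haK : a ≤ K) {r : ℝ} (h1 : 2 ^ a ≤ r) (h2 : r ≤ 2 * 2 ^ a) (h3 : r ≤ 2 ^ K)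
    (n x : ℝ) : ‖∫ y, f y * (Complex.exp (I * n * y) * Hk K r (x - y))‖ₑ ≤ ‖tsum' f K (n, a) x‖ₑ + 2 ^ 28 * MM (fun y => ‖f y‖ₑ) x := by
  by_cases hi : Integrable (fun y => f y * (Complex.exp (I * n * y) * Hk K r (x - y)))
  swap
  · rw [integral_undef hi]; simp
  have hps : ∀ s, Integrable (fun y => f y * (Complex.exp (I * n * y) * ps s (x - y))) := by
    intro s
    refine int_mul_bdd hf (C := 2 ^ 38) ?_ fun y => ?_
    · have := ps_continuous s; fun_prop
    · rw [norm_mul, norm_expI, one_mul]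
      exact (ps_bound s _).trans (by have := kd_le_one s 6 (x - y); linarith)
  have hsum : I * tsum' f K (n, a) x = ∫ y, I * ∑ s ∈ Finset.Ico a K, f y * (Complex.exp (I * n * y) * ps s (x - y)) := by
    rw [integral_const_mul, integral_finsetSum _ fun s _ => hps s]
    unfold tsum' uu
    congr 2
    ext s; simp; omega
  have hi2 : Integrable (fun y => I * ∑ s ∈ Finset.Ico a K, f y * (Complex.exp (I * n * y) * ps s (x - y))) :=
    (integrable_finsetSum _ fun s _ => hps s).const_mul _
  have e : ∫ y, f y * (Complex.exp (I * n * y) * Hk K r (x - y)) =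
      I * tsum' f K (n, a) x + ∫ y, f y * (Complex.exp (I * n * y) * (Hk K r (x - y) - I * ∑ s ∈ Finset.Ico a K, ps s (x - y))) := by
    rw [hsum, ← integral_add hi2]
    · congr 1; ext y
      rw [← Finset.mul_sum, ← Finset.mul_sum]; ring
    · have := hi.sub hi2
      refine this.congr (Filter.Eventually.of_forall fun y => ?_)
      simp only [Pi.sub_apply]
      rw [← Finset.mul_sum, ← Finset.mul_sum]; ring
  rw [e]
  refine (enorm_add_le _ _).trans (add_le_add ?_ ?_)
  · rw [enorm_mul, ← ofReal_norm I, Complex.norm_I, ENNReal.ofReal_one, one_mul]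
  · refine (enorm_integral_le_lintegral_enorm _).trans ?_
    have hmf : Measurable (fun y => ‖f y‖ₑ) := hfm.enorm
    have mk : ∀ s, Measurable (fun y => ENNReal.ofReal (kd s 2 (x - y)) * ‖f y‖ₑ) := by
      intro s
      have : Measurable (fun y => kd s 2 (x - y)) := ((kd_continuous s 2).comp (by fun_prop : Continuous fun y => x - y)).measurable
      exact this.ennreal_ofReal.mul hmf
    calc _ ≤ ∫⁻ y, 2 ^ 24 * (ENNReal.ofReal (kd a 2 (x - y)) * ‖f y‖ₑ + ENNReal.ofReal (kd K 2 (x - y)) * ‖f y‖ₑ) := by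
          refine lintegral_mono_ae ?_
          have hne : ∀ᵐ y : ℝ, y ≠ x := by
            rw [ae_iff]; simp
          filter_upwards [hne] with y hy
          have hb := Hk_bound haK h1 h2 h3 (sub_ne_zero.2 hy.symm)
          rw [enorm_mul, enorm_mul]
          have e1 : ‖Complex.exp (I * n * y)‖ₑ = 1 := by rw [← ofReal_norm, norm_expI]; simp
          rw [e1, one_mul, ← ofReal_norm (Hk _ _ _ - _)]
          calc _ ≤ ‖f y‖ₑ * ENNReal.ofReal (2 ^ 24 * (kd a 2 (x - y) + kd K 2 (x - y))) := by gcongr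
            _ = _ := by
              rw [ENNReal.ofReal_mul (by positivity), ENNReal.ofReal_add (kd_nonneg _ _ _) (kd_nonneg _ _ _)]
              rw [show ENNReal.ofReal (2 ^ 24) = 2 ^ 24 by rw [ENNReal.ofReal_pow (by norm_num)]; simp]
              ring
      _ = 2 ^ 24 * ((∫⁻ y, ENNReal.ofReal (kd a 2 (x - y)) * ‖f y‖ₑ) + ∫⁻ y, ENNReal.ofReal (kd K 2 (x - y)) * ‖f y‖ₑ) := by
          rw [lintegral_const_mul' _ _ (by norm_num), lintegral_add_left (mk a)]
      _ ≤ 2 ^ 24 * (8 * MM (fun y => ‖f y‖ₑ) x + 8 * MM (fun y => ‖f y‖ₑ) x) := by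
          gcongr <;> exact kd_MM _ hmf _ _
      _ = _ := by ring

lemma trunc {f : ℝ → ℂ} (hf : Integrable f) (hfm : Measurable f) {K : ℕ} {r : ℝ} (hr : 2 ≤ r) (n x : ℝ) :
    ∃ a ∈ Finset.range (K + 1), ‖∫ y, f y * (Complex.exp (I * n * y) * Hk K r (x - y))‖ₑ ≤ ‖tsum' f K (n, a) x‖ₑ + 2 ^ 28 * MM (fun y => ‖f y‖ₑ) x := by
  by_cases h : 2 ^ K ≤ r
  · refine ⟨0, by simp, ?_⟩
    have : ∀ y, Hk K r (x - y) = 0 := by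
      intro y; unfold Hk; rw [if_neg]; rintro ⟨h1, h2⟩; linarith
    simp [this]
  · push Not at h
    obtain ⟨a, h1, h2⟩ := exists_nat_pow_near (x := r) (y := 2) (by linarith) (by norm_num)
    rw [pow_succ] at h2
    have haK : a < K := by
      by_contra hc
      have : (2:ℝ) ^ K ≤ 2 ^ a := pow_le_pow_right₀ (by norm_num) (by omega)
      linarith
    have ha : 1 ≤ a := by
      by_contra hc
      have : a = 0 := by omega
      subst this; norm_num at h2; linarith
    exact ⟨a, by simp; omega, trunc_main hf hfm ha haK.le h1 (by linarith) h.le n x⟩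

lemma argmax {s : Finset (ℝ × ℕ)} (hs : s.Nonempty) {h : ℝ × ℕ → ℝ → ℝ≥0∞} (hm : ∀ p, Measurable (h p)) :
    ∃ σ : ℝ → ℝ × ℕ, Measurable σ ∧ Measurable (fun x => h (σ x) x) ∧ (∀ x, σ x ∈ s) ∧ ∀ x, ∀ p ∈ s, h p x ≤ h (σ x) x := by
  classical
  induction hs using Finset.Nonempty.cons_induction with
  | singleton a => exact ⟨fun _ => a, measurable_const, hm a, by simp, by simp⟩
  | cons a t ha ht ih =>
    obtain ⟨σ, h1, h2, h3, h4⟩ := ih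
    have hset : MeasurableSet {x | h (σ x) x ≤ h a x} := measurableSet_le h2 (hm a)
    refine ⟨fun x => if h (σ x) x ≤ h a x then a else σ x, Measurable.ite hset measurable_const h1, ?_, ?_, ?_⟩
    · have : (fun x => h (if h (σ x) x ≤ h a x then a else σ x) x) = fun x => if h (σ x) x ≤ h a x then h a x else h (σ x) x := by
        ext x; split_ifs <;> rfl
      rw [this]
      exact Measurable.ite hset (hm a) h2
    · intro x; simp only; split_ifs
      · simp
      · simp [h3 x]
    · intro x p hp
      simp only
      rw [Finset.mem_cons] at hp
      split_ifs with hc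
      · rcases hp with rfl | hp
        · exact le_rfl
        · exact (h4 x p hp).trans hc
      · rcases hp with rfl | hp
        · exact (not_le.1 hc).le
        · exact h4 x p hp

lemma rt_eq {v : ℝ≥0∞} (hv : v ≠ ⊤) : ENNReal.ofReal (√ v.toReal) = v ^ (1 / 2 : ℝ) := by
  rw [Real.sqrt_eq_rpow, ← ENNReal.ofReal_rpow_of_nonneg ENNReal.toReal_nonneg (by norm_num), ENNReal.ofReal_toReal hv]

lemma measurable_tsum' {f : ℝ → ℂ} (hf : Integrable f) (K : ℕ) (p : ℝ × ℕ) : Measurable (tsum' f K p) := by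
  unfold tsum'
  refine Finset.measurable_sum _ fun s _ => ?_
  exact (uu_BL hf s p.1).continuous.measurable

section
variable {F : Set ℝ} {f : ℝ → ℂ}

lemma f_int (hF : MeasurableSet F) (hFf : volume F ≠ ⊤) (hfm : Measurable f) (hf : ∀ x, ‖f x‖ ≤ F.indicator 1 x) : Integrable f := by
  have h1 : Integrable (F.indicator (1 : ℝ → ℝ)) := (integrable_indicator_iff hF).2 (integrableOn_const (C := (1:ℝ)) hFf)
  exact h1.mono' hfm.aestronglyMeasurable (Filter.Eventually.of_forall hf)

lemma f_le1 (hf : ∀ x, ‖f x‖ ≤ F.indicator 1 x) (x : ℝ) : ‖f x‖ ≤ 1 :=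
  (hf x).trans (Set.indicator_le_self' (by simp) x)

lemma f_sq (hf : ∀ x, ‖f x‖ ≤ F.indicator 1 x) (x : ℝ) : ‖f x‖ₑ ^ 2 ≤ F.indicator 1 x := by
  by_cases hx : x ∈ F
  · have := f_le1 hf x
    rw [Set.indicator_of_mem hx, ← ofReal_norm]
    exact pow_le_one' (ENNReal.ofReal_le_one.2 this) 2
  · have := hf x
    rw [Set.indicator_of_notMem hx] at this ⊢
    rw [norm_le_zero_iff.1 this]; simp

lemma f_l2 (hF : MeasurableSet F) (hf : ∀ x, ‖f x‖ ≤ F.indicator 1 x) : ∫⁻ x, ‖f x‖ₑ ^ 2 ≤ volume F :=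
  (lintegral_mono (f_sq hf)).trans (by rw [lintegral_indicator_one hF])

lemma f_mem (hF : MeasurableSet F) (hFf : volume F ≠ ⊤) (hfm : Measurable f) (hf : ∀ x, ‖f x‖ ≤ F.indicator 1 x) : MemLp f 2 := by
  refine ⟨hfm.aestronglyMeasurable, ?_⟩
  rw [eLpNorm_lt_top_iff_lintegral_rpow_enorm_lt_top (by norm_num) (by norm_num)]
  simpa using (f_l2 hF hf).trans_lt hFf.lt_top

end
end Carl

namespace Carl
open Complex (I)

lemma Dy_range {x : ℝ} {R : ℕ} (hx : |x| ≤ R) (s : ℕ) : -((R:ℤ) + 1) ≤ Dy x s ∧ Dy x s ≤ R + 1 := by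
  have hx2 := abs_le.1 hx
  have hp : (1:ℝ) ≤ 2 ^ s := one_le_pow₀ (by norm_num)
  have hp0 : (0:ℝ) < 2 ^ s := by positivity
  have h1 : |x / 2 ^ s| ≤ R := by
    rw [abs_div, abs_of_pos hp0]
    exact (div_le_self (abs_nonneg x) hp).trans hx
  obtain ⟨h2, h3⟩ := abs_le.1 h1
  unfold Dy
  constructor
  · rw [Int.le_floor]; push_cast; linarith
  · have := Int.floor_le (x / 2 ^ s)
    have h4 : ((⌊x / 2 ^ s⌋ : ℤ) : ℝ) ≤ ((R + 1 : ℤ) : ℝ) := by push_cast; linarith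
    exact_mod_cast h4

lemma Lsum_U (d : Dat) {x : ℝ} (hx : x ∈ d.G) : d.Lsum d.U x = tsum' d.f d.S (d.N x, d.s0 x) x := by
  unfold Dat.Lsum tsum'
  refine Finset.sum_congr ?_ fun _ _ => rfl
  ext s
  rw [mem_Sx]
  simp only [Finset.mem_filter, Finset.mem_Ico]
  constructor
  · rintro ⟨h1, h2, h3⟩; exact ⟨h1, h3⟩
  · rintro ⟨h1, h3⟩
    refine ⟨h1, ?_, h3⟩
    unfold Dat.tl
    rw [Dat.mem_U, Dat.mem_V]
    exact ⟨⟨h1, Dy_range (d.hR x hx) s⟩, d.hNF x⟩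

section
variable {F G : Set ℝ} {f : ℝ → ℂ}

lemma max_bound (hF : MeasurableSet F) (hG : MeasurableSet G) (hFf : volume F ≠ ⊤) (hGf : volume G ≠ ⊤) (hF0 : volume F ≠ 0)
    (hfm : Measurable f) (hf : ∀ x, ‖f x‖ ≤ F.indicator 1 x) {R : ℕ} (hR : ∀ x ∈ G, |x| ≤ R) {Fr : Finset ℝ} (hFr : Fr.Nonempty) (K : ℕ) :
    ∫⁻ x in G, (Fr ×ˢ Finset.range (K + 1)).sup (fun p => ‖tsum' f K p x‖ₑ) ≤ 2 ^ 258 * (volume F ^ (1 / 2 : ℝ) * volume G ^ (1 / 2 : ℝ)) := by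
  by_cases hG0 : volume G = 0
  · rw [setLIntegral_measure_zero _ _ hG0]; exact bot_le
  have hfi := f_int hF hFf hfm hf
  have hm : ∀ p : ℝ × ℕ, Measurable (fun x => ‖tsum' f K p x‖ₑ) := fun p => (measurable_tsum' hfi K p).enorm
  obtain ⟨σ, s1, s2, s3, s4⟩ := argmax (s := Fr ×ˢ Finset.range (K + 1)) (hFr.product (by simp)) (h := fun p x => ‖tsum' f K p x‖ₑ) hm
  have hfr : ∀ x, (σ x).1 ∈ Fr := fun x => (Finset.mem_product.1 (s3 x)).1
  obtain ⟨d, hd1, hd2, hd3, hd4, hd5⟩ : ∃ d : Dat, d.f = f ∧ d.G = G ∧ d.S = K ∧ (d.N = fun x => (σ x).1) ∧ (d.s0 = fun x => (σ x).2) :=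
    ⟨⟨f, hfi, f_mem hF hFf hfm hf, G, hG, hGf, fun x => (σ x).1, measurable_fst.comp s1, Fr, hfr, fun x => (σ x).2, measurable_snd.comp s1, K, R, hR⟩, rfl, rfl, rfl, rfl, rfl⟩
  obtain ⟨A, hA⟩ : ∃ A, A = √ (volume F).toReal := ⟨_, rfl⟩
  obtain ⟨B, hB⟩ : ∃ B, B = √ (volume G).toReal := ⟨_, rfl⟩
  have hA0 : 0 < A := by rw [hA]; exact Real.sqrt_pos.2 (ENNReal.toReal_pos hF0 hFf)
  have hB0 : 0 < B := by rw [hB]; exact Real.sqrt_pos.2 (ENNReal.toReal_pos hG0 hGf)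
  have hA2 : A ^ 2 = (volume F).toReal := by rw [hA]; exact Real.sq_sqrt ENNReal.toReal_nonneg
  have hB2 : B ^ 2 = (volume G).toReal := by rw [hB]; exact Real.sq_sqrt ENNReal.toReal_nonneg
  have key := d.discrete (e := A / B) (by positivity) (by
    rw [hd1, hd2, ← hB2, div_pow, div_mul_cancel₀ _ (by positivity), hA2]
    have h1 := lint_sq (f_mem hF hFf hfm hf)
    have h2 := f_l2 hF hf
    rw [h1] at h2
    exact (ENNReal.ofReal_le_iff_le_toReal hFf).1 h2)
  have e1 : A / B * (volume d.G).toReal = A * B := by rw [hd2, ← hB2]; field_simp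
  rw [e1] at key
  calc _ ≤ d.Lop d.U := by
        unfold Dat.Lop
        rw [hd2]
        refine setLIntegral_mono' hG fun x hx => ?_
        rw [Lsum_U d (by rw [hd2]; exact hx), hd1, hd3, hd4, hd5]
        exact Finset.sup_le fun p hp => s4 x p hp
    _ ≤ _ := key
    _ = _ := by
        rw [ENNReal.ofReal_mul (p := 2 ^ 258) (pow_nonneg zero_le_two 258), ENNReal.ofReal_mul hA0.le, hA, hB, rt_eq hFf, rt_eq hGf, ENNReal.ofReal_pow zero_le_two]
        simp

lemma MM_bound (hF : MeasurableSet F)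
    (hfm : Measurable f) (hf : ∀ x, ‖f x‖ ≤ F.indicator 1 x) :
    ∫⁻ x in G, MM (fun y => ‖f y‖ₑ) x ≤ 2 ^ 5 * (volume F ^ (1 / 2 : ℝ) * volume G ^ (1 / 2 : ℝ)) := by
  have hmf : Measurable (fun y => ‖f y‖ₑ) := hfm.enorm
  have h1 := sq_setLIntegral_le G (measurable_MM hmf)
  have h2 := MM_L2 hmf (fun x => enorm_ne_top)
  have sq : ∀ v : ℝ≥0∞, (v ^ (1 / 2 : ℝ)) ^ 2 = v := by
    intro v; rw [← ENNReal.rpow_natCast, ← ENNReal.rpow_mul]; norm_num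
  refine (ENNReal.pow_le_pow_left_iff two_ne_zero).1 ?_
  calc _ ≤ _ := h1
    _ ≤ volume G * (512 * volume F) := by gcongr; exact h2.trans (by gcongr; exact f_l2 hF hf)
    _ ≤ volume G * (1024 * volume F) := by gcongr; norm_num
    _ = (2 ^ 5) ^ 2 * ((volume F ^ (1 / 2 : ℝ)) ^ 2 * (volume G ^ (1 / 2 : ℝ)) ^ 2) := by rw [sq, sq]; ring
    _ = _ := by ring

/-- combined majorant -/
noncomputable def bb (f : ℝ → ℂ) (Fr : Finset ℝ) (K : ℕ) (x : ℝ) : ℝ≥0∞ :=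
  (Fr ×ˢ Finset.range (K + 1)).sup (fun p => ‖tsum' f K p x‖ₑ) + 2 ^ 28 * MM (fun y => ‖f y‖ₑ) x

lemma measurable_bb (hfi : Integrable f) (hfm : Measurable f) (Fr : Finset ℝ) (K : ℕ) : Measurable (bb f Fr K) := by
  unfold bb
  refine Measurable.add ?_ ((measurable_MM hfm.enorm).const_mul _)
  simp only [Finset.sup_eq_iSup]
  exact Measurable.biSup _ (Finset.countable_toSet _) fun p _ => (measurable_tsum' hfi K p).enorm

lemma bb_bound (hF : MeasurableSet F) (hG : MeasurableSet G) (hFf : volume F ≠ ⊤) (hGf : volume G ≠ ⊤) (hF0 : volume F ≠ 0)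
    (hfm : Measurable f) (hf : ∀ x, ‖f x‖ ≤ F.indicator 1 x) {R : ℕ} (hR : ∀ x ∈ G, |x| ≤ R) {Fr : Finset ℝ} (hFr : Fr.Nonempty) (K : ℕ) :
    ∫⁻ x in G, bb f Fr K x ≤ 2 ^ 259 * (volume F ^ (1 / 2 : ℝ) * volume G ^ (1 / 2 : ℝ)) := by
  unfold bb
  rw [lintegral_add_right _ ((measurable_MM hfm.enorm).const_mul _), lintegral_const_mul _ (measurable_MM hfm.enorm)]
  have h1 := max_bound hF hG hFf hGf hF0 hfm hf hR hFr K
  have h2 := MM_bound (G := G) hF hfm hf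
  obtain ⟨X, hX⟩ : ∃ X, X = volume F ^ (1 / 2 : ℝ) * volume G ^ (1 / 2 : ℝ) := ⟨_, rfl⟩
  rw [← hX] at h1 h2 ⊢
  calc _ ≤ 2 ^ 258 * X + 2 ^ 28 * (2 ^ 5 * X) := by gcongr
    _ = 2 ^ 258 * X + 2 ^ 33 * X := by ring
    _ ≤ 2 ^ 258 * X + 2 ^ 258 * X := by
        gcongr
        · norm_num
        · norm_num
    _ = _ := by rw [pow_succ (2:ℝ≥0∞) 258, ← two_mul]; ring

lemma bb_ge (hfi : Integrable f) (hfm : Measurable f) {Fr : Finset ℝ} {K : ℕ} {n : ℝ} (hn : n ∈ Fr) {r : ℝ} (hr : 2 ≤ r) (x : ℝ) :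
    ‖∫ y, f y * (Complex.exp (I * n * y) * Hk K r (x - y))‖ₑ ≤ bb f Fr K x := by
  obtain ⟨a, ha, h⟩ := trunc hfi hfm (K := K) hr n x
  refine h.trans ?_
  unfold bb
  gcongr
  exact Finset.le_sup (f := fun p => ‖tsum' f K p x‖ₑ) (Finset.mem_product.2 ⟨hn, ha⟩)

end

lemma rescale (f : ℝ → ℂ) (K : ℕ) (n : ℤ) (r x : ℝ) :
    ∫ y in {y : ℝ | r < |x - y| ∧ |x - y| < 1}, f y * hilbertKernel (x - y) * Complex.exp (Complex.I * (n : ℂ) * (y : ℂ)) =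
      ∫ Y, f ((2 ^ K)⁻¹ * Y) * (Complex.exp (I * ((n * (2 ^ K)⁻¹ : ℝ) : ℂ) * Y) * Hk K (2 ^ K * r) (2 ^ K * x - Y)) := by
  have hD : (0:ℝ) < 2 ^ K := by positivity
  have hms : MeasurableSet {y : ℝ | r < |x - y| ∧ |x - y| < 1} := by
    have hc : Continuous fun y : ℝ => |x - y| := by fun_prop
    exact (measurableSet_lt measurable_const hc.measurable).inter (measurableSet_lt hc.measurable measurable_const)
  rw [← integral_indicator hms]
  obtain ⟨g, hg⟩ : ∃ g : ℝ → ℂ, g = Set.indicator {y : ℝ | r < |x - y| ∧ |x - y| < 1} fun y => f y * hilbertKernel (x - y) * Complex.exp (Complex.I * (n : ℂ) * (y : ℂ)) := ⟨_, rfl⟩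
  rw [← hg]
  have h1 := Measure.integral_comp_mul_left g ((2:ℝ) ^ K)⁻¹
  rw [inv_inv, abs_of_pos hD] at h1
  have h2 : ∫ y, g y = (((2:ℝ) ^ K)⁻¹ : ℝ) * ∫ Y, g ((2 ^ K)⁻¹ * Y) := by
    rw [h1, Complex.real_smul]; push_cast; field_simp
  rw [h2, ← integral_const_mul]
  congr 1; ext Y
  rw [hg]
  have e0 : x - (2 ^ K)⁻¹ * Y = (2 ^ K * x - Y) / 2 ^ K := by field_simp
  have e1 : |x - (2 ^ K)⁻¹ * Y| = |2 ^ K * x - Y| / 2 ^ K := by rw [e0, abs_div, abs_of_pos hD]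
  unfold Hk
  by_cases hc : 2 ^ K * r < |2 ^ K * x - Y| ∧ |2 ^ K * x - Y| < 2 ^ K
  · rw [if_pos hc, Set.indicator_of_mem]
    · rw [← e0]; push_cast
      rw [show I * (n:ℂ) * ((2 ^ K)⁻¹ * (Y:ℂ)) = I * (n * (2 ^ K)⁻¹) * Y by ring]
      ring
    · rw [Set.mem_ofPred_eq, e1, lt_div_iff₀ hD, div_lt_one hD, mul_comm]; exact hc
  · rw [if_neg hc, Set.indicator_of_notMem]
    · simp
    · rw [Set.mem_ofPred_eq, e1, lt_div_iff₀ hD, div_lt_one hD, mul_comm r]; exact hc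

end Carl

namespace Carl
open Complex (I)

noncomputable def frq (K : ℕ) : Finset ℝ := (Finset.Icc (-(K:ℤ)) K).image fun n : ℤ => (n:ℝ) * (2 ^ K)⁻¹

noncomputable def hh (f : ℝ → ℂ) (G : Set ℝ) (K : ℕ) : ℝ → ℝ≥0∞ :=
  (G ∩ Set.Icc (-(K:ℝ)) K).indicator fun x => bb (fun Y => f ((2 ^ K)⁻¹ * Y)) (frq K) K (2 ^ K * x)

section
variable {F G : Set ℝ} {f : ℝ → ℂ}

lemma vol_pre (K : ℕ) (A : Set ℝ) : volume ((fun Y => ((2:ℝ) ^ K)⁻¹ * Y) ⁻¹' A) = 2 ^ K * volume A := by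
  rw [Real.volume_preimage_mul_left (by positivity), inv_inv, abs_of_pos (by positivity), ENNReal.ofReal_pow (by norm_num)]
  simp

lemma fs_le (hf : ∀ x, ‖f x‖ ≤ F.indicator 1 x) (K : ℕ) (Y : ℝ) :
    ‖f ((2 ^ K)⁻¹ * Y)‖ ≤ ((fun Y => ((2:ℝ) ^ K)⁻¹ * Y) ⁻¹' F).indicator 1 Y := hf _

lemma meas_mul (K : ℕ) : Measurable (fun Y : ℝ => ((2:ℝ) ^ K)⁻¹ * Y) := by fun_prop

lemma hh_measurable (hF : MeasurableSet F) (hG : MeasurableSet G) (hFf : volume F ≠ ⊤)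
    (hfm : Measurable f) (hf : ∀ x, ‖f x‖ ≤ F.indicator 1 x) (K : ℕ) : Measurable (hh f G K) := by
  have h1 : Measurable fun Y => f ((2 ^ K)⁻¹ * Y) := hfm.comp (meas_mul K)
  have h2 : volume ((fun Y => ((2:ℝ) ^ K)⁻¹ * Y) ⁻¹' F) ≠ ⊤ := by
    rw [vol_pre]; exact ENNReal.mul_ne_top (by simp) hFf
  have h3 := f_int (meas_mul K hF) h2 h1 (fs_le hf K)
  exact ((measurable_bb h3 h1 _ _).comp (by fun_prop)).indicator (hG.inter measurableSet_Icc)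

lemma hh_bound (hF : MeasurableSet F) (hG : MeasurableSet G) (hFf : volume F ≠ ⊤) (hGf : volume G ≠ ⊤) (hF0 : volume F ≠ 0)
    (hfm : Measurable f) (hf : ∀ x, ‖f x‖ ≤ F.indicator 1 x) (K : ℕ) :
    ∫⁻ x, hh f G K x ≤ 2 ^ 259 * (volume F ^ (1 / 2 : ℝ) * volume G ^ (1 / 2 : ℝ)) := by
  have hD : (0:ℝ) < 2 ^ K := by positivity
  have hm := hh_measurable hF hG hFf hfm hf K
  obtain ⟨A, hA⟩ : ∃ A, A = G ∩ Set.Icc (-(K:ℝ)) K := ⟨_, rfl⟩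
  have hAm : MeasurableSet A := by rw [hA]; exact hG.inter measurableSet_Icc
  have hAG : volume A ≤ volume G := by rw [hA]; exact measure_mono Set.inter_subset_left
  have h1 : Measurable fun Y => f ((2 ^ K)⁻¹ * Y) := hfm.comp (meas_mul K)
  have h2 : volume ((fun Y => ((2:ℝ) ^ K)⁻¹ * Y) ⁻¹' F) ≠ ⊤ := by
    rw [vol_pre]; exact ENNReal.mul_ne_top (by simp) hFf
  have h2' : volume ((fun Y => ((2:ℝ) ^ K)⁻¹ * Y) ⁻¹' F) ≠ 0 := by
    rw [vol_pre]; exact mul_ne_zero (by simp) hF0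
  have h3 : volume ((fun Y => ((2:ℝ) ^ K)⁻¹ * Y) ⁻¹' A) ≠ ⊤ := by
    rw [vol_pre]; exact ENNReal.mul_ne_top (by simp) (ne_top_of_le_ne_top hGf hAG)
  have hR : ∀ x ∈ ((fun Y => ((2:ℝ) ^ K)⁻¹ * Y) ⁻¹' A), |x| ≤ ((K * 2 ^ K : ℕ) : ℝ) := by
    intro x hx
    rw [Set.mem_preimage, hA] at hx
    have := abs_le.2 hx.2
    rw [abs_mul, abs_of_pos (by positivity), inv_mul_le_iff₀ hD] at this
    push_cast; linarith
  have hFr : (frq K).Nonempty := by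
    unfold frq; rw [Finset.image_nonempty]; exact ⟨0, by simp⟩
  have key := bb_bound (meas_mul K hF) (meas_mul K hAm) h2 h3 h2' h1 (fs_le hf K) hR hFr K
  rw [vol_pre, vol_pre] at key
  have e1 : ∫⁻ Y, hh f G K ((2 ^ K)⁻¹ * Y) = 2 ^ K * ∫⁻ x, hh f G K x := by
    have := lintegral_map hm (meas_mul K) (μ := volume)
    rw [← this, Real.map_volume_mul_left (by positivity), lintegral_smul_measure, inv_inv, abs_of_pos hD, ENNReal.ofReal_pow (by norm_num)]
    simp
  have e2 : ∫⁻ Y, hh f G K ((2 ^ K)⁻¹ * Y) = ∫⁻ Y in ((fun Y => ((2:ℝ) ^ K)⁻¹ * Y) ⁻¹' A), bb (fun Y => f ((2 ^ K)⁻¹ * Y)) (frq K) K Y := by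
    rw [← lintegral_indicator (meas_mul K hAm)]
    congr 1; ext Y
    unfold hh
    rw [← hA]
    by_cases hY : (2 ^ K)⁻¹ * Y ∈ A
    · rw [Set.indicator_of_mem hY, Set.indicator_of_mem (by exact hY), mul_inv_cancel_left₀ hD.ne']
    · rw [Set.indicator_of_notMem hY, Set.indicator_of_notMem (by exact hY)]
  rw [← e2, e1, ENNReal.mul_rpow_of_nonneg _ _ (by norm_num), ENNReal.mul_rpow_of_nonneg _ _ (by norm_num)] at key
  obtain ⟨q, hq⟩ : ∃ q : ℝ≥0∞, q = (2 ^ K : ℝ≥0∞) ^ (1 / 2 : ℝ) := ⟨_, rfl⟩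
  have hqq : q * q = 2 ^ K := by
    rw [hq, ← ENNReal.rpow_add_of_nonneg _ _ (by norm_num) (by norm_num)]; norm_num
  rw [← hq] at key
  have h5 : 2 ^ K * ∫⁻ x, hh f G K x ≤ 2 ^ K * (2 ^ 259 * (volume F ^ (1 / 2 : ℝ) * volume G ^ (1 / 2 : ℝ))) := by
    refine key.trans ?_
    calc _ ≤ 2 ^ 259 * ((q * volume F ^ (1 / 2 : ℝ)) * (q * volume G ^ (1 / 2 : ℝ))) := by gcongr
      _ = 2 ^ 259 * ((q * q) * (volume F ^ (1 / 2 : ℝ) * volume G ^ (1 / 2 : ℝ))) := by ring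
      _ = _ := by rw [hqq]; ring
  exact (ENNReal.mul_le_mul_iff_right (by simp) (by simp)).1 h5

lemma hh_ge (hF : MeasurableSet F) (hFf : volume F ≠ ⊤)
    (hfm : Measurable f) (hf : ∀ x, ‖f x‖ ≤ F.indicator 1 x) {x : ℝ} (hx : x ∈ G) (n : ℤ) {r : ℝ} (hr : 0 < r) :
    ∀ᶠ K : ℕ in Filter.atTop, ‖∫ y in {y : ℝ | r < |x - y| ∧ |x - y| < 1},
        f y * hilbertKernel (x - y) * Complex.exp (Complex.I * (n : ℂ) * (y : ℂ))‖ₑ ≤ hh f G K x := by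
  obtain ⟨k1, hk1⟩ := exists_nat_ge |x|
  obtain ⟨k2, hk2⟩ := pow_unbounded_of_one_lt (2 / r) (by norm_num : (1:ℝ) < 2)
  filter_upwards [Filter.eventually_ge_atTop (k1 + k2 + n.natAbs)] with K hK
  have h1 : Measurable fun Y => f ((2 ^ K)⁻¹ * Y) := hfm.comp (meas_mul K)
  have h2 : volume ((fun Y => ((2:ℝ) ^ K)⁻¹ * Y) ⁻¹' F) ≠ ⊤ := by
    rw [vol_pre]; exact ENNReal.mul_ne_top (by simp) hFf
  have h3 := f_int (meas_mul K hF) h2 h1 (fs_le hf K)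
  have hxK : x ∈ G ∩ Set.Icc (-(K:ℝ)) K := by
    refine ⟨hx, abs_le.1 (hk1.trans ?_)⟩
    exact_mod_cast (by omega : k1 ≤ K)
  unfold hh
  rw [Set.indicator_of_mem hxK, rescale f K n r x]
  refine bb_ge h3 h1 ?_ ?_ _
  · unfold frq
    refine Finset.mem_image.2 ⟨n, ?_, rfl⟩
    rw [Finset.mem_Icc]; omega
  · have : (2:ℝ) ^ k2 ≤ 2 ^ K := pow_le_pow_right₀ (by norm_num) (by omega)
    rw [div_lt_iff₀ hr] at hk2
    nlinarith

theorem final (hF : MeasurableSet F) (hG : MeasurableSet G) (hFf : volume F ≠ ⊤) (hGf : volume G ≠ ⊤)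
    (hfm : Measurable f) (hf : ∀ x, ‖f x‖ ≤ F.indicator 1 x) :
    ∫⁻ x in G, carlesonOperatorReal f x ≤ 2 ^ 259 * (volume F ^ (1 / 2 : ℝ) * volume G ^ (1 / 2 : ℝ)) := by
  by_cases hF0 : volume F = 0
  · have h0 : ∀ᵐ y, f y = 0 := by
      have : ∀ᵐ y, y ∉ F := measure_eq_zero_iff_ae_notMem.1 hF0
      filter_upwards [this] with y hy
      have := hf y
      rw [Set.indicator_of_notMem hy] at this
      exact norm_le_zero_iff.1 this
    have hz : ∀ x, carlesonOperatorReal f x = 0 := by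
      intro x
      unfold carlesonOperatorReal
      simp only [ENNReal.iSup_eq_zero]
      intro n r hr
      rw [integral_eq_zero_of_ae]
      · simp
      · filter_upwards [ae_restrict_of_ae h0] with y hy
        simp [hy]
    simp [hz]
  · rw [← lintegral_indicator hG]
    calc _ ≤ ∫⁻ x, Filter.liminf (fun K => hh f G K x) Filter.atTop := by
          refine lintegral_mono fun x => ?_
          by_cases hx : x ∈ G
          · rw [Set.indicator_of_mem hx]
            unfold carlesonOperatorReal
            refine iSup_le fun n => iSup_le fun r => iSup_le fun hr => ?_
            exact Filter.le_liminf_of_le (by isBoundedDefault) (hh_ge hF hFf hfm hf hx n hr)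
          · rw [Set.indicator_of_notMem hx]; exact bot_le
      _ ≤ Filter.liminf (fun K => ∫⁻ x, hh f G K x) Filter.atTop := lintegral_liminf_le fun K => hh_measurable hF hG hFf hfm hf K
      _ ≤ _ := by
          refine Filter.liminf_le_of_le (by isBoundedDefault) fun b hb => ?_
          obtain ⟨K, hK⟩ := hb.exists
          exact hK.trans (hh_bound hF hG hFf hGf hF0 hfm hf K)
end
end Carl

/-- **Carleson's theorem on the real line**: for Borel sets `F, G ⊆ ℝ` of finite measure and a
bounded measurable `f` with `|f| ≤ 1_F`, we have
`∫_G T f ≤ 2^{474·4³} |F|^{1/2} |G|^{1/2}`. -/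
theorem rcarleson {F G : Set ℝ} (hF : MeasurableSet F) (hG : MeasurableSet G)
    (hF_fin : volume F < ⊤) (hG_fin : volume G < ⊤)
    {f : ℝ → ℂ} (hf_meas : Measurable f) (hf : ∀ x, ‖f x‖ ≤ F.indicator 1 x) :
    ∫⁻ x in G, carlesonOperatorReal f x ≤
      2 ^ (474 * 4 ^ 3) * volume F ^ (1 / 2 : ℝ) * volume G ^ (1 / 2 : ℝ) := by
  have h := Carl.final hF hG hF_fin.ne hG_fin.ne hf_meas hf
  have h2 : (2:ℝ≥0∞) ^ 259 ≤ 2 ^ (474 * 4 ^ 3) := pow_le_pow_right₀ one_le_two (by norm_num)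
  rw [mul_assoc]
  exact h.trans (mul_le_mul_left h2 _)
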